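/- arXiv:1212.6949 — 2 statements merged into one kernel-verified Lean document; each statement's English description precedes it below -/
import Mathlib

section
/- Let K ≥ 2 be even. There exists a constant C_K > 0 such that for all real numbers x₁ < x₂ < ⋯ < x_K, the limit along even N → ∞ of 2^{−K} · (∏_{k=1}^K |S_{N−k}| π^{−(N−k)/2} e^{−x_k²}) · 𝔼_{N−K}[∏_{m=1}^K det(M − x_m I)] exists and equals C_K · ∫_{U(K)} exp(−(1/2) Tr((H − H^R)²)) dμ_H(U), where H = U X Uᴴ with X = diag(x₁,…,x_K), and μ_H is the Haar probability measure on the unitary group U(K). (This is the Haar-integral form of the paper's Theorem 3 on the K-point fixed-time modified density, obtained by dividing out the Vandermonde factor.) -/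
open MeasureTheory Matrix


/-- The measurable space structure on real matrices (the product σ-algebra on entries). -/
noncomputable instance matrixMeasurableSpace (N : ℕ) :
    MeasurableSpace (Matrix (Fin N) (Fin N) ℝ) :=
  inferInstanceAs (MeasurableSpace (Fin N → Fin N → ℝ))

/-- `ginibre N s` is the Gaussian probability measure `γ^N_s` on `N×N` real matrices under
which the `N²` entries are i.i.d. centered Gaussians of variance `s/2`; `ginibre N 1` is the
real Ginibre ensemble. -/
noncomputable def ginibre (N : ℕ) (s : ℝ) : Measure (Matrix (Fin N) (Fin N) ℝ) :=
  (Measure.pi fun _ : Fin N => Measure.pi fun _ : Fin N =>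
    ProbabilityTheory.gaussianReal 0 (Real.toNNReal (s / 2)) :
      Measure (Fin N → Fin N → ℝ))

/-- `sphereArea n = |S_n| = 2π^{(n+1)/2}/Γ((n+1)/2)`, the surface area of the unit sphere
`S^n ⊂ ℝ^{n+1}`. -/
noncomputable def sphereArea (n : ℕ) : ℝ :=
  2 * Real.pi ^ (((n : ℝ) + 1) / 2) / Real.Gamma (((n : ℝ) + 1) / 2)

/-- The canonical symplectic `K×K` matrix `J`: block diagonal with `K/2` blocks
`[[0,1],[−1,0]]`. -/
def sympJ (K : ℕ) : Matrix (Fin K) (Fin K) ℂ :=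
  Matrix.of fun i j =>
    if (j : ℕ) = (i : ℕ) + 1 ∧ (i : ℕ) % 2 = 0 then 1
    else if (i : ℕ) = (j : ℕ) + 1 ∧ (j : ℕ) % 2 = 0 then -1 else 0

/-- The Borel σ-algebra on the unitary group `U(K)`. -/
noncomputable instance unitaryGroupMeasurableSpace (K : ℕ) :
    MeasurableSpace (Matrix.unitaryGroup (Fin K) ℂ) := borel _

instance unitaryGroupBorelSpace (K : ℕ) :
    BorelSpace (Matrix.unitaryGroup (Fin K) ℂ) := ⟨rfl⟩




section Grass

/-- degree vanishing functional -/
noncomputable def topFunctional (d : ℕ) : ExteriorAlgebra ℂ (Fin d → ℂ) →ₗ[ℂ] ℂ :=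
  ExteriorAlgebra.liftAlternating
    (fun i => if h : d = i then
      ((Matrix.detRowAlternating (n := Fin d) (R := ℂ)).domDomCongr (finCongr h)) else 0)

lemma topFunctional_vanish (d k : ℕ) (h : d ≠ k) (a : ExteriorAlgebra ℂ (Fin d → ℂ))
    (ha : a ∈ (LinearMap.range (ExteriorAlgebra.ι ℂ (M := Fin d → ℂ))) ^ k) :
    topFunctional d a = 0 := by
  rw [← ExteriorAlgebra.exteriorPower, ← ExteriorAlgebra.ιMulti_span_fixedDegree] at ha
  induction ha using Submodule.span_induction with
  | mem x hx =>
    obtain ⟨v, rfl⟩ := hx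
    simp [topFunctional, ExteriorAlgebra.liftAlternating_apply_ιMulti, h]
  | zero => simp
  | add x y _ _ hx hy => simp [hx, hy]
  | smul c x _ hx => simp [hx]

lemma topFunctional_one (d : ℕ) :
    topFunctional d (ExteriorAlgebra.ιMulti ℂ d (fun i => Pi.single i 1)) = 1 := by
  rw [topFunctional, ExteriorAlgebra.liftAlternating_apply_ιMulti]
  simp
  have : (fun i : Fin d => (Pi.single i (1:ℂ) : Fin d → ℂ)) = (1 : Matrix (Fin d) (Fin d) ℂ) := by
    ext i j
    simp [Matrix.one_apply, Pi.single_apply, eq_comm]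
  rw [this]; exact Matrix.det_one

lemma ext_anticomm {V : Type} [AddCommGroup V] [Module ℂ V] (a b : V) :
    ExteriorAlgebra.ι ℂ a * ExteriorAlgebra.ι ℂ b =
      - (ExteriorAlgebra.ι ℂ b * ExteriorAlgebra.ι ℂ a) := by
  have := ExteriorAlgebra.ι_add_mul_swap (R := ℂ) a b
  exact eq_neg_of_add_eq_zero_left this

/-- Abstract package of the even Grassmann algebra. -/
structure GrassPack (I : Type) [Fintype I] (V C : Type) [AddCommGroup V] [Module ℂ V]
    [CommRing C] [Algebra ℂ C] where
  P : V →ₗ[ℂ] V →ₗ[ℂ] C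
  τ : C →ₗ[ℂ] ℂ
  χ : I → V
  ψ : I → V
  alt : ∀ v, P v v = 0
  exch : ∀ a b c d, P a b * P c d = - (P a c * P b d)
  vanish : ∀ {J : Type} (s : Finset J) (v w : J → V), s.card ≠ Fintype.card I →
    τ (∏ j ∈ s, P (v j) (w j)) = 0
  top : τ (∏ i, P (χ i) (ψ i)) = 1

abbrev evenSet (V : Type) [AddCommGroup V] [Module ℂ V] : Set (ExteriorAlgebra ℂ V) :=
  Set.range (fun p : V × V => ExteriorAlgebra.ι ℂ p.1 * ExteriorAlgebra.ι ℂ p.2)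

lemma evenSet_comm (V : Type) [AddCommGroup V] [Module ℂ V] :
    ∀ a ∈ evenSet V, ∀ b ∈ evenSet V, a * b = b * a := by
  rintro _ ⟨⟨a, b⟩, rfl⟩ _ ⟨⟨c, d⟩, rfl⟩
  simp only
  set i := ExteriorAlgebra.ι ℂ (M := V)
  calc i a * i b * (i c * i d) = i a * (i b * i c) * i d := by noncomm_ring
    _ = - (i a * i c * (i b * i d)) := by rw [ext_anticomm b c]; noncomm_ring
    _ = (i c * i a) * (i b * i d) := by rw [ext_anticomm a c]; noncomm_ring
    _ = - (i c * i a * i d * i b) := by rw [ext_anticomm b d]; noncomm_ring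
    _ = - (i c * (i a * i d) * i b) := by noncomm_ring
    _ = _ := by rw [ext_anticomm a d]; noncomm_ring

abbrev EvenAlg (V : Type) [AddCommGroup V] [Module ℂ V] := Algebra.adjoin ℂ (evenSet V)

set_option linter.deprecated false in
noncomputable instance evenAlgCommRing (V : Type) [AddCommGroup V] [Module ℂ V] :
    CommRing (EvenAlg V) :=
  Algebra.adjoinCommRingOfComm ℂ (evenSet_comm V)

noncomputable instance evenAlgAlgebra (V : Type) [AddCommGroup V] [Module ℂ V] :
    Algebra ℂ (EvenAlg V) := (EvenAlg V).algebra

noncomputable def pairMap (V : Type) [AddCommGroup V] [Module ℂ V] :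
    V →ₗ[ℂ] V →ₗ[ℂ] EvenAlg V :=
  LinearMap.mk₂ ℂ (fun v w => ⟨ExteriorAlgebra.ι ℂ v * ExteriorAlgebra.ι ℂ w,
      Algebra.subset_adjoin ⟨(v, w), rfl⟩⟩)
    (fun a b c => by apply Subtype.ext; simp [add_mul])
    (fun a b c => by apply Subtype.ext; simp)
    (fun a b c => by apply Subtype.ext; simp [mul_add])
    (fun a b c => by apply Subtype.ext; simp)

lemma coe_prod_even (V : Type) [AddCommGroup V] [Module ℂ V] {J : Type} (s : Finset J)
    (v w : J → V) :
    ((∏ j ∈ s, pairMap V (v j) (w j) : EvenAlg V) : ExteriorAlgebra ℂ V) ∈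
      (LinearMap.range (ExteriorAlgebra.ι ℂ (M := V))) ^ (s.card * 2) := by
  classical
  induction s using Finset.induction_on with
  | empty => simp
  | insert a s ha ih =>
    rw [Finset.prod_insert ha, Finset.card_insert_of_notMem ha, add_mul, one_mul, add_comm,
      pow_add]
    refine Submodule.mul_mem_mul ?_ ih
    rw [pow_two]
    exact Submodule.mul_mem_mul ⟨_, rfl⟩ ⟨_, rfl⟩

lemma coe_prod_ofFn (V : Type) [AddCommGroup V] [Module ℂ V] (N : ℕ) (f : Fin N → EvenAlg V) :
    ((∏ j, f j : EvenAlg V) : ExteriorAlgebra ℂ V) =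
      (List.ofFn (fun j => (f j : ExteriorAlgebra ℂ V))).prod := by
  induction N with
  | zero => simp
  | succ n ih => rw [Fin.prod_univ_succ, List.ofFn_succ, List.prod_cons, ← ih]; rfl

noncomputable def grassPack (I : Type) [Fintype I] :
    GrassPack I (Fin (Fintype.card I * 2) → ℂ) (EvenAlg (Fin (Fintype.card I * 2) → ℂ)) where
  P := pairMap _
  τ := (topFunctional _).comp (EvenAlg (Fin (Fintype.card I * 2) → ℂ)).val.toLinearMap
  χ := fun i => Pi.single (finProdFinEquiv (Fintype.equivFin I i, 0)) 1
  ψ := fun i => Pi.single (finProdFinEquiv (Fintype.equivFin I i, 1)) 1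
  alt := fun v => by apply Subtype.ext; simp [pairMap]
  exch := fun a b c d => by
    apply Subtype.ext
    simp only [pairMap, LinearMap.mk₂_apply]
    change ExteriorAlgebra.ι ℂ a * ExteriorAlgebra.ι ℂ b * (ExteriorAlgebra.ι ℂ c * ExteriorAlgebra.ι ℂ d)
      = - (ExteriorAlgebra.ι ℂ a * ExteriorAlgebra.ι ℂ c * (ExteriorAlgebra.ι ℂ b * ExteriorAlgebra.ι ℂ d))
    have := ext_anticomm b c
    rw [mul_assoc, ← mul_assoc (ExteriorAlgebra.ι ℂ b), this]
    noncomm_ring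
  vanish := fun s v w hs => by
    refine topFunctional_vanish _ (s.card * 2) ?_ _ (coe_prod_even _ s v w)
    omega
  top := by
    rw [← (Fintype.equivFin I).symm.prod_comp]
    simp only [LinearMap.comp_apply, Equiv.apply_symm_apply]
    refine Eq.trans ?_ (topFunctional_one (Fintype.card I * 2))
    congr 1
    refine (coe_prod_ofFn _ _ _).trans ?_
    rw [ExteriorAlgebra.ιMulti_apply, List.ofFn_mul, List.prod_flatten, List.map_ofFn]
    congr 2
    ext j
    have h0 : finProdFinEquiv (j, (0 : Fin 2)) = ⟨(j : ℕ) * 2, by omega⟩ := by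
      ext; simp [finProdFinEquiv, mul_comm]
    have h1 : finProdFinEquiv (j, (1 : Fin 2)) = ⟨(j : ℕ) * 2 + 1, by omega⟩ := by
      ext; simp [finProdFinEquiv, mul_comm, add_comm]
    simp [pairMap, List.ofFn_succ, h0, h1]

end Grass



section GrassExp

variable {I V C : Type} [Fintype I] [AddCommGroup V] [Module ℂ V] [CommRing C] [Algebra ℂ C]
  [Module ℚ C]

lemma nexp_sum {J : Type} (s : Finset J) (a : J → C) (h : ∀ j ∈ s, IsNilpotent (a j)) :
    IsNilpotent.exp (∑ j ∈ s, a j) = ∏ j ∈ s, IsNilpotent.exp (a j) := by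
  classical
  induction s using Finset.induction_on with
  | empty => simp
  | insert b s hb ih =>
    rw [Finset.sum_insert hb, Finset.prod_insert hb,
      IsNilpotent.exp_add_of_commute (Commute.all _ _) (h b (by simp)), ih]
    · intro j hj; exact h j (by simp [hj])
    · exact isNilpotent_sum (fun j hj => h j (by simp [hj]))

lemma nexp_sq (a : C) (h : a ^ 2 = 0) : IsNilpotent.exp a = 1 + a := by
  rw [IsNilpotent.exp_eq_sum h]
  simp [Finset.sum_range_succ]

lemma nilp_smul (c : ℂ) {a : C} (h : IsNilpotent a) : IsNilpotent (c • a) := by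
  rw [Algebra.smul_def]; exact Commute.isNilpotent_mul_left (Commute.all _ _) h

namespace GrassPack
variable (G : GrassPack I V C)

lemma P_sq (a b : V) : (G.P a b) ^ 2 = 0 := by
  rw [pow_two, G.exch, G.alt, zero_mul, neg_zero]

lemma P_nilp (a b : V) : IsNilpotent (G.P a b) := ⟨2, G.P_sq a b⟩

lemma P_swap (a b : V) : G.P a b = - G.P b a := by
  have := G.alt (a + b)
  simp only [map_add, LinearMap.add_apply, G.alt, zero_add, add_zero] at this
  exact eq_neg_of_add_eq_zero_right this

noncomputable def altMap {J : Type} [Fintype J] [DecidableEq J] (ξ : J → V) : V [⋀^J]→ₗ[ℂ] ℂ :=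
  { (G.τ.compMultilinearMap ((MultilinearMap.mkPiAlgebra ℂ J C).compLinearMap
      (fun j => G.P (ξ j)))) with
    map_eq_zero_of_eq' := by
      intro v i j hv hij
      simp only [MultilinearMap.toFun_eq_coe, LinearMap.compMultilinearMap_apply,
        MultilinearMap.compLinearMap_apply, MultilinearMap.mkPiAlgebra_apply]
      rw [← Finset.mul_prod_erase _ _ (Finset.mem_univ i),
        ← Finset.mul_prod_erase _ _ (Finset.mem_erase.2 ⟨hij.symm, Finset.mem_univ j⟩),
        ← mul_assoc, G.P_swap (ξ j), mul_neg, G.exch, hv, ]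
      have : G.P (ξ i) (v j) * G.P (v j) (ξ j) = 0 := by
        rw [G.P_swap (ξ i), neg_mul, G.exch, G.alt]; simp
      have h2 : G.P (ξ i) (v j) * G.P (v j) (ξ j) = - (G.P (ξ i) (v j) * G.P (v j) (ξ j)) := by
        rw [← G.exch]
      rw [← h2, this]; simp }

lemma altMap_apply {J : Type} [Fintype J] [DecidableEq J] (ξ v : J → V) :
    G.altMap ξ v = G.τ (∏ j, G.P (ξ j) (v j)) := rfl

lemma alt_det {J : Type} [Fintype J] [DecidableEq J] (ξ ξ' : J → V) (A : Matrix J J ℂ) :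
    G.τ (∏ α, G.P (ξ α) (∑ β, A α β • ξ' β)) = A.det * G.τ (∏ α, G.P (ξ α) (ξ' α)) := by
  let L : (J → ℂ) →ₗ[ℂ] V := Fintype.linearCombination ℂ ξ'
  have h := ((G.altMap ξ).compLinearMap L).eq_smul_basis_det (Pi.basisFun ℂ J)
  have h2 := congrArg (fun f => f A) h
  simp only [AlternatingMap.compLinearMap_apply, altMap_apply, AlternatingMap.smul_apply,
    Pi.basisFun_det, smul_eq_mul] at h2
  simp only [L, Fintype.linearCombination_apply, Pi.basisFun_apply] at h2
  simp only [Pi.single_apply, ite_smul, one_smul, zero_smul, Finset.sum_ite_eq, Finset.mem_univ, if_true, Finset.sum_ite_eq'] at h2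
  rw [mul_comm]
  exact h2

lemma exp_det {J : Type} [Fintype J] [DecidableEq J] (hJ : Fintype.card J = Fintype.card I)
    (ξ ξ' : J → V) (A : Matrix J J ℂ) :
    G.τ (IsNilpotent.exp (∑ α, ∑ β, A α β • G.P (ξ α) (ξ' β))) =
      A.det * G.τ (∏ α, G.P (ξ α) (ξ' α)) := by
  have h1 : ∀ α, ∑ β, A α β • G.P (ξ α) (ξ' β) = G.P (ξ α) (∑ β, A α β • ξ' β) := by
    intro α; simp
  simp only [h1]
  rw [nexp_sum _ _ (fun α _ => G.P_nilp _ _), ← G.alt_det]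
  simp only [nexp_sq _ (G.P_sq _ _)]
  rw [Finset.prod_one_add, map_sum, Finset.sum_eq_single Finset.univ]
  · intro s _ hs
    apply G.vanish
    rw [← hJ]
    intro h
    exact hs ((Finset.card_eq_iff_eq_univ _).1 h)
  · simp

end GrassPack
end GrassExp



section HasMeanSec

variable {C : Type} [CommRing C] [Algebra ℂ C]

/-- `f` is a finite combination of integrable functions, with integral `a`. -/
def HasMean {Ω : Type} [MeasurableSpace Ω] (μ : Measure Ω) (f : Ω → C) (a : C) : Prop :=
  ∃ (κ : Type) (_ : Fintype κ) (g : κ → Ω → ℂ) (c : κ → C), (∀ k, Integrable (g k) μ) ∧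
    (∀ ω, f ω = ∑ k, g k ω • c k) ∧ a = ∑ k, (∫ ω, g k ω ∂μ) • c k

lemma HasMean.integral {Ω : Type} [MeasurableSpace Ω] {μ : Measure Ω} {f : Ω → C} {a : C}
    (h : HasMean μ f a) (τ : C →ₗ[ℂ] ℂ) (b : C) :
    ∫ ω, τ (b * f ω) ∂μ = τ (b * a) := by
  obtain ⟨κ, _, g, c, hg, hf, ha⟩ := h
  simp only [hf, ha, Finset.mul_sum, mul_smul_comm, map_sum, map_smul, smul_eq_mul]
  rw [integral_finsetSum _ (fun k _ => (hg k).mul_const _)]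
  simp only [integral_mul_const]

lemma HasMean.pi {ι : Type} [Fintype ι] {Ω : ι → Type} [∀ i, MeasurableSpace (Ω i)]
    {μ : ∀ i, Measure (Ω i)} [∀ i, SigmaFinite (μ i)] {f : ∀ i, Ω i → C} {a : ι → C}
    (h : ∀ i, HasMean (μ i) (f i) (a i)) :
    HasMean (Measure.pi μ) (fun ω => ∏ i, f i (ω i)) (∏ i, a i) := by
  classical
  choose κ hκ g c hg hf ha using h
  refine ⟨∀ i, κ i, inferInstance, fun k ω => ∏ i, g i (k i) (ω i), fun k => ∏ i, c i (k i),
    fun k => Integrable.fintype_prod_dep (fun i => hg i (k i)), ?_, ?_⟩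
  · intro ω
    simp only [hf]
    rw [Fintype.prod_sum]
    refine Finset.sum_congr rfl fun k _ => ?_
    rw [Finset.prod_smul]
  · simp only [ha]
    rw [Fintype.prod_sum]
    refine Finset.sum_congr rfl fun k _ => ?_
    rw [Finset.prod_smul, integral_fintype_prod_eq_prod (𝕜 := ℂ)]

lemma HasMean.prod {Ω Ω' : Type} [MeasurableSpace Ω] [MeasurableSpace Ω'] {μ : Measure Ω}
    {ν : Measure Ω'} [SFinite μ] [SFinite ν] {f : Ω → C} {f' : Ω' → C} {a a' : C}
    (h : HasMean μ f a) (h' : HasMean ν f' a') :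
    HasMean (μ.prod ν) (fun ω => f ω.1 * f' ω.2) (a * a') := by
  obtain ⟨κ, _, g, c, hg, hf, ha⟩ := h
  obtain ⟨κ', _, g', c', hg', hf', ha'⟩ := h'
  refine ⟨κ × κ', inferInstance, fun k ω => g k.1 ω.1 * g' k.2 ω.2, fun k => c k.1 * c' k.2,
    fun k => (hg k.1).mul_prod (hg' k.2), ?_, ?_⟩
  · intro ω
    simp only [hf, hf']
    rw [Finset.sum_mul_sum, ← Finset.univ_product_univ, Finset.sum_product]
    simp only [smul_mul_smul_comm]
  · simp only [ha, ha']
    rw [Finset.sum_mul_sum, ← Finset.univ_product_univ, Finset.sum_product]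
    simp only [smul_mul_smul_comm, integral_prod_mul]

lemma HasMean.comp {Ω Ω' : Type} [MeasurableSpace Ω] [MeasurableSpace Ω'] {μ : Measure Ω}
    {ν : Measure Ω'} {f : Ω' → C} {a : C} (e : Ω ≃ᵐ Ω') (he : MeasurePreserving e μ ν)
    (h : HasMean ν f a) : HasMean μ (fun ω => f (e ω)) a := by
  obtain ⟨κ, _, g, c, hg, hf, ha⟩ := h
  refine ⟨κ, inferInstance, fun k ω => g k (e ω), c, fun k => ?_, fun ω => hf _, ?_⟩
  · exact (he.integrable_comp_emb e.measurableEmbedding).2 (hg k)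
  · rw [ha]
    refine Finset.sum_congr rfl fun k _ => ?_
    rw [he.integral_comp e.measurableEmbedding]

lemma HasMean.congr {Ω : Type} [MeasurableSpace Ω] {μ : Measure Ω} {f f' : Ω → C} {a a' : C}
    (h : HasMean μ f a) (hf : ∀ ω, f ω = f' ω) (ha : a = a') : HasMean μ f' a' := by
  have : f = f' := funext hf
  rw [← this, ← ha]; exact h

variable [Module ℚ C]

lemma hasMean_gauss {Ω : Type} [MeasurableSpace Ω] {μ : Measure Ω} (w r : Ω → ℂ) (m0 s : ℂ)
    (hint : ∀ k : ℕ, Integrable (fun ω => w ω * r ω ^ k) μ)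
    (hodd : ∀ j : ℕ, ∫ ω, w ω * r ω ^ (2 * j + 1) ∂μ = 0)
    (heven : ∀ j : ℕ, ∫ ω, w ω * r ω ^ (2 * j) ∂μ = m0 * ((2 * j).factorial / j.factorial * s ^ j))
    (b : C) (hb : IsNilpotent b) (z : ℂ) :
    HasMean μ (fun ω => w ω • IsNilpotent.exp ((z * r ω) • b))
      (m0 • IsNilpotent.exp ((s * z ^ 2) • b ^ 2)) := by
  obtain ⟨d, hd⟩ := hb
  have hd2 : b ^ (2 * d) = 0 := by rw [mul_comm, pow_mul, hd]; 
                                   rcases d with _ | d <;> simp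
  refine ⟨Fin (2 * d), inferInstance, fun k ω => w ω * r ω ^ (k : ℕ),
    fun k => (z ^ (k : ℕ) / ((k : ℕ).factorial : ℂ)) • b ^ (k : ℕ), fun k => hint k, ?_, ?_⟩
  · intro ω
    have h0 : ((z * r ω) • b) ^ (2 * d) = 0 := by rw [smul_pow, hd2, smul_zero]
    beta_reduce
    rw [IsNilpotent.exp_eq_sum h0, Finset.smul_sum,
      ← Fin.sum_univ_eq_sum_range (fun k => w ω • (((k.factorial : ℚ)⁻¹) • ((z * r ω) • b) ^ k))]
    refine Finset.sum_congr rfl fun k _ => ?_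
    rw [← Rat.cast_smul_eq_qsmul ℂ, smul_pow, smul_smul, smul_smul, smul_smul]
    congr 1
    push_cast
    rw [mul_pow]; field_simp
  · have h0 : ((s * z ^ 2) • b ^ 2) ^ d = 0 := by rw [smul_pow, ← pow_mul, hd2, smul_zero]
    rw [IsNilpotent.exp_eq_sum h0]
    rw [Fin.sum_univ_eq_sum_range (fun k => (∫ ω, w ω * r ω ^ k ∂μ) •
      ((z ^ k / (k.factorial : ℂ)) • b ^ k)), Finset.smul_sum]
    clear h0 hd hd2
    induction d with
    | zero => simp
    | succ d ih =>
      rw [Finset.sum_range_succ, mul_add, mul_one, Finset.sum_range_succ, Finset.sum_range_succ,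
        ← ih, hodd, zero_smul, add_zero, heven]
      congr 1
      rw [← Rat.cast_smul_eq_qsmul ℂ, smul_pow, smul_smul, smul_smul, smul_smul, ← pow_mul b]
      congr 1
      push_cast
      rw [mul_pow, ← pow_mul]
      have : ((2 * d).factorial : ℂ) ≠ 0 := by exact_mod_cast Nat.factorial_ne_zero _
      field_simp

end HasMeanSec

section Moments

lemma int_pow_gauss (c : ℝ) (hc : 0 < c) (k : ℕ) :
    Integrable (fun x : ℝ => Real.exp (-c * x ^ 2) * x ^ k) := by
  have := integrable_rpow_mul_exp_neg_mul_sq hc (s := (k : ℝ)) (by have : (0:ℝ) ≤ k := k.cast_nonneg; linarith)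
  simpa [mul_comm] using this

lemma moment_rec (c : ℝ) (hc : 0 < c) (k : ℕ) :
    ∫ x : ℝ, Real.exp (-c * x ^ 2) * x ^ (k + 2) =
      (k + 1) / (2 * c) * ∫ x : ℝ, Real.exp (-c * x ^ 2) * x ^ k := by
  have hd : ∀ x : ℝ, HasDerivAt (fun x : ℝ => Real.exp (-c * x ^ 2) * x ^ (k + 1))
      ((k + 1) * (Real.exp (-c * x ^ 2) * x ^ k) - 2 * c * (Real.exp (-c * x ^ 2) * x ^ (k + 2))) x := by
    intro x
    have h1 : HasDerivAt (fun x : ℝ => Real.exp (-c * x ^ 2)) (Real.exp (-c * x ^ 2) * (-c * (2 * x))) x := by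
      have := ((hasDerivAt_pow 2 x).const_mul (-c)).exp
      simpa using this
    have h2 := h1.mul (hasDerivAt_pow (k + 1) x)
    refine h2.congr_deriv ?_
    simp only [Nat.add_sub_cancel]
    push_cast
    ring
  have := integral_eq_zero_of_hasDerivAt_of_integrable hd
    (((int_pow_gauss c hc k).const_mul _).sub ((int_pow_gauss c hc (k + 2)).const_mul _))
    (int_pow_gauss c hc (k + 1))
  rw [integral_sub ((int_pow_gauss c hc k).const_mul _) ((int_pow_gauss c hc (k + 2)).const_mul _),
    integral_const_mul, integral_const_mul] at this
  generalize (∫ a : ℝ, Real.exp (-c * a ^ 2) * a ^ k) = A at *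
  generalize (∫ a : ℝ, Real.exp (-c * a ^ 2) * a ^ (k + 2)) = B at *
  field_simp
  linarith

lemma moment_odd (c : ℝ) (hc : 0 < c) (j : ℕ) :
    ∫ x : ℝ, Real.exp (-c * x ^ 2) * x ^ (2 * j + 1) = 0 := by
  induction j with
  | zero =>
    have h := integral_neg_eq_self (fun x : ℝ => Real.exp (-c * x ^ 2) * x ^ (2 * 0 + 1)) volume
    simp [integral_neg] at h ⊢
    linarith
  | succ j ih =>
    rw [show 2 * (j + 1) + 1 = (2 * j + 1) + 2 by ring, moment_rec c hc, ih, mul_zero]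

lemma moment_even (c : ℝ) (hc : 0 < c) (j : ℕ) :
    ∫ x : ℝ, Real.exp (-c * x ^ 2) * x ^ (2 * j) =
      (∫ x : ℝ, Real.exp (-c * x ^ 2)) * ((2 * j).factorial / j.factorial * (1 / (4 * c)) ^ j) := by
  induction j with
  | zero => simp
  | succ j ih =>
    rw [show 2 * (j + 1) = (2 * j) + 2 by ring, moment_rec c hc, ih]
    rw [Nat.factorial_succ, Nat.factorial_succ, Nat.factorial_succ]
    push_cast
    have : (j.factorial : ℝ) ≠ 0 := by exact_mod_cast Nat.factorial_ne_zero _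
    generalize (∫ x : ℝ, Real.exp (-c * x ^ 2)) = A
    rw [pow_succ]
    generalize (1 / (4 * c)) ^ j = B
    field_simp
    ring

end Moments



section Dual

variable {V C : Type} [AddCommGroup V] [Module ℂ V] [CommRing C] [Algebra ℂ C] [Module ℚ C]

lemma hasMean_line (c : ℝ) (hc : 0 < c) (b : C) (hb : IsNilpotent b) (z : ℂ) :
    HasMean (volume : Measure ℝ) (fun t => (Real.exp (-c * t ^ 2) : ℂ) • IsNilpotent.exp ((z * (t : ℂ)) • b))
      (((∫ x : ℝ, Real.exp (-c * x ^ 2) : ℝ) : ℂ) •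
        IsNilpotent.exp ((((1 / (4 * c) : ℝ) : ℂ) * z ^ 2) • b ^ 2)) := by
  have key : ∀ k : ℕ, (fun t : ℝ => (Real.exp (-c * t ^ 2) : ℂ) * (t : ℂ) ^ k) =
      fun t : ℝ => ((Real.exp (-c * t ^ 2) * t ^ k : ℝ) : ℂ) := by
    intro k; funext t; push_cast; rfl
  refine hasMean_gauss _ (fun t : ℝ => (t : ℂ)) _ _ ?_ ?_ ?_ b hb z
  · intro k; rw [key]; exact (int_pow_gauss c hc k).ofReal
  · intro j; rw [key, integral_complex_ofReal, moment_odd c hc]; simp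
  · intro j; rw [key, integral_complex_ofReal, moment_even c hc]; push_cast; ring

lemma hasMean_gaussian (b : C) (hb : IsNilpotent b) :
    HasMean (ProbabilityTheory.gaussianReal 0 (Real.toNNReal (1 / 2)))
      (fun t : ℝ => IsNilpotent.exp ((t : ℂ) • b))
      (IsNilpotent.exp ((1 / 4 : ℂ) • b ^ 2)) := by
  have hv : Real.toNNReal (1 / 2) ≠ 0 := by simp
  have hpdf : ∀ x, ProbabilityTheory.gaussianPDFReal 0 (Real.toNNReal (1 / 2)) x
      = (Real.sqrt Real.pi)⁻¹ * Real.exp (-1 * x ^ 2) := by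
    intro x
    rw [ProbabilityTheory.gaussianPDFReal]
    rw [Real.coe_toNNReal _ (by norm_num)]
    congr 1
    · congr 2; ring
    · congr 1; ring
  have hI : ∫ x : ℝ, Real.exp (-1 * x ^ 2) = Real.sqrt Real.pi := by
    rw [integral_gaussian]; simp
  have hpi : Real.sqrt Real.pi ≠ 0 := by positivity
  have hmom : ∀ k : ℕ, ∫ t, ((t : ℝ) : ℂ) ^ k ∂(ProbabilityTheory.gaussianReal 0 (Real.toNNReal (1 / 2)))
      = (((Real.sqrt Real.pi)⁻¹ * ∫ x : ℝ, Real.exp (-1 * x ^ 2) * x ^ k : ℝ) : ℂ) := by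
    intro k
    rw [ProbabilityTheory.integral_gaussianReal_eq_integral_smul hv, ← integral_const_mul,
      ← integral_complex_ofReal]
    congr 1; funext t; rw [hpdf]; simp; ring
  have := hasMean_gauss (μ := ProbabilityTheory.gaussianReal 0 (Real.toNNReal (1 / 2)))
    (fun _ => 1) (fun t : ℝ => (t : ℂ)) 1 (1/4) ?_ ?_ ?_ b hb 1
  · simpa using this
  · intro k
    simp only [one_mul]
    have := ((ProbabilityTheory.memLp_id_gaussianReal (μ := 0) (v := Real.toNNReal (1 / 2)) k).integrable_norm_pow')
    refine (Integrable.mono' this ?_ ?_)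
    · exact (Complex.measurable_ofReal.pow_const k).aestronglyMeasurable
    · filter_upwards with t; simp
  · intro j
    simp only [one_mul]
    rw [hmom, moment_odd 1 one_pos]; simp
  · intro j
    simp only [one_mul]
    rw [hmom, moment_even 1 one_pos, hI, ← mul_assoc, inv_mul_cancel₀ hpi]; push_cast; ring

lemma hasMean_HS (u s : C) (hu : IsNilpotent u) (hs : IsNilpotent s) :
    HasMean (volume : Measure ℂ) (fun z => (Real.exp (-4 * Complex.normSq z) : ℂ) •
        IsNilpotent.exp (z • u - (starRingEnd ℂ z) • s))
      (((∫ x : ℝ, Real.exp (-4 * x ^ 2) : ℝ) : ℂ) ^ 2 •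
        IsNilpotent.exp ((-1 / 4 : ℂ) • (u * s))) := by
  have h1 : IsNilpotent (u - s) := Commute.isNilpotent_sub (Commute.all _ _) hu hs
  have h2 : IsNilpotent (u + s) := Commute.isNilpotent_add (Commute.all _ _) hu hs
  have := (hasMean_line 4 (by norm_num) (u - s) h1 1).prod (hasMean_line 4 (by norm_num) (u + s) h2 Complex.I)
  refine (HasMean.comp Complex.measurableEquivRealProd Complex.volume_preserving_equiv_real_prod this).congr ?_ ?_
  · intro z
    simp only [Complex.measurableEquivRealProd_apply]
    rw [smul_mul_smul_comm, ← IsNilpotent.exp_add_of_commute (Commute.all _ _) (nilp_smul _ h1) (nilp_smul _ h2)]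
    congr 1
    · rw [← Complex.ofReal_mul, ← Real.exp_add, Complex.normSq_apply]
      congr 2; ring
    · congr 1
      have e1 : z = z.re + z.im * Complex.I := (Complex.re_add_im z).symm
      have e2 : (starRingEnd ℂ) z = z.re - z.im * Complex.I := by
        apply Complex.ext <;> simp
      rw [e2]
      nth_rewrite 3 [e1]
      module
  · rw [smul_mul_smul_comm, ← pow_two, ← IsNilpotent.exp_add_of_commute (Commute.all _ _)
      (nilp_smul _ (h1.pow_of_pos (by norm_num))) (nilp_smul _ (h2.pow_of_pos (by norm_num)))]
    congr 2
    rw [Complex.I_sq]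
    have : (u - s) ^ 2 = (u + s)^2 - (4:ℂ) • (u * s) := by
      rw [Algebra.smul_def, map_ofNat]; ring
    rw [this]
    push_cast
    module

end Dual



/-- The dual `2K × 2K` matrix. -/
noncomputable def dualB {K : ℕ} (G : Fin K → Fin K → ℂ) (x : Fin K → ℝ) :
    Matrix (Fin K ⊕ Fin K) (Fin K ⊕ Fin K) ℂ :=
  Matrix.fromBlocks (Matrix.of fun i j => G i j - G j i) (-Matrix.diagonal fun i => (x i : ℂ))
    (Matrix.diagonal fun i => (x i : ℂ))
    (-(Matrix.of fun i j => (starRingEnd ℂ) (G i j - G j i)))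

section Dual2

variable {V C : Type} [AddCommGroup V] [Module ℂ V] [CommRing C] [Algebra ℂ C] [Module ℚ C]
variable {n K : ℕ} (Gr : GrassPack (Fin n × Fin K) V C)

namespace GrassPack

/-- bilinears -/
noncomputable def bb (i j : Fin n) : C := ∑ m, Gr.P (Gr.χ (i, m)) (Gr.ψ (j, m))
noncomputable def uu (m m' : Fin K) : C := ∑ i, Gr.P (Gr.χ (i, m)) (Gr.χ (i, m'))
noncomputable def ss (m m' : Fin K) : C := ∑ i, Gr.P (Gr.ψ (i, m)) (Gr.ψ (i, m'))
noncomputable def YY (x : Fin K → ℝ) : C := ∑ i, ∑ m, (x m : ℂ) • Gr.P (Gr.χ (i, m)) (Gr.ψ (i, m))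

lemma bb_nilp (i j : Fin n) : IsNilpotent (Gr.bb i j) := isNilpotent_sum fun _ _ => Gr.P_nilp _ _
lemma uu_nilp (i j : Fin K) : IsNilpotent (Gr.uu i j) := isNilpotent_sum fun _ _ => Gr.P_nilp _ _
lemma ss_nilp (i j : Fin K) : IsNilpotent (Gr.ss i j) := isNilpotent_sum fun _ _ => Gr.P_nilp _ _
lemma YY_nilp (x : Fin K → ℝ) : IsNilpotent (Gr.YY x) :=
  isNilpotent_sum fun _ _ => isNilpotent_sum fun _ _ => nilp_smul _ (Gr.P_nilp _ _)

lemma bb_sq : ∑ i, ∑ j, (Gr.bb i j) ^ 2 = - ∑ m, ∑ m', Gr.uu m m' * Gr.ss m m' := by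
  simp only [bb, uu, ss, pow_two, Finset.sum_mul_sum]
  simp only [Gr.exch (Gr.χ _) (Gr.ψ _), Finset.sum_neg_distrib]
  congr 1
  calc _ = ∑ i, ∑ m, ∑ j, ∑ m', Gr.P (Gr.χ (i, m)) (Gr.χ (i, m')) * Gr.P (Gr.ψ (j, m)) (Gr.ψ (j, m')) :=
        Finset.sum_congr rfl fun i _ => Finset.sum_comm
    _ = ∑ m, ∑ i, ∑ j, ∑ m', Gr.P (Gr.χ (i, m)) (Gr.χ (i, m')) * Gr.P (Gr.ψ (j, m)) (Gr.ψ (j, m')) :=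
        Finset.sum_comm
    _ = ∑ m, ∑ i, ∑ m', ∑ j, Gr.P (Gr.χ (i, m)) (Gr.χ (i, m')) * Gr.P (Gr.ψ (j, m)) (Gr.ψ (j, m')) :=
        Finset.sum_congr rfl fun i _ => Finset.sum_congr rfl fun i _ => Finset.sum_comm
    _ = _ := Finset.sum_congr rfl fun i _ => Finset.sum_comm

lemma prod_det (M : Fin n → Fin n → ℝ) (x : Fin K → ℝ) :
    ((∏ m : Fin K, ((Matrix.of M) - x m • (1 : Matrix (Fin n) (Fin n) ℝ)).det : ℝ) : ℂ) =
      Gr.τ (IsNilpotent.exp (- Gr.YY x) * ∏ i, ∏ j, IsNilpotent.exp ((M i j : ℂ) • Gr.bb i j)) := by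
  have h := Gr.exp_det rfl Gr.χ Gr.ψ
    (Matrix.blockDiagonal fun m => ((Matrix.of M) - x m • (1 : Matrix (Fin n) (Fin n) ℝ)).map Complex.ofReal)
  rw [Gr.top, mul_one, Matrix.det_blockDiagonal] at h
  have h2 : ∀ m, (((Matrix.of M) - x m • (1 : Matrix (Fin n) (Fin n) ℝ)).map Complex.ofReal).det
      = ((((Matrix.of M) - x m • (1 : Matrix (Fin n) (Fin n) ℝ)).det : ℝ) : ℂ) := by
    intro m
    exact (RingHom.map_det Complex.ofRealHom _).symm
  simp only [h2] at h
  rw [Complex.ofReal_prod, ← h]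
  congr 1
  simp only [← nexp_sum _ _ (fun j _ => nilp_smul _ (Gr.bb_nilp _ j))]
  rw [← nexp_sum _ _ (fun i _ => isNilpotent_sum fun j _ => nilp_smul _ (Gr.bb_nilp _ j)),
    ← IsNilpotent.exp_add_of_commute (Commute.all _ _) (Gr.YY_nilp x).neg
      (isNilpotent_sum fun i _ => isNilpotent_sum fun j _ => nilp_smul _ (Gr.bb_nilp _ j))]
  congr 1
  simp only [Fintype.sum_prod_type, Matrix.blockDiagonal_apply, ite_smul, zero_smul,
    Finset.sum_ite_eq, Finset.mem_univ, if_true]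
  simp only [Matrix.map_apply, Matrix.sub_apply, Matrix.of_apply, Matrix.smul_apply, smul_eq_mul,
    Complex.ofReal_sub, Complex.ofReal_mul, sub_smul, Finset.sum_sub_distrib, Matrix.one_apply]
  rw [YY, sub_eq_add_neg, add_comm]
  congr 1
  · congr 1
    refine Finset.sum_congr rfl fun i _ => ?_
    refine Finset.sum_congr rfl fun m _ => ?_
    rw [Finset.sum_eq_single i]
    · simp only [if_true, Complex.ofReal_one, mul_one]
    · intro j _ hj; rw [if_neg (Ne.symm hj)]; simp
    · simp
  · refine Finset.sum_congr rfl fun i _ => ?_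
    rw [Finset.sum_comm]
    simp only [bb, Finset.smul_sum]

lemma mean_det (x : Fin K → ℝ) :
    ((∫ M, ∏ m : Fin K, (M - x m • (1 : Matrix (Fin n) (Fin n) ℝ)).det ∂(ginibre n 1) : ℝ) : ℂ) =
      Gr.τ (IsNilpotent.exp (- Gr.YY x) * ∏ m, ∏ m', IsNilpotent.exp ((-1 / 4 : ℂ) • (Gr.uu m m' * Gr.ss m m'))) := by
  have h := HasMean.pi (fun i : Fin n => HasMean.pi (fun j : Fin n => hasMean_gaussian (Gr.bb i j) (Gr.bb_nilp i j)))
  have h2 := h.integral Gr.τ (IsNilpotent.exp (- Gr.YY x))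
  rw [← integral_complex_ofReal]
  have h3 : ∏ i, ∏ j, IsNilpotent.exp ((1 / 4 : ℂ) • (Gr.bb i j) ^ 2) =
      ∏ m, ∏ m', IsNilpotent.exp ((-1 / 4 : ℂ) • (Gr.uu m m' * Gr.ss m m')) := by
    have n1 : ∀ i j, IsNilpotent ((1 / 4 : ℂ) • (Gr.bb i j) ^ 2) := fun i j =>
      nilp_smul _ ((Gr.bb_nilp i j).pow_of_pos (by norm_num))
    have n2 : ∀ i j, IsNilpotent ((-1 / 4 : ℂ) • (Gr.uu i j * Gr.ss i j)) := fun i j =>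
      nilp_smul _ (Commute.isNilpotent_mul_left (Commute.all _ _) (Gr.ss_nilp i j))
    simp only [← nexp_sum _ _ (fun j _ => n1 _ j), ← nexp_sum _ _ (fun j _ => n2 _ j)]
    rw [← nexp_sum _ _ (fun i _ => isNilpotent_sum fun j _ => n1 i j),
      ← nexp_sum _ _ (fun i _ => isNilpotent_sum fun j _ => n2 i j)]
    congr 1
    simp only [← Finset.smul_sum]
    rw [bb_sq]
    module
  rw [← h3, ← h2]
  refine Eq.trans ?_ (integral_congr_ae (Filter.Eventually.of_forall fun M => Gr.prod_det M x))
  rfl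

lemma HS_det (x : Fin K → ℝ) :
    ∫ G : Fin K → Fin K → ℂ, Gr.τ (IsNilpotent.exp (- Gr.YY x) * ∏ m, ∏ m',
      ((Real.exp (-4 * Complex.normSq (G m m')) : ℂ) • IsNilpotent.exp (G m m' • Gr.uu m m' -
        (starRingEnd ℂ (G m m')) • Gr.ss m m'))) =
     ((((∫ x : ℝ, Real.exp (-4 * x ^ 2) : ℝ) : ℂ) ^ 2) ^ K) ^ K * 
      ((∫ M, ∏ m : Fin K, (M - x m • (1 : Matrix (Fin n) (Fin n) ℝ)).det ∂(ginibre n 1) : ℝ) : ℂ) := by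
  have h := HasMean.pi (fun i : Fin K => HasMean.pi (fun j : Fin K => hasMean_HS (Gr.uu i j) (Gr.ss i j)
    (Gr.uu_nilp i j) (Gr.ss_nilp i j)))
  have h2 := h.integral Gr.τ (IsNilpotent.exp (- Gr.YY x))
  refine Eq.trans h2 ?_
  simp only [Finset.prod_smul, Finset.prod_const, Finset.card_univ, Fintype.card_fin]
  rw [mul_smul_comm, map_smul, smul_eq_mul, mean_det Gr]

/-- the flavour vector -/
def th (i : Fin n) : Fin K ⊕ Fin K → V := Sum.elim (fun m => Gr.χ (i, m)) (fun m => Gr.ψ (i, m))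

lemma pair_identity {T : Type} [Fintype T] (θ θ' : T → V) (H : Matrix T T ℂ) :
    ∑ α, ∑ β, H α β • (Gr.P (θ α) (θ β) + Gr.P (θ' α) (θ' β)) =
      ∑ α, ∑ β, (H - Hᵀ) α β • Gr.P (θ α + Complex.I • θ' α) ((1/2 : ℂ) • (θ β - Complex.I • θ' β)) := by
  simp only [Matrix.sub_apply, Matrix.transpose_apply, sub_smul, Finset.sum_sub_distrib]
  have e : ∑ α, ∑ β, H β α • Gr.P (θ α + Complex.I • θ' α) ((1/2 : ℂ) • (θ β - Complex.I • θ' β)) =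
     ∑ α, ∑ β, H α β • Gr.P (θ β + Complex.I • θ' β) ((1/2 : ℂ) • (θ α - Complex.I • θ' α)) := Finset.sum_comm
  rw [e, ← Finset.sum_sub_distrib]
  refine Finset.sum_congr rfl fun α _ => ?_
  rw [← Finset.sum_sub_distrib]
  refine Finset.sum_congr rfl fun β _ => ?_
  rw [← smul_sub]
  congr 1
  simp only [map_add, map_sub, map_smul, LinearMap.add_apply, LinearMap.smul_apply, smul_sub]
  rw [Gr.P_swap (θ β) (θ α), Gr.P_swap (θ' β) (θ' α), Gr.P_swap (θ β) (θ' α), Gr.P_swap (θ' β) (θ α)]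
  have hI := Complex.I_mul_I
  match_scalars <;> first | ring1 | linear_combination hI | linear_combination -hI


lemma site_sum (G : Fin K → Fin K → ℂ) (x : Fin K → ℝ) :
    - Gr.YY x + ∑ m, ∑ m', (G m m' • Gr.uu m m' - (starRingEnd ℂ (G m m')) • Gr.ss m m') =
      ∑ i, ∑ α, ∑ β, (Matrix.fromBlocks (Matrix.of G) (-Matrix.diagonal fun i => (x i : ℂ)) 0
        (-(Matrix.of fun i j => (starRingEnd ℂ) (G i j))) : Matrix (Fin K ⊕ Fin K) (Fin K ⊕ Fin K) ℂ) α β •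
          Gr.P (Gr.th i α) (Gr.th i β) := by
  simp only [Fintype.sum_sum_type, Matrix.fromBlocks_apply₁₁, Matrix.fromBlocks_apply₁₂,
    Matrix.fromBlocks_apply₂₁, Matrix.fromBlocks_apply₂₂, th, Sum.elim_inl, Sum.elim_inr,
    Matrix.zero_apply, zero_smul, Finset.sum_const_zero, zero_add, Matrix.neg_apply, Matrix.of_apply,
    Finset.sum_add_distrib, Matrix.diagonal_apply, neg_smul, Finset.sum_neg_distrib, ite_smul,
    Finset.sum_ite_eq, Finset.mem_univ, if_true, uu, ss, YY, Finset.smul_sum, Finset.sum_sub_distrib]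
  have c1 : ∀ f : Fin K → Fin K → Fin n → C, ∑ m, ∑ m', ∑ i, f m m' i = ∑ i, ∑ m, ∑ m', f m m' i := by
    intro f
    calc _ = ∑ m, ∑ i, ∑ m', f m m' i := Finset.sum_congr rfl fun _ _ => Finset.sum_comm
      _ = _ := Finset.sum_comm
  rw [c1, c1]
  abel

lemma site_det {p : ℕ} (e : Fin 2 × Fin p ≃ Fin n) :
    ∃ c0 : ℂ, ∀ (G : Fin K → Fin K → ℂ) (x : Fin K → ℝ),
    Gr.τ (IsNilpotent.exp (- Gr.YY x + ∑ m, ∑ m', (G m m' • Gr.uu m m' - (starRingEnd ℂ (G m m')) • Gr.ss m m'))) =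
      (dualB G x).det ^ p * c0 := by
  have hJ : Fintype.card ((Fin K ⊕ Fin K) × Fin p) = Fintype.card (Fin n × Fin K) := by
    have := Fintype.card_congr e
    simp at this ⊢
    rw [← this]; ring
  refine ⟨Gr.τ (∏ α : (Fin K ⊕ Fin K) × Fin p,
    Gr.P (Gr.th (e (0, α.2)) α.1 + Complex.I • Gr.th (e (1, α.2)) α.1)
      ((1/2 : ℂ) • (Gr.th (e (0, α.2)) α.1 - Complex.I • Gr.th (e (1, α.2)) α.1))), fun G x => ?_⟩
  have h := Gr.exp_det hJ (fun α => Gr.th (e (0, α.2)) α.1 + Complex.I • Gr.th (e (1, α.2)) α.1)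
    (fun α => (1/2 : ℂ) • (Gr.th (e (0, α.2)) α.1 - Complex.I • Gr.th (e (1, α.2)) α.1))
    (Matrix.blockDiagonal fun _ => dualB G x)
  rw [Matrix.det_blockDiagonal] at h
  simp only [Finset.prod_const, Finset.card_univ, Fintype.card_fin] at h
  rw [← h, site_sum]
  congr 2
  rw [← e.sum_comp, Fintype.sum_prod_type, Fin.sum_univ_two, ← Finset.sum_add_distrib]
  simp only [Fintype.sum_prod_type_right, Matrix.blockDiagonal_apply, ite_smul, zero_smul]
  refine Finset.sum_congr rfl fun q _ => ?_
  rw [← Finset.sum_add_distrib]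
  simp only [← Finset.sum_add_distrib, ← smul_add]
  rw [pair_identity]
  refine Finset.sum_congr rfl fun α _ => ?_
  rw [Finset.sum_eq_single q]
  · refine Finset.sum_congr rfl fun β _ => ?_
    rw [if_pos rfl]
    congr 1
    rcases α with α | α <;> rcases β with β | β <;>
      simp [dualB, Matrix.diagonal_apply, eq_comm] <;> first | ring1 | (split_ifs with h <;> simp [h])
  · intro r _ hr
    simp [Ne.symm hr]
  · simp

end GrassPack
end Dual2

noncomputable instance evenAlgRat (V : Type) [AddCommGroup V] [Module ℂ V] :
    Module ℚ (EvenAlg V) := Module.compHom _ (algebraMap ℚ ℂ)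

lemma duality (K p : ℕ) : ∃ c : ℂ, ∀ x : Fin K → ℝ,
    ((∫ M, ∏ m : Fin K, (M - x m • (1 : Matrix (Fin (2 * p)) (Fin (2 * p)) ℝ)).det ∂(ginibre (2 * p) 1) : ℝ) : ℂ) =
      c * ∫ G : Fin K → Fin K → ℂ, (Real.exp (-4 * ∑ m, ∑ m', Complex.normSq (G m m')) : ℂ) * (dualB G x).det ^ p := by
  let Gr := grassPack (Fin (2 * p) × Fin K)
  obtain ⟨c0, hc0⟩ := Gr.site_det finProdFinEquiv
  have hm : (∫ x : ℝ, Real.exp (-4 * x ^ 2)) ≠ 0 := by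
    rw [integral_gaussian]; positivity
  refine ⟨(((((∫ x : ℝ, Real.exp (-4 * x ^ 2) : ℝ) : ℂ) ^ 2) ^ K) ^ K)⁻¹ * c0, fun x => ?_⟩
  rw [mul_assoc, eq_inv_mul_iff_mul_eq₀ (pow_ne_zero _ (pow_ne_zero _ (pow_ne_zero _ (Complex.ofReal_ne_zero.2 hm)))), ← Gr.HS_det, ← integral_const_mul]
  congr 1
  funext G
  simp only [Finset.prod_smul]
  have n1 : ∀ m m', IsNilpotent (G m m' • Gr.uu m m' - (starRingEnd ℂ (G m m')) • Gr.ss m m') :=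
    fun m m' => Commute.isNilpotent_sub (Commute.all _ _) (nilp_smul _ (Gr.uu_nilp _ _)) (nilp_smul _ (Gr.ss_nilp _ _))
  simp only [← nexp_sum _ _ (fun j _ => n1 _ j)]
  rw [← nexp_sum _ _ (fun i _ => isNilpotent_sum fun j _ => n1 i j), mul_smul_comm,
    ← IsNilpotent.exp_add_of_commute (Commute.all _ _) (Gr.YY_nilp x).neg
     (isNilpotent_sum fun i _ => isNilpotent_sum fun j _ => n1 i j), map_smul, hc0, smul_eq_mul]
  have : ∏ m, ∏ m', (Real.exp (-4 * Complex.normSq (G m m')) : ℂ) =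
    (Real.exp (-4 * ∑ m, ∑ m', Complex.normSq (G m m')) : ℂ) := by
    simp only [← Complex.ofReal_prod, ← Real.exp_sum, Finset.mul_sum]
  rw [this]; ring



section MaxW
open scoped ComplexOrder

variable {K : ℕ}

noncomputable def Qm (G : Fin K → Fin K → ℂ) : Matrix (Fin K) (Fin K) ℂ :=
  Matrix.of fun i j => G i j - G j i

noncomputable def nrm2 (G : Fin K → Fin K → ℂ) : ℝ := ∑ m, ∑ m', Complex.normSq (G m m')

noncomputable def WW (G : Fin K → Fin K → ℂ) : ℝ :=
  Real.exp (-8 * nrm2 G) * Complex.normSq (Qm G).det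

noncomputable def mmax (K : ℕ) : ℝ := (Real.exp (-1) / 2) ^ K

lemma mmax_pos : 0 < mmax K := by unfold mmax; positivity

lemma WW_nonneg (G : Fin K → Fin K → ℂ) : 0 ≤ WW G :=
  mul_nonneg (Real.exp_pos _).le (Complex.normSq_nonneg _)

lemma trace_QQ (G : Fin K → Fin K → ℂ) :
    (Qm G * (Qm G)ᴴ).trace = ((∑ i, ∑ j, Complex.normSq (G i j - G j i) : ℝ) : ℂ) := by
  simp only [Matrix.trace, Matrix.diag, Matrix.mul_apply, Matrix.conjTranspose_apply, Qm, Matrix.of_apply]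
  push_cast
  refine Finset.sum_congr rfl fun i _ => Finset.sum_congr rfl fun j _ => ?_
  exact Complex.mul_conj _

lemma sum_sym (G : Fin K → Fin K → ℂ) :
    4 * nrm2 G - ∑ i, ∑ j, Complex.normSq (G i j - G j i) = ∑ i, ∑ j, Complex.normSq (G i j + G j i) := by
  have h : nrm2 G = ∑ i, ∑ j, Complex.normSq (G j i) := Finset.sum_comm
  have : 4 * nrm2 G = ∑ i, ∑ j, (2 * Complex.normSq (G i j) + 2 * Complex.normSq (G j i)) := by
    simp only [Finset.sum_add_distrib, ← Finset.mul_sum]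
    rw [← h]; unfold nrm2; ring
  rw [this, ← Finset.sum_sub_distrib]
  refine Finset.sum_congr rfl fun i _ => ?_
  rw [← Finset.sum_sub_distrib]
  refine Finset.sum_congr rfl fun j _ => ?_
  simp only [Complex.normSq_apply, Complex.add_re, Complex.add_im, Complex.sub_re, Complex.sub_im]
  ring

lemma one_var (l : ℝ) : l * Real.exp (-2 * l) ≤ Real.exp (-1) / 2 := by
  have h := Real.add_one_le_exp (2 * l - 1)
  have h2 : Real.exp (2 * l - 1) * Real.exp (-2 * l) = Real.exp (-1) := by
    rw [← Real.exp_add]; congr 1; ring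
  have h3 := Real.exp_pos (-2 * l)
  nlinarith

lemma one_var_eq (l : ℝ) (h : l * Real.exp (-2 * l) = Real.exp (-1) / 2) : l = 1 / 2 := by
  by_contra hne
  have h1 := Real.add_one_lt_exp (x := 2 * l - 1) (by intro h0; apply hne; linarith)
  have h2 : Real.exp (2 * l - 1) * Real.exp (-2 * l) = Real.exp (-1) := by
    rw [← Real.exp_add]; congr 1; ring
  have h3 := Real.exp_pos (-2 * l)
  nlinarith

lemma QQ_psd (G : Fin K → Fin K → ℂ) : (Qm G * (Qm G)ᴴ).PosSemidef :=
  Matrix.posSemidef_self_mul_conjTranspose _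

lemma normSq_det_eq (G : Fin K → Fin K → ℂ) :
    Complex.normSq (Qm G).det = ∏ i, (QQ_psd G).isHermitian.eigenvalues i := by
  have h := (QQ_psd G).isHermitian.det_eq_prod_eigenvalues
  rw [Matrix.det_mul, Matrix.det_conjTranspose] at h
  have h2 : (Qm G).det * star (Qm G).det = ((Complex.normSq (Qm G).det : ℝ) : ℂ) := Complex.mul_conj _
  rw [h2] at h
  have h3 : ((Complex.normSq (Qm G).det : ℝ) : ℂ) = ((∏ i, (QQ_psd G).isHermitian.eigenvalues i : ℝ) : ℂ) := by
    rw [h]; push_cast; rfl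
  exact_mod_cast h3

lemma sum_eig (G : Fin K → Fin K → ℂ) :
    ∑ i, (QQ_psd G).isHermitian.eigenvalues i = ∑ i, ∑ j, Complex.normSq (G i j - G j i) := by
  have h := (QQ_psd G).isHermitian.trace_eq_sum_eigenvalues
  rw [trace_QQ] at h
  have h3 : ((∑ i, ∑ j, Complex.normSq (G i j - G j i) : ℝ) : ℂ) = ((∑ i, (QQ_psd G).isHermitian.eigenvalues i : ℝ) : ℂ) := by
    rw [h]; push_cast; rfl
  exact_mod_cast h3.symm

lemma WW_eq (G : Fin K → Fin K → ℂ) :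
    WW G = Real.exp (-2 * ∑ i, ∑ j, Complex.normSq (G i j + G j i)) *
      ∏ i, ((QQ_psd G).isHermitian.eigenvalues i * Real.exp (-2 * (QQ_psd G).isHermitian.eigenvalues i)) := by
  rw [Finset.prod_mul_distrib, ← normSq_det_eq, ← Real.exp_sum, ← Finset.mul_sum, sum_eig, ← sum_sym, WW,
    mul_left_comm, ← Real.exp_add, mul_comm]
  congr 2; ring

lemma prod_le (G : Fin K → Fin K → ℂ) :
   ∏ i, ((QQ_psd G).isHermitian.eigenvalues i * Real.exp (-2 * (QQ_psd G).isHermitian.eigenvalues i)) ≤ mmax K := by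
  have := Finset.prod_le_prod (s := Finset.univ) (f := fun i => ((QQ_psd G).isHermitian.eigenvalues i * Real.exp (-2 * (QQ_psd G).isHermitian.eigenvalues i)))
    (g := fun _ => Real.exp (-1) / 2) (fun i _ => mul_nonneg ((QQ_psd G).eigenvalues_nonneg i) (Real.exp_pos _).le)
    (fun i _ => one_var _)
  rwa [Finset.prod_const, Finset.card_univ, Fintype.card_fin] at this

lemma prod_nonneg' (G : Fin K → Fin K → ℂ) :
   0 ≤ ∏ i, ((QQ_psd G).isHermitian.eigenvalues i * Real.exp (-2 * (QQ_psd G).isHermitian.eigenvalues i)) :=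
  Finset.prod_nonneg (fun i _ => mul_nonneg ((QQ_psd G).eigenvalues_nonneg i) (Real.exp_pos _).le)

lemma sumsym_nonneg (G : Fin K → Fin K → ℂ) : 0 ≤ ∑ i, ∑ j, Complex.normSq (G i j + G j i) :=
  Finset.sum_nonneg fun _ _ => Finset.sum_nonneg fun _ _ => Complex.normSq_nonneg _

lemma WW_le (G : Fin K → Fin K → ℂ) : WW G ≤ mmax K := by
  rw [WW_eq]
  have h1 : Real.exp (-2 * ∑ i, ∑ j, Complex.normSq (G i j + G j i)) ≤ 1 := by
    rw [Real.exp_le_one_iff]; linarith [sumsym_nonneg G]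
  calc _ ≤ 1 * _ := mul_le_mul_of_nonneg_right h1 (prod_nonneg' G)
    _ ≤ _ := by rw [one_mul]; exact prod_le G

lemma WW_max (G : Fin K → Fin K → ℂ) (h : WW G = mmax K) :
    (∀ i j, G i j = - G j i) ∧ Qm G * (Qm G)ᴴ = (1 / 2 : ℂ) • 1 := by
  rw [WW_eq] at h
  have hm := mmax_pos (K := K)
  have h1 : Real.exp (-2 * ∑ i, ∑ j, Complex.normSq (G i j + G j i)) ≤ 1 := by
    rw [Real.exp_le_one_iff]; linarith [sumsym_nonneg G]
  have hp := prod_le G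
  have hp0 := prod_nonneg' G
  have hE : Real.exp (-2 * ∑ i, ∑ j, Complex.normSq (G i j + G j i)) = 1 := by
    apply le_antisymm h1
    by_contra hlt
    push Not at hlt
    rcases hp0.eq_or_lt with h0 | h0
    · rw [← h0] at h; linarith
    · have := mul_lt_mul_of_pos_right hlt h0
      linarith
  rw [hE, one_mul] at h
  constructor
  · rw [Real.exp_eq_one_iff] at hE
    have h0 : ∑ i, ∑ j, Complex.normSq (G i j + G j i) = 0 := by linarith
    rw [Finset.sum_eq_zero_iff_of_nonneg (fun _ _ => Finset.sum_nonneg fun _ _ => Complex.normSq_nonneg _)] at h0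
    intro i j
    have h2 := h0 i (Finset.mem_univ _)
    rw [Finset.sum_eq_zero_iff_of_nonneg (fun _ _ => Complex.normSq_nonneg _)] at h2
    have h3 := h2 j (Finset.mem_univ _)
    rw [Complex.normSq_eq_zero] at h3
    exact eq_neg_of_add_eq_zero_left h3
  · have hl : ∀ i, (QQ_psd G).isHermitian.eigenvalues i = 1 / 2 := by
      intro i
      apply one_var_eq
      by_contra hne
      have hlt := lt_of_le_of_ne (one_var ((QQ_psd G).isHermitian.eigenvalues i)) hne
      have hpos : ∀ j ∈ Finset.univ, 0 < ((QQ_psd G).isHermitian.eigenvalues j * Real.exp (-2 * (QQ_psd G).isHermitian.eigenvalues j)) := by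
        intro j hj
        refine lt_of_le_of_ne (mul_nonneg ((QQ_psd G).eigenvalues_nonneg j) (Real.exp_pos _).le) ?_
        intro h0
        rw [Finset.prod_eq_zero hj h0.symm] at h
        linarith
      have := Finset.prod_lt_prod (s := Finset.univ) (g := fun _ => Real.exp (-1) / 2) hpos
        (fun i _ => one_var _) ⟨i, Finset.mem_univ _, hlt⟩
      rw [h, Finset.prod_const, Finset.card_univ, Fintype.card_fin] at this
      exact lt_irrefl _ this
    have hs := (QQ_psd G).isHermitian.spectral_theorem
    rw [hs]
    have : (RCLike.ofReal ∘ (QQ_psd G).isHermitian.eigenvalues : Fin K → ℂ) = fun _ => (1/2 : ℂ) := by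
      funext i; simp [hl]
    rw [this]
    have h3 : Matrix.diagonal (fun _ : Fin K => (1/2 : ℂ)) = (1/2 : ℂ) • 1 := by
      rw [Matrix.smul_one_eq_diagonal]
    rw [h3]
    simp

end MaxW



section Trans

lemma sympJ_block (q : ℕ) (a a' : Fin q) (b b' : Fin 2) :
    sympJ (q * 2) (finProdFinEquiv (a, b)) (finProdFinEquiv (a', b')) =
      if a = a' then (!![0, 1; -1, 0] : Matrix (Fin 2) (Fin 2) ℂ) b b' else 0 := by
  simp only [sympJ, Matrix.of_apply, finProdFinEquiv_apply_val]
  by_cases h : a = a'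
  · subst h
    fin_cases b <;> fin_cases b' <;> simp <;> omega
  · have h' : (a : ℕ) ≠ a' := fun h0 => h (Fin.ext h0)
    rw [if_neg h]
    have hb := b.isLt
    have hb' := b'.isLt
    rw [if_neg (by omega), if_neg (by omega)]

lemma sympJ_transpose (K : ℕ) : (sympJ K)ᵀ = - sympJ K := by
  ext i j
  simp only [sympJ, Matrix.transpose_apply, Matrix.neg_apply, Matrix.of_apply]
  split_ifs <;> first | omega | simp

lemma sympJ_conj (K : ℕ) : (sympJ K)ᴴ = (sympJ K)ᵀ := by
  ext i j
  simp only [sympJ, Matrix.conjTranspose_apply, Matrix.transpose_apply, Matrix.of_apply]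
  split_ifs <;> simp

lemma sympJ_mul (K : ℕ) (hK : Even K) : sympJ K * (sympJ K)ᵀ = 1 := by
  obtain ⟨q, rfl⟩ := hK
  rw [show q + q = q * 2 by ring]
  ext i j
  obtain ⟨⟨a, b⟩, rfl⟩ := finProdFinEquiv.surjective i
  obtain ⟨⟨a', b'⟩, rfl⟩ := finProdFinEquiv.surjective j
  rw [Matrix.mul_apply, ← finProdFinEquiv.sum_comp, Fintype.sum_prod_type]
  simp only [Matrix.transpose_apply, sympJ_block, Fin.sum_univ_two]
  rw [Finset.sum_eq_single a]
  · rw [Matrix.one_apply]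
    simp only [EmbeddingLike.apply_eq_iff_eq, Prod.mk.injEq]
    by_cases h : a = a'
    · subst h
      fin_cases b <;> fin_cases b' <;> simp
    · simp [h, Ne.symm h]
  · intro c _ hc
    simp [Ne.symm hc]
  · simp

variable {K : ℕ} (A : Matrix (Fin K) (Fin K) ℂ)

lemma th_anti (hA : Aᵀ = -A) (a b : Fin K → ℂ) : star a ⬝ᵥ (A *ᵥ star b) = - (star b ⬝ᵥ (A *ᵥ star a)) := by
  rw [Matrix.dotProduct_mulVec, ← Matrix.mulVec_transpose, hA, Matrix.neg_mulVec, neg_dotProduct,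
    dotProduct_comm]

lemma th_iso (hU : A * Aᴴ = 1) (a b : Fin K → ℂ) :
    star (A *ᵥ star a) ⬝ᵥ (A *ᵥ star b) = star (star a ⬝ᵥ b) := by
  have hU' : Aᴴ * A = 1 := mul_eq_one_comm.1 hU
  rw [Matrix.star_mulVec, star_star, Matrix.dotProduct_mulVec, Matrix.vecMul_vecMul, hU', Matrix.vecMul_one,
    ← Matrix.star_dotProduct_star, star_star, dotProduct_comm]
  
  

lemma star_dot (a b : Fin K → ℂ) : star (star a ⬝ᵥ b) = star b ⬝ᵥ a := by
  rw [← Matrix.star_dotProduct]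

lemma exists_family (hA : Aᵀ = -A) (k : ℕ) (hk : k * 2 ≤ K) :
    ∃ v : Fin k → (Fin K → ℂ), (∀ i j, star (v i) ⬝ᵥ v j = if i = j then 1 else 0) ∧
      ∀ i j, star (v i) ⬝ᵥ (A *ᵥ star (v j)) = 0 := by
  induction k with
  | zero => exact ⟨fun i => i.elim0, fun i => i.elim0, fun i => i.elim0⟩
  | succ k ih =>
    obtain ⟨v, hv1, hv2⟩ := ih (by omega)
    let L : (Fin K → ℂ) →ₗ[ℂ] (Fin k ⊕ Fin k → ℂ) :=
      Matrix.mulVecLin (Matrix.of (Sum.elim (fun i => star (v i)) (fun i => star (A *ᵥ star (v i)))))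
    have hL : LinearMap.ker L ≠ ⊥ := by
      apply LinearMap.ker_ne_bot_of_finrank_lt
      simp; omega
    obtain ⟨w0, hw0, hne⟩ := Submodule.exists_mem_ne_zero_of_ne_bot hL
    have e1 : ∀ i, star (v i) ⬝ᵥ w0 = 0 := fun i => congrFun (LinearMap.mem_ker.1 hw0) (Sum.inl i)
    have e2 : ∀ i, star (A *ᵥ star (v i)) ⬝ᵥ w0 = 0 := fun i => congrFun (LinearMap.mem_ker.1 hw0) (Sum.inr i)
    obtain ⟨r, hr, hr0⟩ : ∃ r : ℝ, star w0 ⬝ᵥ w0 = (r : ℂ) ∧ 0 < r := by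
      refine ⟨∑ i, Complex.normSq (w0 i), ?_, ?_⟩
      · simp [dotProduct, mul_comm, Complex.mul_conj]
      · refine lt_of_le_of_ne (Finset.sum_nonneg fun _ _ => Complex.normSq_nonneg _) ?_
        intro h0
        apply hne
        rw [eq_comm, Finset.sum_eq_zero_iff_of_nonneg (fun _ _ => Complex.normSq_nonneg _)] at h0
        funext i
        exact Complex.normSq_eq_zero.1 (h0 i (Finset.mem_univ _))
    let w := (((Real.sqrt r)⁻¹ : ℝ) : ℂ) • w0
    have f1 : ∀ i, star (v i) ⬝ᵥ w = 0 := fun i => by simp [w, e1]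
    have f2 : ∀ i, star (A *ᵥ star (v i)) ⬝ᵥ w = 0 := fun i => by rw [dotProduct_smul, e2, smul_zero]
    have f3 : star w ⬝ᵥ w = 1 := by
      simp only [w, star_smul, smul_dotProduct, dotProduct_smul, hr, smul_eq_mul]
      have : star (((Real.sqrt r)⁻¹ : ℝ) : ℂ) = (((Real.sqrt r)⁻¹ : ℝ) : ℂ) := Complex.conj_ofReal _
      rw [this, ← Complex.ofReal_mul, ← Complex.ofReal_mul]
      have h2 := Real.mul_self_sqrt hr0.le
      have h3 : Real.sqrt r ≠ 0 := (Real.sqrt_pos.2 hr0).ne'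
      rw [← Complex.ofReal_one]
      congr 1
      field_simp
      nlinarith
    have f4 : star w ⬝ᵥ (A *ᵥ star w) = 0 := by
      have := th_anti A hA w w
      exact self_eq_neg.1 this
    refine ⟨Fin.cons w v, ?_, ?_⟩
    · intro i j
      refine Fin.cases ?_ (fun i => ?_) i <;> refine Fin.cases ?_ (fun j => ?_) j
      · simpa using f3
      · simp only [Fin.cons_zero, Fin.cons_succ]
        rw [← star_dot, f1, star_zero, if_neg (Fin.succ_ne_zero j).symm]
      · simp only [Fin.cons_zero, Fin.cons_succ]
        rw [f1, if_neg (Fin.succ_ne_zero i)]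
      · simp only [Fin.cons_succ, Fin.succ_inj]; exact hv1 i j
    · intro i j
      refine Fin.cases ?_ (fun i => ?_) i <;> refine Fin.cases ?_ (fun j => ?_) j
      · simpa using f4
      · simp only [Fin.cons_zero, Fin.cons_succ]
        rw [← star_dot, f2, star_zero]
      · simp only [Fin.cons_zero, Fin.cons_succ]
        rw [th_anti A hA, ← star_dot, f2, star_zero, neg_zero]
      · simp only [Fin.cons_succ]; exact hv2 i j

lemma exists_symp (hK : Even K) (hA : Aᵀ = -A) (hU : A * Aᴴ = 1) :
    ∃ V : Matrix.unitaryGroup (Fin K) ℂ, A = (V : Matrix (Fin K) (Fin K) ℂ) * sympJ K * (V : Matrix (Fin K) (Fin K) ℂ)ᵀ := by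
  obtain ⟨q, rfl⟩ : ∃ q, K = q * 2 := by obtain ⟨q, rfl⟩ := hK; exact ⟨q, by ring⟩
  obtain ⟨v, hv1, hv2⟩ := exists_family A hA q le_rfl
  -- rows of Vᵀ
  let col : Fin q × Fin 2 → (Fin (q * 2) → ℂ) := fun ab => if ab.2 = 0 then v ab.1 else - (A *ᵥ star (v ab.1))
  let V : Matrix (Fin (q * 2)) (Fin (q * 2)) ℂ := Matrix.of fun i j => col (finProdFinEquiv.symm j) i
  have hAA : ∀ w : Fin (q * 2) → ℂ, A *ᵥ star (A *ᵥ star w) = - w := by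
    intro w
    rw [Matrix.star_mulVec, star_star, ← Matrix.mulVec_transpose, Matrix.mulVec_mulVec]
    have : (Aᴴ)ᵀ = - Aᴴ := by
      have h0 := congrArg Matrix.conjTranspose hA
      rw [Matrix.conjTranspose_neg] at h0
      rw [← h0]; rfl
    rw [this, mul_neg, hU, Matrix.neg_mulVec, Matrix.one_mulVec]
  have hdot : ∀ s t, star (col s) ⬝ᵥ col t = if s = t then 1 else 0 := by
    rintro ⟨a, b⟩ ⟨a', b'⟩
    fin_cases b <;> fin_cases b' <;> simp [col, hv1, hv2]
    · rw [← star_dot, hv2, star_zero]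
    · rw [th_iso A hU, hv1]; split_ifs <;> simp
  have hVV : Vᴴ * V = 1 := by
    ext i j
    have := hdot (finProdFinEquiv.symm i) (finProdFinEquiv.symm j)
    simp only [EmbeddingLike.apply_eq_iff_eq] at this
    rw [Matrix.one_apply, ← this]
    rfl
  have hVV' : V * Vᴴ = 1 := mul_eq_one_comm.1 hVV
  have hAV : A * (Vᴴ)ᵀ = V * sympJ (q * 2) := by
    ext i j
    obtain ⟨⟨a, b⟩, rfl⟩ := finProdFinEquiv.surjective j
    have e1 : (A * (Vᴴ)ᵀ) i (finProdFinEquiv (a, b)) = (A *ᵥ star (col (a, b))) i := by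
      simp only [Matrix.mul_apply, Matrix.mulVec, dotProduct, Matrix.transpose_apply, Matrix.conjTranspose_apply, V,
        Matrix.of_apply, Equiv.symm_apply_apply]
      rfl
    rw [e1, Matrix.mul_apply, ← finProdFinEquiv.sum_comp, Fintype.sum_prod_type]
    have hV : ∀ ab, V i (finProdFinEquiv ab) = col ab i := by
      intro ab; simp only [V, Matrix.of_apply, Equiv.symm_apply_apply]
    simp only [sympJ_block, Fin.sum_univ_two, hV]
    rw [Finset.sum_eq_single a]
    · fin_cases b
      · simp [col]
      · simp [col, Matrix.mulVec_neg, hAA]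
    · intro c _ hc
      simp [hc]
    · simp
  refine ⟨⟨V, Matrix.mem_unitaryGroup_iff.2 hVV'⟩, ?_⟩
  change A = V * sympJ (q * 2) * Vᵀ
  rw [← hAV, mul_assoc, ← Matrix.transpose_mul, hVV', Matrix.transpose_one, mul_one]

end Trans



section Act
variable {K : ℕ}

noncomputable def actT (U : Matrix.unitaryGroup (Fin K) ℂ) (G : Fin K → Fin K → ℂ) : Fin K → Fin K → ℂ :=
  ((U : Matrix (Fin K) (Fin K) ℂ)ᴴ * Matrix.of G * ((U : Matrix (Fin K) (Fin K) ℂ)ᴴ)ᵀ)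

lemma of_actT (U : Matrix.unitaryGroup (Fin K) ℂ) (G : Fin K → Fin K → ℂ) :
    Matrix.of (actT U G) = (U : Matrix (Fin K) (Fin K) ℂ)ᴴ * Matrix.of G * ((U : Matrix (Fin K) (Fin K) ℂ)ᴴ)ᵀ := rfl

lemma Qm_eq (G : Fin K → Fin K → ℂ) : Qm G = Matrix.of G - (Matrix.of G)ᵀ := rfl

lemma Qm_actT (U : Matrix.unitaryGroup (Fin K) ℂ) (G : Fin K → Fin K → ℂ) :
    Qm (actT U G) = (U : Matrix (Fin K) (Fin K) ℂ)ᴴ * Qm G * ((U : Matrix (Fin K) (Fin K) ℂ)ᴴ)ᵀ := by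
  rw [Qm_eq, of_actT, Qm_eq]
  simp only [Matrix.transpose_mul, Matrix.transpose_transpose, mul_sub, sub_mul, mul_assoc]

lemma nrm2_eq (G : Fin K → Fin K → ℂ) : (nrm2 G : ℂ) = (Matrix.of G * (Matrix.of G)ᴴ).trace := by
  simp only [nrm2, Matrix.trace, Matrix.diag, Matrix.mul_apply, Matrix.conjTranspose_apply, Matrix.of_apply]
  push_cast
  refine Finset.sum_congr rfl fun i _ => Finset.sum_congr rfl fun j _ => ?_
  exact (Complex.mul_conj _).symm

lemma U_mul (U : Matrix.unitaryGroup (Fin K) ℂ) :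
    (U : Matrix (Fin K) (Fin K) ℂ) * (U : Matrix (Fin K) (Fin K) ℂ)ᴴ = 1 :=
  Matrix.mem_unitaryGroup_iff.1 U.2

lemma U_mul' (U : Matrix.unitaryGroup (Fin K) ℂ) :
    (U : Matrix (Fin K) (Fin K) ℂ)ᴴ * (U : Matrix (Fin K) (Fin K) ℂ) = 1 :=
  Matrix.mem_unitaryGroup_iff'.1 U.2

lemma Ubar_mul (U : Matrix.unitaryGroup (Fin K) ℂ) :
    ((U : Matrix (Fin K) (Fin K) ℂ)ᴴ)ᵀ * (((U : Matrix (Fin K) (Fin K) ℂ)ᴴ)ᵀ)ᴴ = 1 := by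
  have : (((U : Matrix (Fin K) (Fin K) ℂ)ᴴ)ᵀ)ᴴ = (U : Matrix (Fin K) (Fin K) ℂ)ᵀ := by
    ext i j; simp
  rw [this, ← Matrix.transpose_mul, U_mul, Matrix.transpose_one]

lemma nrm2_actT (U : Matrix.unitaryGroup (Fin K) ℂ) (G : Fin K → Fin K → ℂ) :
    nrm2 (actT U G) = nrm2 G := by
  have h : (nrm2 (actT U G) : ℂ) = nrm2 G := by
    rw [nrm2_eq, nrm2_eq, of_actT, Matrix.conjTranspose_mul, Matrix.conjTranspose_mul,
      Matrix.conjTranspose_conjTranspose]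
    rw [mul_assoc, ← mul_assoc (((U : Matrix (Fin K) (Fin K) ℂ)ᴴ)ᵀ), Ubar_mul, one_mul, mul_assoc,
      Matrix.trace_mul_comm, mul_assoc, mul_assoc, U_mul, mul_one]
  exact_mod_cast h

lemma normSq_det_U (U : Matrix.unitaryGroup (Fin K) ℂ) : 
    Complex.normSq ((U : Matrix (Fin K) (Fin K) ℂ).det) = 1 := by
  have h := congrArg Matrix.det (U_mul U)
  rw [Matrix.det_mul, Matrix.det_conjTranspose, Matrix.det_one] at h
  have h2 : (U : Matrix (Fin K) (Fin K) ℂ).det * star (U : Matrix (Fin K) (Fin K) ℂ).det = 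
    ((Complex.normSq (U : Matrix (Fin K) (Fin K) ℂ).det : ℝ) : ℂ) := Complex.mul_conj _
  rw [h2] at h
  exact_mod_cast h

lemma WW_actT (U : Matrix.unitaryGroup (Fin K) ℂ) (G : Fin K → Fin K → ℂ) :
    WW (actT U G) = WW G := by
  rw [WW, WW, nrm2_actT, Qm_actT, Matrix.det_mul, Matrix.det_mul, Matrix.det_transpose,
    Matrix.det_conjTranspose, map_mul, map_mul]
  have : Complex.normSq (star (U : Matrix (Fin K) (Fin K) ℂ).det) = 1 := by
    rw [← normSq_det_U U]; exact Complex.normSq_conj _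
  rw [this]; ring

lemma continuous_actT : Continuous (fun p : Matrix.unitaryGroup (Fin K) ℂ × (Fin K → Fin K → ℂ) => actT p.1 p.2) := by
  have h1 : Continuous (fun p : Matrix.unitaryGroup (Fin K) ℂ × (Fin K → Fin K → ℂ) => (p.1 : Matrix (Fin K) (Fin K) ℂ)) :=
    continuous_subtype_val.comp continuous_fst
  have h2 : Continuous (fun p : Matrix.unitaryGroup (Fin K) ℂ × (Fin K → Fin K → ℂ) => (Matrix.of p.2 : Matrix (Fin K) (Fin K) ℂ)) :=
    continuous_snd
  exact (h1.matrix_conjTranspose.mul h2).mul h1.matrix_conjTranspose.matrix_transpose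

lemma continuous_nrm2 : Continuous (nrm2 (K := K)) := by
  unfold nrm2
  refine continuous_finsetSum _ fun i _ => continuous_finsetSum _ fun j _ => ?_
  exact Complex.continuous_normSq.comp (by fun_prop)

lemma normSq_le_nrm2 (G : Fin K → Fin K → ℂ) (i j : Fin K) : Complex.normSq (G i j) ≤ nrm2 G := by
  unfold nrm2
  calc _ ≤ ∑ m', Complex.normSq (G i m') :=
        Finset.single_le_sum (f := fun m' => Complex.normSq (G i m')) (fun _ _ => Complex.normSq_nonneg _) (Finset.mem_univ j)
    _ ≤ _ := Finset.single_le_sum (f := fun m => ∑ m', Complex.normSq (G m m')) (fun _ _ => Finset.sum_nonneg fun _ _ => Complex.normSq_nonneg _) (Finset.mem_univ i)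

lemma nrm2_nonneg (G : Fin K → Fin K → ℂ) : 0 ≤ nrm2 G :=
  Finset.sum_nonneg fun _ _ => Finset.sum_nonneg fun _ _ => Complex.normSq_nonneg _

lemma norm_sq_le_nrm2 (G : Fin K → Fin K → ℂ) : ‖G‖ ≤ Real.sqrt (nrm2 G) := by
  rw [pi_norm_le_iff_of_nonneg (Real.sqrt_nonneg _)]
  intro i
  rw [pi_norm_le_iff_of_nonneg (Real.sqrt_nonneg _)]
  intro j
  apply Real.le_sqrt_of_sq_le
  rw [← Complex.normSq_eq_norm_sq]
  exact normSq_le_nrm2 G i j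

noncomputable def actL (U : Matrix.unitaryGroup (Fin K) ℂ) : (Fin K → Fin K → ℂ) →ₗ[ℝ] (Fin K → Fin K → ℂ) where
  toFun := actT U
  map_add' a b := by
    change (U : Matrix (Fin K) (Fin K) ℂ)ᴴ * (Matrix.of a + Matrix.of b) * ((U : Matrix (Fin K) (Fin K) ℂ)ᴴ)ᵀ = 
      (U : Matrix (Fin K) (Fin K) ℂ)ᴴ * (Matrix.of a) * ((U : Matrix (Fin K) (Fin K) ℂ)ᴴ)ᵀ + (U : Matrix (Fin K) (Fin K) ℂ)ᴴ * (Matrix.of b) * ((U : Matrix (Fin K) (Fin K) ℂ)ᴴ)ᵀ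
    rw [mul_add, add_mul]
  map_smul' r a := by
    change (U : Matrix (Fin K) (Fin K) ℂ)ᴴ * (r • Matrix.of a) * ((U : Matrix (Fin K) (Fin K) ℂ)ᴴ)ᵀ = 
      r • ((U : Matrix (Fin K) (Fin K) ℂ)ᴴ * (Matrix.of a) * ((U : Matrix (Fin K) (Fin K) ℂ)ᴴ)ᵀ)
    rw [Matrix.mul_smul, Matrix.smul_mul]

lemma actT_inj (U : Matrix.unitaryGroup (Fin K) ℂ) : Function.Injective (actL U) := by
  rw [← LinearMap.ker_eq_bot, LinearMap.ker_eq_bot']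
  intro G hG
  have h : nrm2 G = 0 := by
    rw [← nrm2_actT U G]
    have : actT U G = 0 := hG
    rw [this]; simp [nrm2]
  have := norm_sq_le_nrm2 G
  rw [h, Real.sqrt_zero] at this
  exact norm_le_zero_iff.1 this

instance volHaar1 : (volume : Measure (Fin K → ℂ)).IsAddHaarMeasure :=
  Measure.pi.isAddHaarMeasure (fun _ : Fin K => (volume : Measure ℂ))

instance volHaar2 : (volume : Measure (Fin K → Fin K → ℂ)).IsAddHaarMeasure :=
  Measure.pi.isAddHaarMeasure (fun _ : Fin K => (volume : Measure (Fin K → ℂ)))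

lemma actT_mp (U : Matrix.unitaryGroup (Fin K) ℂ) : MeasurePreserving (actT U) (volume : Measure (Fin K → Fin K → ℂ)) volume := by
  have hcont : Continuous (actT U) := (actL U).continuous_of_finiteDimensional
  refine ⟨hcont.measurable, ?_⟩
  have hdet : LinearMap.det (actL U) ≠ 0 := by
    have := (LinearEquiv.ofInjectiveEndo (actL U) (actT_inj U)).isUnit_det'
    exact this.ne_zero
  have h := Measure.map_linearMap_addHaar_eq_smul_addHaar (volume : Measure (Fin K → Fin K → ℂ)) hdet
  have h' : Measure.map (actT U) (volume : Measure (Fin K → Fin K → ℂ)) = ENNReal.ofReal |(LinearMap.det (actL U))⁻¹| • volume := h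
  rw [h']
  set B : Set (Fin K → Fin K → ℂ) := {G | nrm2 G < 1}
  have hBo : IsOpen B := isOpen_lt continuous_nrm2 continuous_const
  have hB0 : (volume B) ≠ 0 := (hBo.measure_pos _ ⟨0, by simp [B, nrm2]⟩).ne'
  have hBf : volume B ≠ ⊤ := by
    have : B ⊆ Metric.closedBall 0 1 := by
      intro G hG
      rw [mem_closedBall_zero_iff]
      exact (norm_sq_le_nrm2 G).trans (Real.sqrt_le_one.2 (le_of_lt hG))
    exact ((measure_mono this).trans_lt (isCompact_closedBall _ _).measure_lt_top).ne
  have h2 := congrArg (fun m => m B) h'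
  simp only [Measure.smul_apply, smul_eq_mul] at h2
  rw [Measure.map_apply hcont.measurable hBo.measurableSet] at h2
  have h3 : actT U ⁻¹' B = B := by
    ext G; simp only [B, Set.mem_preimage, Set.mem_ofPred_eq, nrm2_actT]
  rw [h3] at h2
  have h4 : ENNReal.ofReal |(LinearMap.det (actL U))⁻¹| = 1 := by
    have := ENNReal.mul_left_inj hB0 hBf (b := ENNReal.ofReal |(LinearMap.det (actL U))⁻¹|) (a := 1)
    rw [one_mul] at this
    exact (this.1 h2).symm
  rw [h4, one_smul]

end Act



section Wt
variable {K : ℕ}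

noncomputable def wt (x : Fin K → ℝ) (t : ℝ) (G : Fin K → Fin K → ℂ) : ℂ :=
  (Real.exp (-8 * nrm2 G) : ℂ) * (dualB G (fun i => t * x i)).det

lemma nrm2_smul (r : ℝ) (G : Fin K → Fin K → ℂ) : nrm2 (r • G) = r ^ 2 * nrm2 G := by
  simp only [nrm2, Finset.mul_sum]
  refine Finset.sum_congr rfl fun i _ => Finset.sum_congr rfl fun j _ => ?_
  simp [Complex.normSq_ofReal, pow_two]

lemma dualB_smul (r : ℝ) (G : Fin K → Fin K → ℂ) (x : Fin K → ℝ) :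
    dualB (r • G) (fun i => r * x i) = (r : ℂ) • dualB G x := by
  rw [dualB, dualB, Matrix.fromBlocks_smul]
  congr 1
  · ext i j; simp [mul_sub]
  · ext i j; simp only [Matrix.neg_apply, Matrix.smul_apply, Matrix.diagonal_apply]; split_ifs <;> simp
  · ext i j; simp only [Matrix.smul_apply, Matrix.diagonal_apply]; split_ifs <;> simp
  · ext i j; simp; ring

lemma duality2 (p : ℕ) (hp : 0 < p) : ∃ c : ℂ, ∀ x : Fin K → ℝ,
    ((∫ M, ∏ m : Fin K, (M - x m • (1 : Matrix (Fin (2 * p)) (Fin (2 * p)) ℝ)).det ∂(ginibre (2 * p) 1) : ℝ) : ℂ) =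
      c * ∫ G : Fin K → Fin K → ℂ, wt x (Real.sqrt (2 * p))⁻¹ G ^ p := by
  obtain ⟨c, hc⟩ := duality K p
  set R : ℝ := Real.sqrt (2 * p) with hR
  have hR0 : R ≠ 0 := by rw [hR]; positivity
  have hR2 : R ^ 2 = 2 * p := Real.sq_sqrt (by positivity)
  refine ⟨c * (((|(R ^ Module.finrank ℝ (Fin K → Fin K → ℂ))⁻¹| : ℝ) : ℂ)⁻¹ * ((R : ℂ) ^ (2 * K)) ^ p), fun x => ?_⟩
  rw [hc, mul_assoc]
  congr 1
  have h := Measure.integral_comp_smul (volume : Measure (Fin K → Fin K → ℂ))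
    (fun G : Fin K → Fin K → ℂ => (Real.exp (-4 * nrm2 G) : ℂ) * (dualB G x).det ^ p) R
  rw [mul_assoc, eq_inv_mul_iff_mul_eq₀, ← integral_const_mul (((R : ℂ) ^ (2 * K)) ^ p)]
  · rw [Complex.real_smul] at h
    refine h.symm.trans ?_
    congr 1
    funext G
    have e1 : dualB (R • G) x = (R : ℂ) • dualB G (fun i => R⁻¹ * x i) := by
      rw [← dualB_smul]; congr 1; funext i; field_simp
    rw [e1, Matrix.det_smul, nrm2_smul, wt, hR2]
    have e2 : Fintype.card (Fin K ⊕ Fin K) = 2 * K := by simp; ring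
    have e3 : Real.exp (-4 * (2 * p * nrm2 G)) = Real.exp (-8 * nrm2 G) ^ p := by
      rw [← Real.exp_nat_mul]; congr 1; ring
    rw [e2, e3]
    push_cast
    ring
  · exact Complex.ofReal_ne_zero.2 (abs_ne_zero.2 (inv_ne_zero (pow_ne_zero _ hR0)))

lemma wt_zero (hK : Even K) (x : Fin K → ℝ) (G : Fin K → Fin K → ℂ) : wt x 0 G = WW G := by
  have : dualB G (fun i => 0 * x i) = Matrix.fromBlocks (Qm G) 0 0 (-(Qm G).map (starRingEnd ℂ)) := by
    rw [dualB]; congr 1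
    · ext i j; simp [Matrix.diagonal_apply]
    · ext i j; simp [Matrix.diagonal_apply]
  rw [wt, this, Matrix.det_fromBlocks_zero₂₁, WW, Matrix.det_neg]
  have h2 : ((Qm G).map (starRingEnd ℂ)).det = (starRingEnd ℂ) (Qm G).det := (RingHom.map_det _ _).symm
  rw [h2, Fintype.card_fin, hK.neg_one_pow, one_mul, Complex.mul_conj]
  push_cast; rfl

lemma continuous_wt (x : Fin K → ℝ) : Continuous (fun q : ℝ × (Fin K → Fin K → ℂ) => wt x q.1 q.2) := by
  unfold wt
  refine Continuous.mul ?_ ?_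
  · have := continuous_nrm2 (K := K)
    fun_prop
  · apply Continuous.matrix_det
    unfold dualB
    refine Continuous.matrix_fromBlocks ?_ ?_ ?_ ?_
    · refine continuous_matrix fun i j => ?_
      simp only [Matrix.of_apply]; fun_prop
    · refine continuous_matrix fun i j => ?_
      simp only [Matrix.diagonal_apply, Matrix.neg_apply]; split_ifs <;> fun_prop
    · refine continuous_matrix fun i j => ?_
      simp only [Matrix.diagonal_apply]; split_ifs <;> fun_prop
    · refine continuous_matrix fun i j => ?_
      simp only [Matrix.of_apply, Matrix.neg_apply]
      have := Complex.continuous_conj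
      fun_prop

lemma wt_bound (x : Fin K → ℝ) : ∃ C : ℝ, 0 < C ∧ ∀ t : ℝ, |t| ≤ 1 → ∀ G, ‖wt x t G‖ ≤ C * Real.exp (-nrm2 G) := by
  obtain ⟨b, hb0, hb⟩ : ∃ b : ℝ, 0 ≤ b ∧ ∀ i, |x i| ≤ b :=
    ⟨∑ i, |x i|, Finset.sum_nonneg fun _ _ => abs_nonneg _, fun i =>
      Finset.single_le_sum (f := fun i => |x i|) (fun _ _ => abs_nonneg _) (Finset.mem_univ i)⟩
  refine ⟨(2 * K).factorial * ((2 * K).factorial * Real.exp (1 + b)), by positivity, fun t ht G => ?_⟩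
  have hr := nrm2_nonneg G
  have hG : ∀ i j, ‖G i j‖ ≤ Real.sqrt (nrm2 G) := by
    intro i j
    apply Real.le_sqrt_of_sq_le
    rw [← Complex.normSq_eq_norm_sq]
    exact normSq_le_nrm2 G i j
  have hs : 2 * Real.sqrt (nrm2 G) ≤ 1 + nrm2 G := by
    have := Real.sq_sqrt hr
    nlinarith [sq_nonneg (Real.sqrt (nrm2 G) - 1)]
  have hx : ∀ i, ‖((t * x i : ℝ) : ℂ)‖ ≤ b := by
    intro i
    rw [Complex.norm_real, Real.norm_eq_abs, abs_mul]
    calc |t| * |x i| ≤ 1 * b := mul_le_mul ht (hb i) (abs_nonneg _) zero_le_one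
      _ = b := one_mul _
  have hd : ‖(dualB G (fun i => t * x i)).det‖ ≤ (Fintype.card (Fin K ⊕ Fin K)).factorial • (1 + b + nrm2 G) ^ Fintype.card (Fin K ⊕ Fin K) := by
    refine Matrix.det_le (abv := NormedField.toAbsoluteValue ℂ) ?_
    have hq : ∀ i j, ‖G i j - G j i‖ ≤ 1 + b + nrm2 G := by
      intro i j
      have := norm_sub_le (G i j) (G j i)
      linarith [hG i j, hG j i]
    rintro (i | i) (j | j)
    · exact hq i j
    · change ‖dualB G (fun i => t * x i) (Sum.inl i) (Sum.inr j)‖ ≤ _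
      simp only [dualB, Matrix.fromBlocks_apply₁₂, Matrix.neg_apply, Matrix.diagonal_apply, norm_neg]
      split_ifs
      · linarith [hx i]
      · rw [norm_zero]; linarith
    · change ‖dualB G (fun i => t * x i) (Sum.inr i) (Sum.inl j)‖ ≤ _
      simp only [dualB, Matrix.fromBlocks_apply₂₁, Matrix.diagonal_apply]
      split_ifs
      · linarith [hx i]
      · rw [norm_zero]; linarith
    · change ‖dualB G (fun i => t * x i) (Sum.inr i) (Sum.inr j)‖ ≤ _
      simp only [dualB, Matrix.fromBlocks_apply₂₂, Matrix.neg_apply, Matrix.of_apply, norm_neg]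
      rw [RCLike.norm_conj]
      exact hq i j
  have e2 : Fintype.card (Fin K ⊕ Fin K) = 2 * K := by simp; ring
  rw [e2, nsmul_eq_mul] at hd
  have hp := Real.pow_div_factorial_le_exp (1 + b + nrm2 G) (by linarith) (2 * K)
  rw [div_le_iff₀ (by positivity)] at hp
  rw [wt, norm_mul, Complex.norm_real, Real.norm_eq_abs, abs_of_pos (Real.exp_pos _)]
  calc _ ≤ Real.exp (-8 * nrm2 G) * ((2 * K).factorial * (Real.exp (1 + b + nrm2 G) * (2 * K).factorial)) := by
        gcongr
        exact hd.trans (by gcongr)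
    _ = (2 * K).factorial * ((2 * K).factorial * Real.exp (1 + b)) * Real.exp (-7 * nrm2 G) := by
        rw [show -7 * nrm2 G = -8 * nrm2 G + nrm2 G by ring, Real.exp_add (-8 * nrm2 G), Real.exp_add (1 + b)]; ring
    _ ≤ _ := by
        gcongr
        linarith

lemma integrable_exp_nrm2 : Integrable (fun G : Fin K → Fin K → ℂ => Real.exp (-nrm2 G)) := by
  have h0 : Integrable (fun z : ℂ => Real.exp (-Complex.normSq z)) := by
    have := GaussianFourier.integrable_cexp_neg_mul_sq_norm_add (V := ℂ) (b := 1) (by simp) 0 0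
    have := this.norm
    refine this.congr ?_
    filter_upwards with z
    rw [Complex.norm_exp, Complex.normSq_eq_norm_sq]
    congr 1
    simp [← Complex.ofReal_pow]
  have h1 := Integrable.fintype_prod (μ := fun _ : Fin K => (volume : Measure ℂ)) (fun _ : Fin K => h0)
  have h2 := Integrable.fintype_prod (μ := fun _ : Fin K => (Measure.pi fun _ : Fin K => (volume : Measure ℂ))) (fun _ : Fin K => h1)
  refine h2.congr ?_
  filter_upwards with G
  simp only [← Real.exp_sum, nrm2, Finset.sum_neg_distrib]

end Wt



section Loc
variable {K : ℕ}

lemma det_expand (ε : ℝ) (hε : 0 < ε) : ∃ δ : ℝ, 0 < δ ∧ ∀ H : Fin K → Fin K → ℂ, ‖H‖ ≤ δ →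
    ‖(1 + Matrix.of H).det - 1 - (Matrix.of H).trace‖ ≤ ε * ‖H‖ := by
  have hd : DifferentiableAt ℂ (fun H : Fin K → Fin K → ℂ => (1 + Matrix.of H).det) 0 := by
    simp only [Matrix.det_apply, Matrix.add_apply, Matrix.of_apply]
    fun_prop
  have hf := hd.hasFDerivAt
  set L := fderiv ℂ (fun H : Fin K → Fin K → ℂ => (1 + Matrix.of H).det) 0 with hL
  have hLt : ∀ H : Fin K → Fin K → ℂ, L H = (Matrix.of H).trace := by
    intro H
    have h1 : HasDerivAt (fun s : ℂ => (1 + Matrix.of (s • H)).det) (L H) 0 := by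
      have h2 : HasDerivAt (fun s : ℂ => s • H) H 0 := by
        simpa using (hasDerivAt_id (0 : ℂ)).smul_const H
      have hf' : HasFDerivAt (fun H : Fin K → Fin K → ℂ => (1 + Matrix.of H).det) L ((0 : ℂ) • H) := by
        rw [zero_smul]; exact hf
      exact hf'.comp_hasDerivAt (0 : ℂ) h2
    have h3 : HasDerivAt (fun s : ℂ => (1 + Matrix.of (s • H)).det) ((Matrix.of H).trace) 0 := by
      have e : (fun s : ℂ => (1 + Matrix.of (s • H)).det) = fun s : ℂ => 1 + (Matrix.of H).trace * s +
          ((Matrix.det (1 + (Polynomial.X : Polynomial ℂ) • (Matrix.of H).map Polynomial.C)).divX.divX.eval s) * s ^ 2 := by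
        funext s
        rw [← Matrix.det_one_add_smul]; rfl
      rw [e]
      have hp := ((Matrix.det (1 + (Polynomial.X : Polynomial ℂ) • (Matrix.of H).map Polynomial.C)).divX.divX).hasDerivAt (0 : ℂ)
      have h4 := hp.mul ((hasDerivAt_id (0 : ℂ)).pow 2)
      have h5 := (((hasDerivAt_id (0 : ℂ)).const_mul (Matrix.of H).trace).const_add 1).add h4
      refine (h5.congr_deriv ?_)
      simp
    exact h1.unique h3
  have ho := hasFDerivAt_iff_isLittleO_nhds_zero.1 hf
  have := ho.bound hε
  rw [Metric.eventually_nhds_iff] at this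
  obtain ⟨δ, hδ, h⟩ := this
  refine ⟨δ / 2, by positivity, fun H hH => ?_⟩
  have := h (y := H) (by rw [dist_zero_right]; linarith)
  simpa [hLt] using this

lemma norm_pow_sub_pow_le' (a b : ℂ) (M : ℝ) (hM : 1 ≤ M) (ha : ‖a‖ ≤ M) (hb : ‖b‖ ≤ M) (n : ℕ) :
    ‖a ^ n - b ^ n‖ ≤ n * M ^ n * ‖a - b‖ := by
  induction n with
  | zero => simp
  | succ n ih =>
    have e : a ^ (n + 1) - b ^ (n + 1) = a * (a ^ n - b ^ n) + (a - b) * b ^ n := by ring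
    have h1 : ‖b ^ n‖ ≤ M ^ (n + 1) := by
      rw [norm_pow]
      exact (pow_le_pow_left₀ (norm_nonneg _) hb n).trans (pow_le_pow_right₀ hM (Nat.le_succ n))
    calc ‖a ^ (n + 1) - b ^ (n + 1)‖ ≤ ‖a‖ * ‖a ^ n - b ^ n‖ + ‖a - b‖ * ‖b ^ n‖ := by
          rw [e]; refine (norm_add_le _ _).trans ?_; rw [norm_mul, norm_mul]
      _ ≤ M * (n * M ^ n * ‖a - b‖) + ‖a - b‖ * M ^ (n + 1) := by gcongr
      _ = _ := by push_cast; ring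

lemma detpow_unif (R : ℝ) (hR : 0 ≤ R) (ε : ℝ) (hε : 0 < ε) : ∀ᶠ p : ℕ in Filter.atTop,
    ∀ H : Fin K → Fin K → ℂ, ‖H‖ ≤ R →
      ‖(1 + ((p : ℂ)⁻¹) • Matrix.of H).det ^ p - Complex.exp (Matrix.of H).trace‖ ≤ ε := by
  set T : ℝ := K * R with hT
  have hT0 : 0 ≤ T := by positivity
  set E : ℝ := Real.exp (T + R) with hE
  have hE0 : 0 < E := Real.exp_pos _
  set ε₁ : ℝ := min 1 (ε / (2 * E * (R + 1))) with hε₁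
  have hε₁0 : 0 < ε₁ := lt_min one_pos (by positivity)
  obtain ⟨δ, hδ, hdet⟩ := det_expand (K := K) ε₁ hε₁0
  have c1 : ∀ᶠ p : ℕ in Filter.atTop, R / δ ≤ p := tendsto_natCast_atTop_atTop.eventually_ge_atTop _
  have c2 : ∀ᶠ p : ℕ in Filter.atTop, 2 * T ^ 2 * E / ε ≤ p := tendsto_natCast_atTop_atTop.eventually_ge_atTop _
  have c3 : ∀ᶠ p : ℕ in Filter.atTop, T + 1 ≤ p := tendsto_natCast_atTop_atTop.eventually_ge_atTop _
  filter_upwards [c1, c2, c3] with p h1 h2 h3 H hH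
  have hp : (0 : ℝ) < p := by linarith
  have hpc : (p : ℂ) ≠ 0 := by exact_mod_cast hp.ne'
  set τ := (Matrix.of H).trace with hτ
  have hτn : ‖τ‖ ≤ T := by
    rw [hτ, Matrix.trace]
    refine (norm_sum_le _ _).trans ?_
    refine (Finset.sum_le_sum (g := fun _ => R) fun i _ => ?_).trans ?_
    · exact ((norm_le_pi_norm (H i) i).trans (norm_le_pi_norm H i)).trans hH
    · simp [hT]
  have hHp : ‖(p : ℂ)⁻¹ • H‖ ≤ R / p := by
    rw [norm_smul, norm_inv, Complex.norm_natCast, inv_mul_eq_div]; gcongr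
  have hb1 := hdet ((p : ℂ)⁻¹ • H) (hHp.trans (by rw [div_le_iff₀ hp]; rw [div_le_iff₀ hδ] at h1; linarith))
  have e1 : (Matrix.of ((p : ℂ)⁻¹ • H)) = (p : ℂ)⁻¹ • Matrix.of H := rfl
  rw [e1, Matrix.trace_smul, ← hτ, smul_eq_mul, inv_mul_eq_div] at hb1
  set a := (1 + ((p : ℂ)⁻¹) • Matrix.of H).det with ha
  have hb1' : ‖a - 1 - τ / p‖ ≤ ε₁ * (R / p) := hb1.trans (by gcongr)
  have hτp : ‖τ / p‖ ≤ T / p := by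
    rw [norm_div, Complex.norm_natCast]; gcongr
  have hb2 : ‖Complex.exp (τ / p) - 1 - τ / p‖ ≤ (T / p) ^ 2 := by
    refine (Complex.norm_exp_sub_one_sub_id_le ?_).trans (by gcongr)
    refine hτp.trans ?_
    rw [div_le_one hp]; linarith
  have hM : (1 : ℝ) ≤ Real.exp ((T + R) / p) := Real.one_le_exp (by positivity)
  have hMb : ‖Complex.exp (τ / p)‖ ≤ Real.exp ((T + R) / p) := by
    rw [Complex.norm_exp]
    apply Real.exp_le_exp.2
    refine (Complex.re_le_norm _).trans (hτp.trans ?_)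
    gcongr; linarith
  have hMa : ‖a‖ ≤ Real.exp ((T + R) / p) := by
    have e : a = (a - 1 - τ / p) + τ / p + 1 := by ring
    have : ‖a‖ ≤ ε₁ * (R / p) + T / p + 1 := by
      rw [e]
      refine (norm_add_le _ _).trans ?_
      rw [norm_one]
      gcongr
      exact (norm_add_le _ _).trans (add_le_add hb1' hτp)
    have h5 : ε₁ * (R / p) ≤ R / p := by
      have : ε₁ ≤ 1 := min_le_left _ _
      have h6 : 0 ≤ R / p := by positivity
      nlinarith
    have h7 := Real.add_one_le_exp ((T + R) / p)
    have : (T + R) / p = T / p + R / p := add_div _ _ _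
    linarith
  have hfin := norm_pow_sub_pow_le' a (Complex.exp (τ / p)) _ hM hMa hMb p
  rw [← Complex.exp_nat_mul, mul_div_cancel₀ _ hpc, ← Real.exp_nat_mul, mul_div_cancel₀ _ hp.ne', ← hE] at hfin
  refine hfin.trans ?_
  have hab : ‖a - Complex.exp (τ / p)‖ ≤ ε₁ * (R / p) + (T / p) ^ 2 := by
    have e : a - Complex.exp (τ / p) = (a - 1 - τ / p) - (Complex.exp (τ / p) - 1 - τ / p) := by ring
    rw [e]
    exact (norm_sub_le _ _).trans (add_le_add hb1' hb2)
  calc (p : ℝ) * E * ‖a - Complex.exp (τ / p)‖ ≤ p * E * (ε₁ * (R / p) + (T / p) ^ 2) := by gcongr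
    _ = E * R * ε₁ + E * T ^ 2 / p := by field_simp
    _ ≤ ε / 2 + ε / 2 := by
        refine add_le_add ?_ ?_
        · calc E * R * ε₁ ≤ E * R * (ε / (2 * E * (R + 1))) := by gcongr; exact min_le_right _ _
            _ = (ε / 2) * (R / (R + 1)) := by field_simp
            _ ≤ (ε / 2) * 1 := by gcongr; rw [div_le_one (by linarith)]; linarith
            _ = _ := mul_one _
        · rw [div_le_iff₀ hε] at h2
          rw [div_le_iff₀ hp]; linarith
    _ = ε := by ring

noncomputable def Ym (x : Fin K → ℝ) (G : Fin K → Fin K → ℂ) : Matrix (Fin K) (Fin K) ℂ :=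
  -(((Qm G).map (starRingEnd ℂ))⁻¹ * Matrix.diagonal (fun i => (x i : ℂ)) * (Qm G)⁻¹ * Matrix.diagonal (fun i => (x i : ℂ)))

lemma wt_eq (x : Fin K → ℝ) (hK : Even K) (G : Fin K → Fin K → ℂ) (hG : (Qm G).det ≠ 0) (t : ℝ) :
    wt x t G = WW G * (1 + ((t : ℂ) ^ 2) • Ym x G).det := by
  have hQ : IsUnit (Qm G).det := hG.isUnit
  have hdc : ((Qm G).map (starRingEnd ℂ)).det = (starRingEnd ℂ) (Qm G).det := (RingHom.map_det _ _).symm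
  have hQc : IsUnit ((Qm G).map (starRingEnd ℂ)).det := by
    rw [hdc]; exact hQ.map _
  let _ : Invertible (Qm G) := Matrix.invertibleOfIsUnitDet _ hQ
  set X : Matrix (Fin K) (Fin K) ℂ := Matrix.diagonal (fun i => (x i : ℂ)) with hX
  have e0 : (Matrix.diagonal fun i => ((t * x i : ℝ) : ℂ)) = (t : ℂ) • X := by
    ext i j; rw [hX, Matrix.smul_apply, Matrix.diagonal_apply, Matrix.diagonal_apply]; split_ifs <;> simp
  have e1 : dualB G (fun i => t * x i) = Matrix.fromBlocks (Qm G) (-((t : ℂ) • X)) ((t : ℂ) • X) (-(Qm G).map (starRingEnd ℂ)) := by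
    rw [dualB, e0]; rfl
  have e2 : -(Qm G).map (starRingEnd ℂ) - ((t : ℂ) • X) * ⅟(Qm G) * (-((t : ℂ) • X)) =
      -((Qm G).map (starRingEnd ℂ) * (1 + ((t : ℂ) ^ 2) • Ym x G)) := by
    have e3 : (Qm G).map (starRingEnd ℂ) * Ym x G = -(X * (Qm G)⁻¹ * X) := by
      rw [Ym, ← hX, Matrix.mul_neg, ← Matrix.mul_assoc, ← Matrix.mul_assoc, ← Matrix.mul_assoc, Matrix.mul_nonsing_inv _ hQc, one_mul]
    rw [mul_add, mul_one, Matrix.mul_smul, e3, Matrix.invOf_eq_nonsing_inv, neg_add, smul_neg, neg_neg, Matrix.mul_neg, sub_neg_eq_add]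
    congr 1
    simp only [Matrix.smul_mul, Matrix.mul_smul, smul_smul, pow_two]
  rw [wt, e1, Matrix.det_fromBlocks₁₁, e2, Matrix.det_neg, Fintype.card_fin, hK.neg_one_pow, one_mul, Matrix.det_mul, hdc, WW]
  push_cast
  rw [← Complex.mul_conj]
  ring

end Loc



section Lap
variable {K : ℕ}

lemma continuous_Qm : Continuous (fun G : Fin K → Fin K → ℂ => Qm G) := by
  unfold Qm
  refine continuous_matrix fun i j => ?_
  simp only [Matrix.of_apply]; fun_prop

lemma continuous_WW : Continuous (WW (K := K)) := by
  unfold WW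
  have h1 := continuous_nrm2 (K := K)
  have h2 : Continuous (fun G : Fin K → Fin K → ℂ => (Qm G).det) := continuous_Qm.matrix_det
  have h3 := Complex.continuous_normSq.comp h2
  exact (by fun_prop : Continuous fun G : Fin K → Fin K → ℂ => Real.exp (-8 * nrm2 G)).mul h3

noncomputable def Fx (x : Fin K → ℝ) (G : Fin K → Fin K → ℂ) : ℂ :=
  Complex.exp ((1 / 2 : ℂ) * (Ym x G).trace)

lemma continuousOn_minv : ContinuousOn (fun A : Matrix (Fin K) (Fin K) ℂ => A⁻¹) {A | A.det ≠ 0} := by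
  have e : (fun A : Matrix (Fin K) (Fin K) ℂ => A⁻¹) = fun A => (A.det)⁻¹ • A.adjugate := by
    funext A
    rw [Matrix.inv_def, Ring.inverse_eq_inv']
  rw [e]
  have h1 : ContinuousOn (fun A : Matrix (Fin K) (Fin K) ℂ => (A.det)⁻¹) {A | A.det ≠ 0} :=
    ContinuousOn.inv₀ (Continuous.matrix_det continuous_id).continuousOn (fun A hA => hA)
  have h2 : ContinuousOn (fun A : Matrix (Fin K) (Fin K) ℂ => A.adjugate) {A | A.det ≠ 0} :=
    (Continuous.matrix_adjugate continuous_id).continuousOn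
  exact h1.smul h2

lemma continuousOn_Ym (x : Fin K → ℝ) : ContinuousOn (fun G => Ym x G) {G : Fin K → Fin K → ℂ | (Qm G).det ≠ 0} := by
  have h1 : ContinuousOn (fun G : Fin K → Fin K → ℂ => (Qm G)⁻¹) {G : Fin K → Fin K → ℂ | (Qm G).det ≠ 0} := by
    refine ContinuousOn.comp (g := fun A : Matrix (Fin K) (Fin K) ℂ => A⁻¹) continuousOn_minv continuous_Qm.continuousOn ?_
    intro G hG
    exact hG
  have h2 : ContinuousOn (fun G : Fin K → Fin K → ℂ => ((Qm G).map (starRingEnd ℂ))⁻¹) {G : Fin K → Fin K → ℂ | (Qm G).det ≠ 0} := by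
    refine ContinuousOn.comp (g := fun A : Matrix (Fin K) (Fin K) ℂ => A⁻¹) continuousOn_minv
      (continuous_Qm.matrix_map Complex.continuous_conj).continuousOn ?_
    intro G hG
    have : ((Qm G).map (starRingEnd ℂ)).det = (starRingEnd ℂ) (Qm G).det := (RingHom.map_det _ _).symm
    rw [Set.mem_ofPred_eq] at hG ⊢
    rw [this]
    exact (map_ne_zero _).2 hG
  have h3 := (((h2.mul (continuousOn_const (c := Matrix.diagonal (fun i => (x i : ℂ))))).mul h1).mul
    (continuousOn_const (c := Matrix.diagonal (fun i => (x i : ℂ))))).neg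
  exact h3

lemma det_ne_of_WW (G : Fin K → Fin K → ℂ) (h : 0 < WW G) : (Qm G).det ≠ 0 := by
  intro h0
  rw [WW, h0] at h
  simp at h

lemma continuousOn_Fx (x : Fin K → ℝ) : ContinuousOn (Fx x) {G : Fin K → Fin K → ℂ | 0 < WW G} := by
  unfold Fx
  have h1 := (continuousOn_Ym x).mono (fun G (hG : 0 < WW G) => det_ne_of_WW G hG)
  have h2 : Continuous (fun A : Matrix (Fin K) (Fin K) ℂ => Complex.exp ((1 / 2 : ℂ) * A.trace)) := by
    have : Continuous (fun A : Matrix (Fin K) (Fin K) ℂ => A.trace) := Continuous.matrix_trace continuous_id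
    fun_prop
  exact h2.comp_continuousOn h1

lemma WW_bound (hK : Even K) : ∃ C : ℝ, 0 < C ∧ ∀ G : Fin K → Fin K → ℂ, WW G ≤ C * Real.exp (-nrm2 G) := by
  obtain ⟨C, hC, h⟩ := wt_bound (K := K) 0
  refine ⟨C, hC, fun G => ?_⟩
  have := h 0 (by simp) G
  rw [wt_zero hK, Complex.norm_real, Real.norm_eq_abs, abs_of_nonneg (WW_nonneg G)] at this
  exact this

lemma nrm2_le_of (C a : ℝ) (hC : 0 < C) (ha : 0 < a) : ∃ B : ℝ, 0 ≤ B ∧ ∀ G : Fin K → Fin K → ℂ,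
    a ≤ C * Real.exp (-nrm2 G) → nrm2 G ≤ B := by
  refine ⟨max 0 (Real.log (C / a)), le_max_left _ _, fun G h => le_max_of_le_right ?_⟩
  rw [Real.le_log_iff_exp_le (by positivity), le_div_iff₀ ha]
  have e : Real.exp (nrm2 G) * Real.exp (-nrm2 G) = 1 := by rw [← Real.exp_add]; simp
  calc Real.exp (nrm2 G) * a ≤ Real.exp (nrm2 G) * (C * Real.exp (-nrm2 G)) := by gcongr
    _ = C * (Real.exp (nrm2 G) * Real.exp (-nrm2 G)) := by ring
    _ = C := by rw [e, mul_one]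

lemma isCompact_nrm2 (B : ℝ) : IsCompact {G : Fin K → Fin K → ℂ | nrm2 G ≤ B} := by
  refine Metric.isCompact_of_isClosed_isBounded (isClosed_le continuous_nrm2 continuous_const) ?_
  refine (Metric.isBounded_closedBall (x := (0 : Fin K → Fin K → ℂ)) (r := Real.sqrt B)).subset fun G hG => ?_
  rw [Metric.mem_closedBall, dist_zero_right]
  exact (norm_sq_le_nrm2 G).trans (Real.sqrt_le_sqrt hG)

lemma isCompact_WW (hK : Even K) (a : ℝ) (ha : 0 < a) : IsCompact {G : Fin K → Fin K → ℂ | a ≤ WW G} := by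
  obtain ⟨C, hC, h⟩ := WW_bound (K := K) hK
  obtain ⟨B, -, hB⟩ := nrm2_le_of (K := K) C a hC ha
  exact (isCompact_nrm2 B).of_isClosed_subset (isClosed_le continuous_const continuous_WW)
    (fun G hG => hB G (le_trans hG (h G)))

lemma WW_attained (hK : Even K) : ∃ G : Fin K → Fin K → ℂ, WW G = mmax K := by
  set r : ℝ := (2 * Real.sqrt 2)⁻¹ with hr
  have hr2 : r ^ 2 = 1 / 8 := by
    rw [hr, inv_pow, mul_pow, Real.sq_sqrt (by norm_num)]; norm_num
  refine ⟨fun i j => (r : ℂ) * sympJ K i j, ?_⟩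
  set G : Fin K → Fin K → ℂ := fun i j => (r : ℂ) * sympJ K i j with hG
  have hof : Matrix.of G = (r : ℂ) • sympJ K := rfl
  have hQ : Qm G = ((2 * r : ℝ) : ℂ) • sympJ K := by
    rw [Qm_eq, hof, Matrix.transpose_smul, sympJ_transpose, smul_neg, sub_neg_eq_add, ← two_smul ℂ, smul_smul]
    push_cast; rfl
  have hJ : sympJ K * (sympJ K)ᴴ = 1 := by rw [sympJ_conj, sympJ_mul K hK]
  have hn : nrm2 G = K / 8 := by
    have := nrm2_eq G
    rw [hof, Matrix.conjTranspose_smul, Matrix.smul_mul, Matrix.mul_smul, hJ, smul_smul, Matrix.trace_smul, Matrix.trace_one, Fintype.card_fin] at this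
    have h2 : ((nrm2 G : ℝ) : ℂ) = ((r ^ 2 * K : ℝ) : ℂ) := by
      rw [this]; simp [pow_two]
    have := Complex.ofReal_injective h2
    rw [this, hr2]; ring
  have hd : Complex.normSq (Qm G).det = (1 / 2) ^ K := by
    rw [hQ, Matrix.det_smul, Fintype.card_fin, map_mul, map_pow, Complex.normSq_ofReal]
    have h1 : Complex.normSq (sympJ K).det = 1 := by
      have := congrArg Matrix.det hJ
      rw [Matrix.det_mul, Matrix.det_conjTranspose, Matrix.det_one] at this
      have h2 : ((Complex.normSq (sympJ K).det : ℝ) : ℂ) = 1 := by rw [← this]; exact (Complex.mul_conj _).symm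
      exact_mod_cast h2
    rw [h1, mul_one]
    congr 1
    nlinarith [hr2]
  rw [WW, hn, hd, mmax, div_pow (Real.exp (-1)), ← Real.exp_nat_mul, one_div, inv_pow, div_eq_mul_inv]
  congr 2
  ring

lemma integrable_wt_pow (x : Fin K → ℝ) (t : ℝ) (ht : |t| ≤ 1) (p : ℕ) (hp : 0 < p) :
    Integrable (fun G : Fin K → Fin K → ℂ => wt x t G ^ p) := by
  obtain ⟨C, hC, h⟩ := wt_bound (K := K) x
  refine ((integrable_exp_nrm2 (K := K)).const_mul (C ^ p)).mono' ?_ ?_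
  · have := (continuous_wt x).comp (f := fun G : Fin K → Fin K → ℂ => (t, G)) (by fun_prop)
    exact (this.pow p).aestronglyMeasurable
  · filter_upwards with G
    rw [norm_pow]
    calc ‖wt x t G‖ ^ p ≤ (C * Real.exp (-nrm2 G)) ^ p := pow_le_pow_left₀ (norm_nonneg _) (h t ht G) p
      _ = C ^ p * Real.exp (-nrm2 G) ^ p := mul_pow _ _ _
      _ ≤ C ^ p * Real.exp (-nrm2 G) := by
        gcongr
        refine pow_le_of_le_one (Real.exp_pos _).le ?_ hp.ne'
        exact Real.exp_le_one_iff.2 (by linarith [nrm2_nonneg G])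

lemma integrable_WW_pow (hK : Even K) (p : ℕ) (hp : 0 < p) :
    Integrable (fun G : Fin K → Fin K → ℂ => WW G ^ p) := by
  have := (integrable_wt_pow (K := K) 0 0 (by simp) p hp).re
  refine this.congr ?_
  filter_upwards with G
  rw [wt_zero hK, ← Complex.ofReal_pow]
  exact Complex.ofReal_re _

lemma WW_int_lower (hK : Even K) (a : ℝ) (ha : 0 < a) (ham : a < mmax K) : ∃ v : ℝ, 0 < v ∧ ∀ p : ℕ, 0 < p →
    a ^ p * v ≤ ∫ G : Fin K → Fin K → ℂ, WW G ^ p := by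
  refine ⟨(volume : Measure (Fin K → Fin K → ℂ)).real {G | a ≤ WW G}, ?_, fun p hp => ?_⟩
  · refine ENNReal.toReal_pos ?_ (isCompact_WW hK a ha).measure_lt_top.ne
    have ho : IsOpen {G : Fin K → Fin K → ℂ | a < WW G} := isOpen_lt continuous_const continuous_WW
    obtain ⟨G, hG⟩ := WW_attained (K := K) hK
    have hpos := ho.measure_pos (volume : Measure (Fin K → Fin K → ℂ)) ⟨G, by simp only [Set.mem_ofPred_eq]; rw [hG]; exact ham⟩
    exact (hpos.trans_le (measure_mono fun G (hG : a < WW G) => hG.le)).ne'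
  · have := mul_meas_ge_le_integral_of_nonneg (μ := (volume : Measure (Fin K → Fin K → ℂ))) (f := fun G => WW G ^ p)
      (Filter.Eventually.of_forall fun G => pow_nonneg (WW_nonneg G) p) (integrable_WW_pow hK p hp) (a ^ p)
    refine le_trans (le_of_eq ?_) this
    congr 2
    ext G
    simp only [Set.mem_ofPred_eq]
    exact (pow_le_pow_iff_left₀ ha.le (WW_nonneg G) hp.ne').symm

lemma tail_unif (hK : Even K) (x : Fin K → ℝ) (a b : ℝ) (ha : 0 < a) (hab : a < b) : ∃ t0 : ℝ, 0 < t0 ∧ ∀ t : ℝ, |t| ≤ t0 →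
    ∀ G : Fin K → Fin K → ℂ, WW G ≤ a → ‖wt x t G‖ ≤ b := by
  obtain ⟨C, hC, h⟩ := wt_bound (K := K) x
  obtain ⟨B, -, hB⟩ := nrm2_le_of (K := K) C b hC (ha.trans hab)
  have hc : IsCompact ({G : Fin K → Fin K → ℂ | nrm2 G ≤ B} ∩ {G | WW G ≤ a}) :=
    (isCompact_nrm2 B).inter_right (isClosed_le continuous_WW continuous_const)
  have ho : IsOpen {q : ℝ × (Fin K → Fin K → ℂ) | ‖wt x q.1 q.2‖ < b} :=
    isOpen_lt (continuous_wt x).norm continuous_const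
  obtain ⟨u, v, hu, -, h0u, hv, huv⟩ := generalized_tube_lemma (isCompact_singleton (x := (0 : ℝ))) hc ho (by
    rintro ⟨t, G⟩ ⟨ht, hG⟩
    rw [Set.mem_singleton_iff] at ht
    have ht' : t = 0 := ht
    rw [ht']
    simp only [Set.mem_ofPred_eq]
    rw [wt_zero hK, Complex.norm_real, Real.norm_eq_abs, abs_of_nonneg (WW_nonneg G)]
    exact lt_of_le_of_lt hG.2 hab)
  obtain ⟨δ, hδ, hball⟩ := Metric.isOpen_iff.1 hu 0 (h0u rfl)
  refine ⟨min (δ / 2) 1, by positivity, fun t ht G hG => ?_⟩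
  by_contra hlt
  push Not at hlt
  have h1 := h t (ht.trans (min_le_right _ _)) G
  have h2 := hB G (hlt.le.trans h1)
  have h3 : (t, G) ∈ u ×ˢ v := ⟨hball (by
    rw [Metric.mem_ball, dist_zero_right, Real.norm_eq_abs]
    have := ht.trans (min_le_left _ _)
    linarith), hv ⟨h2, hG⟩⟩
  have h4 := huv h3
  simp only [Set.mem_ofPred_eq] at h4
  linarith

lemma tail_small (hK : Even K) (x : Fin K → ℝ) (a : ℝ) (ha : 0 < a) (ham : a < mmax K) (ε : ℝ) (hε : 0 < ε) :
    ∃ t0 : ℝ, 0 < t0 ∧ ∀ᶠ p : ℕ in Filter.atTop, ∀ t : ℝ, |t| ≤ t0 →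
    ∫ G in {G : Fin K → Fin K → ℂ | WW G ≤ a}, ‖wt x t G‖ ^ p ≤ ε * ∫ G : Fin K → Fin K → ℂ, WW G ^ p := by
  obtain ⟨b, hab, hbm⟩ := exists_between ham
  obtain ⟨c, hbc, hcm⟩ := exists_between hbm
  have hb : 0 < b := ha.trans hab
  have hc : 0 < c := hb.trans hbc
  obtain ⟨t0, ht0, htail⟩ := tail_unif hK x a b ha hab
  obtain ⟨v, hv, hlow⟩ := WW_int_lower hK c hc hcm
  obtain ⟨C, hC, h⟩ := wt_bound (K := K) x
  set I := ∫ G : Fin K → Fin K → ℂ, C * Real.exp (-nrm2 G) with hI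
  have hI0 : 0 ≤ I := integral_nonneg fun G => by positivity
  have hlim : Filter.Tendsto (fun p : ℕ => (b / c) ^ p * (I / b)) Filter.atTop (nhds (0 * (I / b))) :=
    (tendsto_pow_atTop_nhds_zero_of_lt_one (by positivity) (by rw [div_lt_one hc]; exact hbc)).mul_const _
  rw [zero_mul] at hlim
  have hev := hlim.eventually_le_const (show 0 < ε * v by positivity)
  refine ⟨min t0 1, by positivity, ?_⟩
  filter_upwards [hev, Filter.eventually_gt_atTop 0] with p hp1 hp t ht
  have hms : MeasurableSet {G : Fin K → Fin K → ℂ | WW G ≤ a} :=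
    (isClosed_le continuous_WW continuous_const).measurableSet
  have ht1 : |t| ≤ 1 := ht.trans (min_le_right _ _)
  have hint : Integrable (fun G : Fin K → Fin K → ℂ => b ^ (p - 1) * (C * Real.exp (-nrm2 G))) :=
    (integrable_exp_nrm2.const_mul C).const_mul _
  have hwint : Integrable (fun G : Fin K → Fin K → ℂ => ‖wt x t G‖ ^ p) := by
    simpa only [norm_pow] using (integrable_wt_pow x t ht1 p hp).norm
  calc ∫ G in {G : Fin K → Fin K → ℂ | WW G ≤ a}, ‖wt x t G‖ ^ p
      ≤ ∫ G in {G : Fin K → Fin K → ℂ | WW G ≤ a}, b ^ (p - 1) * (C * Real.exp (-nrm2 G)) := by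
        refine setIntegral_mono_on hwint.integrableOn hint.integrableOn hms fun G hG => ?_
        have e : ‖wt x t G‖ ^ p = ‖wt x t G‖ ^ (p - 1) * ‖wt x t G‖ := by
          rw [← pow_succ, Nat.sub_add_cancel hp]
        rw [e]
        have := htail t (ht.trans (min_le_left _ _)) G hG
        have := h t ht1 G
        gcongr
    _ ≤ ∫ G : Fin K → Fin K → ℂ, b ^ (p - 1) * (C * Real.exp (-nrm2 G)) :=
        setIntegral_le_integral hint (Filter.Eventually.of_forall fun G => by positivity)
    _ = b ^ (p - 1) * I := by rw [integral_const_mul]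
    _ = c ^ p * ((b / c) ^ p * (I / b)) := by
        have e : b ^ p = b ^ (p - 1) * b := by rw [← pow_succ, Nat.sub_add_cancel hp]
        rw [div_pow, e]; field_simp
    _ ≤ c ^ p * (ε * v) := by gcongr
    _ = ε * (c ^ p * v) := by ring
    _ ≤ _ := by gcongr; exact hlow p hp

end Lap



section Lap2
variable {K : ℕ}

lemma Ym_bounded (hK : Even K) (x : Fin K → ℝ) (a : ℝ) (ha : 0 < a) : ∃ R : ℝ, 0 ≤ R ∧
    ∀ G : Fin K → Fin K → ℂ, a ≤ WW G → ‖(fun i j => (1 / 2 : ℂ) * Ym x G i j : Fin K → Fin K → ℂ)‖ ≤ R := by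
  have hc := isCompact_WW hK a ha
  have h1 : ContinuousOn (fun G => (fun i j => (1 / 2 : ℂ) * Ym x G i j : Fin K → Fin K → ℂ)) {G : Fin K → Fin K → ℂ | a ≤ WW G} := by
    have h2 := (continuousOn_Ym x).mono (fun G (hG : a ≤ WW G) => det_ne_of_WW G (ha.trans_le hG))
    refine continuousOn_pi.2 fun i => continuousOn_pi.2 fun j => ?_
    refine ContinuousOn.mul continuousOn_const ?_
    exact (continuous_apply_apply (ρ := fun _ _ => ℂ) i j).comp_continuousOn h2
  obtain ⟨R, hR⟩ := hc.exists_bound_of_continuousOn h1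
  exact ⟨max R 0, le_max_right _ _, fun G hG => (hR G hG).trans (le_max_left _ _)⟩

lemma Fx_unif (hK : Even K) (x : Fin K → ℝ) (a : ℝ) (ha : 0 < a) (ε : ℝ) (hε : 0 < ε) : ∀ᶠ p : ℕ in Filter.atTop,
    ∀ G : Fin K → Fin K → ℂ, a ≤ WW G →
      ‖wt x (Real.sqrt (2 * p))⁻¹ G ^ p - (WW G : ℂ) ^ p * Fx x G‖ ≤ ε * WW G ^ p := by
  obtain ⟨R, hR0, hR⟩ := Ym_bounded hK x a ha
  filter_upwards [detpow_unif (K := K) R hR0 ε hε, Filter.eventually_gt_atTop 0] with p hp hp0 G hG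
  have hW : 0 < WW G := ha.trans_le hG
  have h1 := hp _ (hR G hG)
  have hp' : (p : ℂ) ≠ 0 := by exact_mod_cast hp0.ne'
  have e1 : (Matrix.of (fun i j => (1 / 2 : ℂ) * Ym x G i j : Fin K → Fin K → ℂ)) = (1 / 2 : ℂ) • Ym x G := rfl
  have e2 : (((Real.sqrt (2 * p))⁻¹ : ℝ) : ℂ) ^ 2 = (p : ℂ)⁻¹ * (1 / 2) := by
    rw [← Complex.ofReal_pow, inv_pow, Real.sq_sqrt (by positivity)]
    push_cast
    field_simp
  rw [e1, smul_smul, ← e2, Matrix.trace_smul, smul_eq_mul] at h1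
  rw [wt_eq x hK G (det_ne_of_WW G hW), mul_pow, ← mul_sub, norm_mul, norm_pow, Complex.norm_real, Real.norm_eq_abs, abs_of_pos hW, mul_comm ε]
  gcongr
  exact h1

variable (μ : Measure (Matrix.unitaryGroup (Fin K) ℂ)) [IsProbabilityMeasure μ]

lemma continuous_actT1 (U : Matrix.unitaryGroup (Fin K) ℂ) : Continuous (actT U) :=
  continuous_actT.comp (f := fun G => (U, G)) (by fun_prop)

lemma Fx_bounded (hK : Even K) (x : Fin K → ℝ) (a : ℝ) (ha : 0 < a) : ∃ M : ℝ, 0 ≤ M ∧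
    ∀ G : Fin K → Fin K → ℂ, a ≤ WW G → ‖Fx x G‖ ≤ M := by
  obtain ⟨M, hM⟩ := (isCompact_WW hK a ha).exists_bound_of_continuousOn
    ((continuousOn_Fx x).mono (fun G (hG : a ≤ WW G) => ha.trans_le hG))
  exact ⟨max M 0, le_max_right _ _, fun G hG => (hM G hG).trans (le_max_left _ _)⟩

lemma continuous_FxU (x : Fin K → ℝ) (G : Fin K → Fin K → ℂ) (hG : 0 < WW G) :
    Continuous (fun U : Matrix.unitaryGroup (Fin K) ℂ => Fx x (actT U G)) := by
  refine (continuousOn_Fx x).comp_continuous (continuous_actT.comp (f := fun U => (U, G)) (by fun_prop)) fun U => ?_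
  rw [Set.mem_ofPred_eq, WW_actT]; exact hG

lemma Fbar_cont (hK : Even K) (x : Fin K → ℝ) (a : ℝ) (ha : 0 < a) :
    ContinuousOn (fun G : Fin K → Fin K → ℂ => ∫ U, Fx x (actT U G) ∂μ) {G | a ≤ WW G} := by
  obtain ⟨M, hM0, hM⟩ := Fx_bounded hK x a ha
  refine continuousOn_of_dominated (bound := fun _ => M) ?_ ?_ (integrable_const M) ?_
  · intro G hG
    exact (continuous_FxU x G (ha.trans_le hG)).aestronglyMeasurable
  · intro G hG
    filter_upwards with U
    exact hM _ (by rw [WW_actT]; exact hG)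
  · filter_upwards with U
    refine ContinuousOn.comp (g := Fx x) (continuousOn_Fx x) (continuous_actT1 U).continuousOn ?_
    intro G hG
    rw [Set.mem_ofPred_eq, WW_actT]; exact ha.trans_le hG

lemma Fbar_near (hK : Even K) (x : Fin K → ℝ) (L : ℂ)
    (hL : ∀ G : Fin K → Fin K → ℂ, WW G = mmax K → ∫ U, Fx x (actT U G) ∂μ = L) (ε : ℝ) (hε : 0 < ε) :
    ∃ a : ℝ, 0 < a ∧ a < mmax K ∧ ∀ G : Fin K → Fin K → ℂ, a < WW G → ‖∫ U, Fx x (actT U G) ∂μ - L‖ ≤ ε := by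
  have hm := mmax_pos (K := K)
  set m := mmax K with hmdef
  have hc := isCompact_WW (K := K) hK (m / 2) (by positivity)
  have hcont := Fbar_cont μ hK x (m / 2) (by positivity)
  have hcl : IsCompact ({G : Fin K → Fin K → ℂ | m / 2 ≤ WW G} ∩ (fun G : Fin K → Fin K → ℂ => ‖∫ U, Fx x (actT U G) ∂μ - L‖) ⁻¹' Set.Ici ε) := by
    have h2 : ContinuousOn (fun G : Fin K → Fin K → ℂ => ‖∫ U, Fx x (actT U G) ∂μ - L‖) {G | m / 2 ≤ WW G} :=
      (hcont.sub continuousOn_const).norm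
    exact hc.of_isClosed_subset (h2.preimage_isClosed_of_isClosed hc.isClosed isClosed_Ici) Set.inter_subset_left
  rcases Set.eq_empty_or_nonempty ({G : Fin K → Fin K → ℂ | m / 2 ≤ WW G} ∩ (fun G : Fin K → Fin K → ℂ => ‖∫ U, Fx x (actT U G) ∂μ - L‖) ⁻¹' Set.Ici ε) with he | hne
  · refine ⟨m / 2, by positivity, by linarith, fun G hG => ?_⟩
    by_contra hcon
    push Not at hcon
    exact (Set.eq_empty_iff_forall_notMem.1 he G) ⟨hG.le, hcon.le⟩
  · obtain ⟨G0, hG0, hmax⟩ := hcl.exists_isMaxOn hne continuous_WW.continuousOn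
    refine ⟨WW G0, (by positivity : 0 < m / 2).trans_le hG0.1, lt_of_le_of_ne (WW_le G0) ?_, fun G hG => ?_⟩
    · intro heq
      have h1 : ε ≤ ‖∫ U, Fx x (actT U G0) ∂μ - L‖ := hG0.2
      rw [hL G0 heq, sub_self, norm_zero] at h1
      linarith
    · by_contra hcon
      push Not at hcon
      have h2 : WW G ≤ WW G0 := hmax ⟨le_trans hG0.1 hG.le, hcon.le⟩
      linarith

lemma Fx_fubini (hK : Even K) (x : Fin K → ℝ) (a : ℝ) (ha : 0 < a) (p : ℕ) (hp : 0 < p) :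
    ∫ G in {G : Fin K → Fin K → ℂ | a < WW G}, (WW G : ℂ) ^ p * Fx x G =
      ∫ G in {G : Fin K → Fin K → ℂ | a < WW G}, (WW G : ℂ) ^ p * ∫ U, Fx x (actT U G) ∂μ := by
  obtain ⟨M, hM0, hM⟩ := Fx_bounded hK x a ha
  set A : Set (Fin K → Fin K → ℂ) := {G | a < WW G} with hA
  have hAm : MeasurableSet A := (isOpen_lt continuous_const continuous_WW).measurableSet
  set g : (Fin K → Fin K → ℂ) → ℂ := A.indicator (fun G => (WW G : ℂ) ^ p * Fx x G) with hg
  have hgc : ContinuousOn (fun G : Fin K → Fin K → ℂ => (WW G : ℂ) ^ p * Fx x G) A := by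
    refine ContinuousOn.mul ?_ ((continuousOn_Fx x).mono (fun G (hG : a < WW G) => ha.trans hG))
    exact ((Complex.continuous_ofReal.comp continuous_WW).pow p).continuousOn
  have hgm : Measurable g := by
    classical
    have := ContinuousOn.measurable_piecewise (s := A) (f := fun G : Fin K → Fin K → ℂ => (WW G : ℂ) ^ p * Fx x G) (g := 0) hgc (continuous_zero.continuousOn) hAm
    rwa [Set.piecewise_eq_indicator] at this
  have hmemA : ∀ (U : Matrix.unitaryGroup (Fin K) ℂ) G, actT U G ∈ A ↔ G ∈ A := by
    intro U G; rw [hA, Set.mem_ofPred_eq, Set.mem_ofPred_eq, WW_actT]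
  have hgU : ∀ (U : Matrix.unitaryGroup (Fin K) ℂ) G, g (actT U G) = A.indicator (fun G => (WW G : ℂ) ^ p * Fx x (actT U G)) G := by
    intro U G
    rw [hg]
    by_cases h : G ∈ A
    · rw [Set.indicator_of_mem h, Set.indicator_of_mem ((hmemA U G).2 h), WW_actT]
    · rw [Set.indicator_of_notMem h, Set.indicator_of_notMem (fun h' => h ((hmemA U G).1 h'))]
  have hbd : ∀ U G, ‖g (actT U G)‖ ≤ M * WW G ^ p := by
    intro U G
    rw [hgU]
    by_cases h : G ∈ A
    · rw [Set.indicator_of_mem h, norm_mul, norm_pow, Complex.norm_real, Real.norm_eq_abs, abs_of_nonneg (WW_nonneg G), mul_comm]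
      have h3 : ‖Fx x (actT U G)‖ ≤ M := hM _ (by rw [WW_actT]; exact le_of_lt h)
      exact mul_le_mul_of_nonneg_right h3 (pow_nonneg (WW_nonneg G) p)
    · rw [Set.indicator_of_notMem h, norm_zero]
      exact mul_nonneg hM0 (pow_nonneg (WW_nonneg G) p)
  have hint : Integrable (Function.uncurry fun (U : Matrix.unitaryGroup (Fin K) ℂ) (G : Fin K → Fin K → ℂ) => g (actT U G)) (μ.prod volume) := by
    have h4 : Integrable (fun q : Matrix.unitaryGroup (Fin K) ℂ × (Fin K → Fin K → ℂ) => M * WW q.2 ^ p) (μ.prod volume) :=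
      ((integrable_WW_pow hK p hp).const_mul M).comp_snd μ
    refine h4.mono' ?_ (Filter.Eventually.of_forall fun q => hbd q.1 q.2)
    exact (hgm.comp continuous_actT.measurable).aestronglyMeasurable
  have hswap := integral_integral_swap hint
  have h5 : ∀ U : Matrix.unitaryGroup (Fin K) ℂ, ∫ G, g (actT U G) = ∫ G, g G := by
    intro U
    have h6 := (actT_mp U).map_eq
    conv_rhs => rw [← h6]
    exact (integral_map (continuous_actT1 U).aemeasurable hgm.aestronglyMeasurable).symm
  simp only [h5] at hswap
  rw [integral_const, probReal_univ, one_smul] at hswap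
  rw [← integral_indicator hAm, ← integral_indicator hAm]
  refine hswap.trans ?_
  congr 1
  funext G
  simp only [hgU]
  by_cases h : G ∈ A
  · simp only [Set.indicator_of_mem h]
    rw [integral_const_mul]
  · simp only [Set.indicator_of_notMem h, integral_zero]

lemma laplace (hK : Even K) (x : Fin K → ℝ) (L : ℂ)
    (hL : ∀ G : Fin K → Fin K → ℂ, WW G = mmax K → ∫ U, Fx x (actT U G) ∂μ = L) :
    Filter.Tendsto (fun p : ℕ => (∫ G : Fin K → Fin K → ℂ, wt x (Real.sqrt (2 * p))⁻¹ G ^ p) /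
      ((∫ G : Fin K → Fin K → ℂ, WW G ^ p : ℝ) : ℂ)) Filter.atTop (nhds L) := by
  rw [Metric.tendsto_nhds]
  intro η hη
  set ε := η / (2 * (3 + ‖L‖)) with hεd
  have hε : 0 < ε := by positivity
  obtain ⟨a, ha, ham, hnear⟩ := Fbar_near μ hK x L hL ε hε
  obtain ⟨t0, ht0, htail⟩ := tail_small hK x a ha ham ε hε
  have hsq : Filter.Tendsto (fun p : ℕ => (Real.sqrt (2 * p))⁻¹) Filter.atTop (nhds 0) := by
    refine tendsto_inv_atTop_zero.comp (Real.tendsto_sqrt_atTop.comp ?_)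
    exact Filter.Tendsto.const_mul_atTop (by norm_num) tendsto_natCast_atTop_atTop
  obtain ⟨v, hv, hlow⟩ := WW_int_lower hK a ha ham
  filter_upwards [htail, Fx_unif hK x a ha ε hε, hsq.eventually_le_const ht0, hsq.eventually_le_const one_pos, Filter.eventually_gt_atTop 0] with p hp1 hp2 hp3 hp4 hp
  set t := (Real.sqrt (2 * p))⁻¹ with ht
  have ht0' : 0 ≤ t := by positivity
  set J := ∫ G : Fin K → Fin K → ℂ, WW G ^ p with hJ
  have hJ0 : 0 < J := lt_of_lt_of_le (by positivity) (hlow p hp)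
  set A : Set (Fin K → Fin K → ℂ) := {G | a < WW G} with hA
  have hAm : MeasurableSet A := (isOpen_lt continuous_const continuous_WW).measurableSet
  have hAc : Aᶜ = {G | WW G ≤ a} := by ext G; simp [hA]
  have htabs : |t| ≤ t0 := by rwa [abs_of_nonneg ht0']
  have hwint := integrable_wt_pow x t (by rwa [abs_of_nonneg ht0']) p hp
  have hWint := integrable_WW_pow (K := K) hK p hp
  have hWintc : Integrable (fun G : Fin K → Fin K → ℂ => (WW G : ℂ) ^ p) := by
    have := hWint.ofReal (𝕜 := ℂ)
    simpa using this
  obtain ⟨M, hM0, hM⟩ := Fx_bounded hK x a ha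
  have hWFint : IntegrableOn (fun G : Fin K → Fin K → ℂ => (WW G : ℂ) ^ p * Fx x G) A := by
    refine Integrable.mono' (hWint.const_mul M).integrableOn ?_ ?_
    · refine ContinuousOn.aestronglyMeasurable ?_ hAm
      refine ContinuousOn.mul ?_ ((continuousOn_Fx x).mono (fun G (hG : a < WW G) => ha.trans hG))
      exact ((Complex.continuous_ofReal.comp continuous_WW).pow p).continuousOn
    · filter_upwards [ae_restrict_mem hAm] with G hG
      rw [norm_mul, norm_pow, Complex.norm_real, Real.norm_eq_abs, abs_of_nonneg (WW_nonneg G), mul_comm]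
      exact mul_le_mul_of_nonneg_right (hM G (le_of_lt hG)) (pow_nonneg (WW_nonneg G) p)
  have hJA : ∫ G in A, WW G ^ p ≤ J :=
    setIntegral_le_integral hWint (Filter.Eventually.of_forall fun G => pow_nonneg (WW_nonneg G) p)
  have b1 : ‖∫ G in A, (wt x t G ^ p - (WW G : ℂ) ^ p * Fx x G)‖ ≤ ε * J := by
    refine (norm_integral_le_of_norm_le (hWint.const_mul ε).integrableOn ?_).trans ?_
    · filter_upwards [ae_restrict_mem hAm] with G hG
      exact hp2 G (le_of_lt hG)
    · rw [integral_const_mul]; gcongr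
  have b2 : ‖(∫ G in A, (WW G : ℂ) ^ p * Fx x G) - ∫ G in A, (WW G : ℂ) ^ p * L‖ ≤ ε * J := by
    rw [Fx_fubini μ hK x a ha p hp, ← integral_sub]
    · refine (norm_integral_le_of_norm_le (hWint.const_mul ε).integrableOn ?_).trans ?_
      · filter_upwards [ae_restrict_mem hAm] with G hG
        rw [← mul_sub, norm_mul, norm_pow, Complex.norm_real, Real.norm_eq_abs, abs_of_nonneg (WW_nonneg G), mul_comm]
        exact mul_le_mul_of_nonneg_right (hnear G hG) (pow_nonneg (WW_nonneg G) p)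
      · rw [integral_const_mul]; gcongr
    · refine Integrable.mono' (hWint.const_mul M).integrableOn ?_ ?_
      · refine ContinuousOn.aestronglyMeasurable ?_ hAm
        refine ContinuousOn.mul ?_ ((Fbar_cont μ hK x a ha).mono (fun G (hG : a < WW G) => le_of_lt hG))
        exact ((Complex.continuous_ofReal.comp continuous_WW).pow p).continuousOn
      · filter_upwards [ae_restrict_mem hAm] with G hG
        rw [norm_mul, norm_pow, Complex.norm_real, Real.norm_eq_abs, abs_of_nonneg (WW_nonneg G), mul_comm]
        refine mul_le_mul_of_nonneg_right ?_ (pow_nonneg (WW_nonneg G) p)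
        refine (norm_integral_le_of_norm_le_const (C := M) (Filter.Eventually.of_forall fun U => hM _ ?_)).trans (by simp)
        rw [WW_actT]; exact le_of_lt hG
    · exact (hWintc.mul_const L).integrableOn
  have b3 : ‖∫ G in Aᶜ, wt x t G ^ p‖ ≤ ε * J := by
    refine (norm_integral_le_integral_norm _).trans ?_
    rw [hAc]
    simp only [norm_pow]
    exact hp1 t htabs
  have b4 : ‖∫ G in Aᶜ, (WW G : ℂ) ^ p * L‖ ≤ ε * J * ‖L‖ := by
    rw [integral_mul_const, norm_mul]
    refine mul_le_mul_of_nonneg_right ?_ (norm_nonneg _)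
    refine (norm_integral_le_integral_norm _).trans ?_
    rw [hAc]
    have := hp1 0 (by simpa using ht0.le)
    simp only [wt_zero hK] at this
    simpa only [norm_pow] using this
  have e1 : (∫ G : Fin K → Fin K → ℂ, wt x t G ^ p) - J * L =
      (∫ G in A, (wt x t G ^ p - (WW G : ℂ) ^ p * Fx x G)) + ((∫ G in A, (WW G : ℂ) ^ p * Fx x G) - ∫ G in A, (WW G : ℂ) ^ p * L)
      + (∫ G in Aᶜ, wt x t G ^ p) - ∫ G in Aᶜ, (WW G : ℂ) ^ p * L := by
    have e2 : (J : ℂ) * L = ∫ G : Fin K → Fin K → ℂ, (WW G : ℂ) ^ p * L := by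
      rw [integral_mul_const, hJ, ← integral_complex_ofReal]
      push_cast; rfl
    rw [e2, ← integral_add_compl hAm hwint, ← integral_add_compl hAm (hWintc.mul_const L), integral_sub hwint.integrableOn hWFint]
    ring
  have hJc : (J : ℂ) ≠ 0 := by exact_mod_cast hJ0.ne'
  rw [dist_eq_norm]
  have e3 : (∫ G : Fin K → Fin K → ℂ, wt x t G ^ p) / (J : ℂ) - L = ((∫ G : Fin K → Fin K → ℂ, wt x t G ^ p) - J * L) / J := by
    field_simp
  rw [e3, norm_div, Complex.norm_real, Real.norm_eq_abs, abs_of_pos hJ0, div_lt_iff₀ hJ0, e1]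
  calc _ ≤ ε * J + ε * J + ε * J + ε * J * ‖L‖ := by
        refine (norm_sub_le _ _).trans (add_le_add ((norm_add_le _ _).trans (add_le_add ((norm_add_le _ _).trans (add_le_add b1 b2)) b3)) b4)
    _ = η / 2 * J := by
        rw [hεd]; field_simp; ring
    _ < η * J := by gcongr; linarith

end Lap2



section LV
variable {K : ℕ}

noncomputable def AU (U : Matrix.unitaryGroup (Fin K) ℂ) : Matrix (Fin K) (Fin K) ℂ :=
  (U : Matrix (Fin K) (Fin K) ℂ)ᴴ * sympJ K * ((U : Matrix (Fin K) (Fin K) ℂ)ᴴ)ᵀ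

noncomputable def XD (x : Fin K → ℝ) : Matrix (Fin K) (Fin K) ℂ := Matrix.diagonal (fun i => (x i : ℂ))

lemma Fx_of_max (x : Fin K → ℝ) (G : Fin K → Fin K → ℂ) (hQ : Qm G * (Qm G)ᴴ = (1 / 2 : ℂ) • 1) :
    Fx x G = Complex.exp (2 * (Qm G * XD x * (Qm G)ᴴ * XD x).trace) := by
  have h1 : Qm G * ((2 : ℂ) • (Qm G)ᴴ) = 1 := by
    rw [Matrix.mul_smul, hQ, smul_smul]; norm_num
  have h2 : (Qm G)⁻¹ = (2 : ℂ) • (Qm G)ᴴ := Matrix.inv_eq_right_inv h1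
  have h3 : ((2 : ℂ) • (Qm G)ᴴ) * Qm G = 1 := mul_eq_one_comm.1 h1
  have hT : (Qm G)ᵀ = -Qm G := by
    rw [Qm_eq, Matrix.transpose_sub, Matrix.transpose_transpose, neg_sub]
  have h4 : (Qm G).map (starRingEnd ℂ) = -(Qm G)ᴴ := by
    have : (Qm G).map (starRingEnd ℂ) = ((Qm G)ᵀ)ᴴ := by
      ext i j; simp [Matrix.conjTranspose_apply]
    rw [this, hT, Matrix.conjTranspose_neg]
  have h5 : ((Qm G).map (starRingEnd ℂ))⁻¹ = -((2 : ℂ) • Qm G) := by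
    refine Matrix.inv_eq_right_inv ?_
    rw [h4, neg_mul_neg, Matrix.mul_smul, ← Matrix.smul_mul, h3]
  have hY : Ym x G = (4 : ℂ) • (Qm G * XD x * (Qm G)ᴴ * XD x) := by
    rw [Ym, h2, h5]
    simp only [Matrix.neg_mul, neg_neg, Matrix.smul_mul, Matrix.mul_smul, smul_neg, XD]
    rw [smul_smul]; norm_num
  rw [Fx, hY, Matrix.trace_smul, smul_eq_mul]
  congr 1
  ring

lemma L_value (hK : Even K) (μ : Measure (Matrix.unitaryGroup (Fin K) ℂ)) [μ.IsHaarMeasure] (x : Fin K → ℝ)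
    (G : Fin K → Fin K → ℂ) (hG : WW G = mmax K) :
    ∫ U, Fx x (actT U G) ∂μ = ∫ U, Complex.exp ((AU U * XD x * (AU U)ᴴ * XD x).trace) ∂μ := by
  have hQ := (WW_max G hG).2
  set s : ℝ := Real.sqrt 2 with hs
  have hs2 : (s : ℂ) * s = 2 := by
    rw [← Complex.ofReal_mul, Real.mul_self_sqrt (by norm_num)]; norm_num
  have hT : ((s : ℂ) • Qm G)ᵀ = -((s : ℂ) • Qm G) := by
    rw [Matrix.transpose_smul, Qm_eq, Matrix.transpose_sub, Matrix.transpose_transpose, ← smul_neg, neg_sub]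
  have hU : ((s : ℂ) • Qm G) * ((s : ℂ) • Qm G)ᴴ = 1 := by
    rw [Matrix.conjTranspose_smul, Matrix.smul_mul, Matrix.mul_smul, hQ, smul_smul, smul_smul]
    have : star (s : ℂ) = s := Complex.conj_ofReal s
    rw [this, hs2]; norm_num
  obtain ⟨V, hV⟩ := exists_symp _ hK hT hU
  have h1 : ∀ U : Matrix.unitaryGroup (Fin K) ℂ, Fx x (actT U G) =
      (fun U => Complex.exp ((AU U * XD x * (AU U)ᴴ * XD x).trace)) (V⁻¹ * U) := by
    intro U
    have hG' : WW (actT U G) = mmax K := by rw [WW_actT, hG]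
    rw [Fx_of_max x _ (WW_max _ hG').2]
    have e1 : AU (V⁻¹ * U) = (s : ℂ) • Qm (actT U G) := by
      rw [Qm_actT, ← Matrix.smul_mul, ← Matrix.mul_smul, hV, AU]
      have e2 : ((V⁻¹ * U : Matrix.unitaryGroup (Fin K) ℂ) : Matrix (Fin K) (Fin K) ℂ) = (V : Matrix (Fin K) (Fin K) ℂ)ᴴ * U := rfl
      rw [e2, Matrix.conjTranspose_mul, Matrix.conjTranspose_conjTranspose, Matrix.transpose_mul]
      simp only [Matrix.mul_assoc]
    simp only [e1]
    rw [Matrix.conjTranspose_smul, Matrix.smul_mul, Matrix.smul_mul, Matrix.mul_smul, Matrix.smul_mul, Matrix.smul_mul, smul_smul, Matrix.trace_smul]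
    have : star (s : ℂ) = s := Complex.conj_ofReal s
    rw [this, hs2, smul_eq_mul]
  simp only [h1]
  exact integral_mul_left_eq_self (μ := μ) (fun U => Complex.exp ((AU U * XD x * (AU U)ᴴ * XD x).trace)) V⁻¹

lemma final_integrand (hK : Even K) (x : Fin K → ℝ) (U : Matrix.unitaryGroup (Fin K) ℂ) :
    Complex.exp ((AU U * XD x * (AU U)ᴴ * XD x).trace) =
      ((Real.exp (∑ i, x i ^ 2) * Real.exp (-(1 / 2) *
            (Matrix.trace
              ((((U : Matrix (Fin K) (Fin K) ℂ) * Matrix.diagonal (fun i => (x i : ℂ)) *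
                  (U : Matrix (Fin K) (Fin K) ℂ)ᴴ) -
                sympJ K * ((U : Matrix (Fin K) (Fin K) ℂ) *
                  Matrix.diagonal (fun i => (x i : ℂ)) *
                  (U : Matrix (Fin K) (Fin K) ℂ)ᴴ)ᵀ * (sympJ K)ᵀ) ^ 2)).re) : ℝ) : ℂ) := by
  have hXD : Matrix.diagonal (fun i => (x i : ℂ)) = XD x := rfl
  rw [hXD]
  set u : Matrix (Fin K) (Fin K) ℂ := (U : Matrix (Fin K) (Fin K) ℂ) with hu
  set X := XD x with hX
  set J := sympJ K with hJ
  have hXH : Xᴴ = X := by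
    rw [hX, XD, Matrix.diagonal_conjTranspose]; congr 1; funext i; exact Complex.conj_ofReal _
  have hXT : Xᵀ = X := by rw [hX, XD, Matrix.diagonal_transpose]
  have hUU : uᴴ * u = 1 := Matrix.mem_unitaryGroup_iff'.1 U.2
  have hJJ : J * Jᵀ = 1 := sympJ_mul K hK
  have hJJ' : Jᵀ * J = 1 := mul_eq_one_comm.1 hJJ
  have hAU : AU U = uᴴ * J * (uᴴ)ᵀ := rfl
  have hJc : Jᴴ = Jᵀ := sympJ_conj K
  rw [hAU]
  have hxx : (X * X).trace = ((∑ i, x i ^ 2 : ℝ) : ℂ) := by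
    rw [hX, XD, Matrix.diagonal_mul_diagonal, Matrix.trace_diagonal]
    push_cast
    refine Finset.sum_congr rfl fun i _ => by ring
  clear_value u X J
  generalize hA : uᴴ * J * (uᴴ)ᵀ = A
  generalize hH : u * X * uᴴ = H
  obtain ⟨τ, hτ⟩ : ∃ τ, τ = (A * X * Aᴴ * X).trace := ⟨_, rfl⟩
  rw [← hτ]
  have hreal : (starRingEnd ℂ) τ = τ := by
    have : (starRingEnd ℂ) τ = ((A * X * Aᴴ * X)ᴴ).trace := by rw [hτ]; exact (Matrix.trace_conjTranspose _).symm
    rw [this]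
    simp only [Matrix.conjTranspose_mul, Matrix.conjTranspose_conjTranspose, hXH]
    rw [Matrix.trace_mul_comm, hτ]
    simp only [Matrix.mul_assoc]
  have hHH : (H * H).trace = ((∑ i, x i ^ 2 : ℝ) : ℂ) := by
    have e : H * H = u * (X * X) * uᴴ := by
      rw [← hH]
      calc u * X * uᴴ * (u * X * uᴴ) = u * X * (uᴴ * u) * X * uᴴ := by simp only [Matrix.mul_assoc]
        _ = _ := by rw [hUU, Matrix.mul_one]; simp only [Matrix.mul_assoc]
    rw [e, Matrix.trace_mul_comm, ← Matrix.mul_assoc, hUU, Matrix.one_mul, hxx]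
  have hRR : ((J * Hᵀ * Jᵀ) * (J * Hᵀ * Jᵀ)).trace = (H * H).trace := by
    have e : (J * Hᵀ * Jᵀ) * (J * Hᵀ * Jᵀ) = J * (H * H)ᵀ * Jᵀ := by
      calc (J * Hᵀ * Jᵀ) * (J * Hᵀ * Jᵀ) = J * Hᵀ * (Jᵀ * J) * Hᵀ * Jᵀ := by simp only [Matrix.mul_assoc]
        _ = _ := by rw [hJJ', Matrix.mul_one, Matrix.transpose_mul]; simp only [Matrix.mul_assoc]
    rw [e, Matrix.trace_mul_comm, ← Matrix.mul_assoc, hJJ', Matrix.one_mul, Matrix.trace_transpose]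
  have hHR : (H * (J * Hᵀ * Jᵀ)).trace = τ := by
    have eT : Hᵀ = (uᴴ)ᵀ * X * uᵀ := by
      rw [← hH]; simp only [Matrix.transpose_mul, hXT, Matrix.mul_assoc]
    have eA : Aᴴ = uᵀ * Jᵀ * u := by
      rw [← hA, Matrix.conjTranspose_mul, Matrix.conjTranspose_mul, Matrix.conjTranspose_conjTranspose, hJc]
      have : ((uᴴ)ᵀ)ᴴ = uᵀ := by ext i j; simp [Matrix.conjTranspose_apply]
      rw [this]; simp only [Matrix.mul_assoc]
    rw [hτ, eA, ← hA, eT, ← hH]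
    calc (u * X * uᴴ * (J * ((uᴴ)ᵀ * X * uᵀ) * Jᵀ)).trace = ((u * X) * (uᴴ * J * (uᴴ)ᵀ * X * uᵀ * Jᵀ)).trace := by
          simp only [Matrix.mul_assoc]
      _ = _ := by rw [Matrix.trace_mul_comm]; simp only [Matrix.mul_assoc]
  have hRH : ((J * Hᵀ * Jᵀ) * H).trace = τ := by rw [Matrix.trace_mul_comm, hHR]
  have hsq : ((H - J * Hᵀ * Jᵀ) ^ 2).trace = 2 * ((∑ i, x i ^ 2 : ℝ) : ℂ) - 2 * τ := by
    rw [pow_two, sub_mul, mul_sub, mul_sub, Matrix.trace_sub, Matrix.trace_sub, Matrix.trace_sub, hRR, hHR, hRH, hHH]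
    ring
  have hτr : τ = (τ.re : ℂ) := (Complex.conj_eq_iff_re.1 hreal).symm
  rw [hsq, ← Real.exp_add, Complex.ofReal_exp]
  congr 1
  rw [hτr]
  have : (2 * ((∑ i, x i ^ 2 : ℝ) : ℂ) - 2 * (τ.re : ℂ)).re = 2 * (∑ i, x i ^ 2) - 2 * τ.re := by
    have : (2 * ((∑ i, x i ^ 2 : ℝ) : ℂ) - 2 * (τ.re : ℂ)) = ((2 * (∑ i, x i ^ 2) - 2 * τ.re : ℝ) : ℂ) := by push_cast; ring
    rw [this, Complex.ofReal_re]
  rw [this]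
  congr 1
  ring

end LV



section NRM

noncomputable def nuG (n : ℕ) : Measure (Fin n → ℝ) :=
  Measure.pi fun _ : Fin n => ProbabilityTheory.gaussianReal 0 (Real.toNNReal (1 / 2))

instance nuG_prob (n : ℕ) : IsProbabilityMeasure (nuG n) := by
  unfold nuG; infer_instance

lemma ginibre_eq_nuG (n : ℕ) :
    ginibre n 1 = (Measure.pi fun _ : Fin n => nuG n : Measure (Fin n → Fin n → ℝ)) := rfl

lemma gpdf_half (x : ℝ) : ProbabilityTheory.gaussianPDFReal 0 (Real.toNNReal (1 / 2)) x
      = (Real.sqrt Real.pi)⁻¹ * Real.exp (-x ^ 2) := by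
  rw [ProbabilityTheory.gaussianPDFReal]
  rw [Real.coe_toNNReal _ (by norm_num)]
  congr 1
  · congr 2; ring
  · congr 1; ring

noncomputable def rhoG (n : ℕ) (x : Fin n → ℝ) : ℝ :=
  (Real.sqrt Real.pi)⁻¹ ^ n * Real.exp (-(x ⬝ᵥ x))

lemma rhoG_eq (n : ℕ) (x : Fin n → ℝ) :
    rhoG n x = ∏ i, ProbabilityTheory.gaussianPDFReal 0 (Real.toNNReal (1 / 2)) (x i) := by
  simp only [gpdf_half, Finset.prod_mul_distrib, rhoG, Finset.prod_const, Finset.card_univ,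
    Fintype.card_fin, ← Real.exp_sum]
  congr 2
  simp [dotProduct, pow_two]

lemma rhoG_nonneg (n : ℕ) (x : Fin n → ℝ) : 0 ≤ rhoG n x := by unfold rhoG; positivity

lemma rhoG_meas (n : ℕ) : Measurable (rhoG n) := by
  unfold rhoG dotProduct; fun_prop

lemma nuG_density (n : ℕ) :
    nuG n = (volume : Measure (Fin n → ℝ)).withDensity (fun x => ENNReal.ofReal (rhoG n x)) := by
  unfold nuG
  apply Measure.pi_eq
  intro s hs
  have hv : (Real.toNNReal (1 / 2)) ≠ 0 := by norm_num
  rw [withDensity_apply _ (MeasurableSet.univ_pi hs), volume_pi, Measure.restrict_pi_pi]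
  simp only [rhoG_eq]
  have hint : ∀ i : Fin n, Integrable (ProbabilityTheory.gaussianPDFReal 0 (Real.toNNReal (1 / 2)))
      (volume.restrict (s i)) := fun i =>
    (ProbabilityTheory.integrable_gaussianPDFReal 0 _).restrict
  rw [← ofReal_integral_eq_lintegral_ofReal (Integrable.fintype_prod (f := fun _ => ProbabilityTheory.gaussianPDFReal 0 (Real.toNNReal (1 / 2))) hint)
    (Filter.Eventually.of_forall fun x => Finset.prod_nonneg fun i _ =>
      ProbabilityTheory.gaussianPDFReal_nonneg _ _ _)]
  rw [integral_fintype_prod_eq_prod (𝕜 := ℝ) (μ := fun i => volume.restrict (s i)) (fun _ => ProbabilityTheory.gaussianPDFReal 0 (Real.toNNReal (1 / 2)))]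
  rw [ENNReal.ofReal_prod_of_nonneg (fun i _ => integral_nonneg fun x =>
    ProbabilityTheory.gaussianPDFReal_nonneg _ _ _)]
  refine Finset.prod_congr rfl fun i _ => ?_
  rw [ProbabilityTheory.gaussianReal_apply_eq_integral _ hv]

lemma withDensity_preserving {α : Type*} [MeasurableSpace α] (m : Measure α) (f : α → ENNReal)
    (T : α → α) (hT : MeasurePreserving T m m) (hf : Measurable f) (hfT : ∀ x, f (T x) = f x) :
    MeasurePreserving T (m.withDensity f) (m.withDensity f) := by
  refine ⟨hT.measurable, ?_⟩
  ext s hs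
  rw [Measure.map_apply hT.measurable hs, withDensity_apply _ hs,
    withDensity_apply _ (hT.measurable hs)]
  rw [← hT.setLIntegral_comp_preimage hs hf]
  simp only [hfT]

lemma nuG_rot (n : ℕ) (O : Matrix (Fin n) (Fin n) ℝ) (h1 : O * O = 1) (h2 : Oᵀ = O) :
    MeasurePreserving (fun r : Fin n → ℝ => r ᵥ* O) (nuG n) (nuG n) := by
  rw [nuG_density]
  have hd : O.det * O.det = 1 := by rw [← det_mul, h1, det_one]
  have hd0 : O.det ≠ 0 := by intro h; rw [h] at hd; simp at hd
  have habs : |O.det| = 1 := by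
    have : |O.det| * |O.det| = 1 := by rw [← abs_mul, hd, abs_one]
    nlinarith [abs_nonneg O.det]
  have hfun : (fun r : Fin n → ℝ => r ᵥ* O) = toLin' O := by
    funext r
    rw [toLin'_apply, ← vecMul_transpose, h2]
  have hrot : ∀ r : Fin n → ℝ, (r ᵥ* O) ⬝ᵥ (r ᵥ* O) = r ⬝ᵥ r := by
    intro r
    nth_rw 2 [← h2]
    rw [vecMul_transpose, dotProduct_mulVec, vecMul_vecMul, h1, vecMul_one]
  apply withDensity_preserving
  · rw [hfun]
    refine ⟨?_, ?_⟩
    · exact (LinearMap.continuous_of_finiteDimensional _).measurable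
    · rw [Real.map_matrix_volume_pi_eq_smul_volume_pi hd0, abs_inv, habs]; simp
  · exact (rhoG_meas n).ennreal_ofReal
  · intro r; simp only [rhoG, hrot]

lemma householder (n : ℕ) (c d : Fin n → ℝ) (h : c ⬝ᵥ c = d ⬝ᵥ d) :
    ∃ O : Matrix (Fin n) (Fin n) ℝ, O * O = 1 ∧ Oᵀ = O ∧ c ᵥ* O = d := by
  by_cases hcd : c = d
  · exact ⟨1, by simp, by simp, by simp [hcd]⟩
  set w := c - d with hw
  have hw0 : w ⬝ᵥ w ≠ 0 := by
    intro h0; exact hcd (sub_eq_zero.1 (dotProduct_self_eq_zero.1 h0))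
  have hcw : 2 * (c ⬝ᵥ w) = w ⬝ᵥ w := by
    simp only [hw, dotProduct_sub, sub_dotProduct]
    rw [dotProduct_comm d c, h]; ring
  refine ⟨1 - (2 / (w ⬝ᵥ w)) • vecMulVec w w, ?_, ?_, ?_⟩
  · have : vecMulVec w w * vecMulVec w w = (w ⬝ᵥ w) • vecMulVec w w := by
      rw [vecMulVec_mul_vecMulVec]
      ext i j; simp [vecMulVec_apply]; try ring
    simp only [mul_sub, sub_mul, mul_one, one_mul, smul_mul_assoc, mul_smul_comm, this, smul_smul]
    rw [sub_sub, sub_eq_self, ← sub_eq_zero]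
    rw [div_mul_cancel₀ _ hw0]
    module
  · rw [transpose_sub, transpose_smul, transpose_vecMulVec]; simp
  · rw [vecMul_sub, vecMul_one, vecMul_smul, vecMul_vecMulVec, smul_smul]
    have : 2 / (w ⬝ᵥ w) * (c ⬝ᵥ w) = 1 := by
      rw [div_mul_eq_mul_div, hcw, div_self hw0]
    rw [this, one_smul, hw]; simp

end NRM



section NRM2

lemma nuG_tail (n : ℕ) :
    MeasurePreserving (fun (r : Fin (n+1) → ℝ) (j : Fin n) => r j.succ) (nuG (n+1)) (nuG n) := by
  have h := measurePreserving_piFinSuccAbove (n := n) (α := fun _ => ℝ)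
    (fun _ => ProbabilityTheory.gaussianReal 0 (Real.toNNReal (1 / 2))) 0
  exact (measurePreserving_snd (μ := ProbabilityTheory.gaussianReal 0 (Real.toNNReal (1 / 2)))
    (ν := nuG n)).comp h

noncomputable def detPow (K n : ℕ) (M : Fin n → Fin n → ℝ) : ENNReal :=
  ENNReal.ofReal ((Matrix.of M).det ^ K)

lemma detPow_meas (K n : ℕ) : Measurable (detPow K n) := by
  unfold detPow
  have : Continuous fun M : Fin n → Fin n → ℝ => (Matrix.of M).det := by
    apply Continuous.matrix_det
    exact continuous_id
  exact (this.measurable.pow_const K).ennreal_ofReal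

lemma detPow_rot {K n : ℕ} (hK : Even K) (O : Matrix (Fin n) (Fin n) ℝ) (h1 : O * O = 1)
    (M : Fin n → Fin n → ℝ) : detPow K n (fun i => M i ᵥ* O) = detPow K n M := by
  have hd : O.det ^ 2 = 1 := by rw [pow_two, ← det_mul, h1, det_one]
  have : (Matrix.of fun i => M i ᵥ* O) = Matrix.of M * O := by
    ext i j; rfl
  obtain ⟨q, rfl⟩ := hK
  unfold detPow
  rw [this, det_mul, mul_pow, ← two_mul, pow_mul O.det, hd, one_pow, mul_one]

lemma detPow_cons {K n : ℕ} (a : ℝ) (ha : 0 ≤ a) (R : Fin n → Fin (n+1) → ℝ) :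
    detPow K (n+1) (Fin.cons (a • (Pi.single 0 1 : Fin (n+1) → ℝ)) R) =
      ENNReal.ofReal (a ^ K) * detPow K n (fun i j => R i j.succ) := by
  unfold detPow
  rw [← ENNReal.ofReal_mul (by positivity), ← mul_pow]
  congr 2
  rw [det_succ_row_zero, Fin.sum_univ_succ, Finset.sum_eq_zero]
  · simp
    left
    rfl
  · intro j _
    simp

noncomputable def Dl (K n : ℕ) : ENNReal :=
  ∫⁻ M : Fin n → Fin n → ℝ, detPow K n M ∂(Measure.pi fun _ : Fin n => nuG n)

lemma Dl_zero (K : ℕ) : Dl K 0 = 1 := by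
  unfold Dl detPow
  simp

lemma Dl_succ {K : ℕ} (hK : Even K) (n : ℕ) :
    Dl K (n+1) = (∫⁻ c : Fin (n+1) → ℝ, ENNReal.ofReal (Real.sqrt (c ⬝ᵥ c) ^ K) ∂nuG (n+1)) *
      Dl K n := by
  have h := (measurePreserving_piFinSuccAbove (n := n) (α := fun _ => Fin (n+1) → ℝ)
    (fun _ => nuG (n+1)) 0).symm
  unfold Dl
  rw [← h.lintegral_comp (detPow_meas K (n+1))]
  have hcons : ∀ z : (Fin (n+1) → ℝ) × (Fin n → Fin (n+1) → ℝ),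
      (MeasurableEquiv.piFinSuccAbove (fun _ => Fin (n+1) → ℝ) 0).symm z =
        (Fin.cons z.1 z.2 : Fin (n+1) → Fin (n+1) → ℝ) := by
    intro z
    exact Fin.insertNth_zero' z.1 z.2
  have hm : Measurable fun z : (Fin (n+1) → ℝ) × (Fin n → Fin (n+1) → ℝ) =>
      detPow K (n+1) (Fin.cons z.1 z.2) := by
    have := (detPow_meas K (n+1)).comp h.measurable
    convert! this using 1
    funext z
    exact congrArg _ (hcons z).symm
  have e1 : (∫⁻ z, detPow K (n+1) ((MeasurableEquiv.piFinSuccAbove (fun _ => Fin (n+1) → ℝ) 0).symm z)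
      ∂((nuG (n+1)).prod (Measure.pi fun _ : Fin n => nuG (n+1)))) =
      ∫⁻ z, detPow K (n+1) (Fin.cons z.1 z.2)
      ∂((nuG (n+1)).prod (Measure.pi fun _ : Fin n => nuG (n+1))) :=
    lintegral_congr fun z => congrArg _ (hcons z)
  refine e1.trans ?_
  rw [lintegral_prod _ hm.aemeasurable, ← lintegral_mul_const]
  · refine lintegral_congr fun c => ?_
    set a := Real.sqrt (c ⬝ᵥ c)
    have ha : 0 ≤ a := Real.sqrt_nonneg _
    have hcc : 0 ≤ c ⬝ᵥ c := by
      unfold dotProduct; exact Finset.sum_nonneg fun i _ => mul_self_nonneg _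
    obtain ⟨O, h1, h2, h3⟩ := householder (n+1) c (a • (Pi.single 0 1 : Fin (n+1) → ℝ)) (by
      simp [← mul_assoc, a, Real.mul_self_sqrt hcc])
    have hrot := measurePreserving_pi (fun _ : Fin n => nuG (n+1)) (fun _ : Fin n => nuG (n+1))
      (fun _ => nuG_rot (n+1) O h1 h2)
    have e2 : ∀ R : Fin n → Fin (n+1) → ℝ, detPow K (n+1) (Fin.cons c R) =
        detPow K (n+1) (Fin.cons (a • (Pi.single 0 1 : Fin (n+1) → ℝ)) (fun i => R i ᵥ* O)) := by
      intro R
      rw [← detPow_rot hK O h1]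
      congr 1
      funext i
      refine Fin.cases ?_ (fun i => ?_) i
      · simpa using h3
      · simp
    simp only [e2]
    have hm2 : Measurable fun R : Fin n → Fin (n+1) → ℝ =>
      detPow K (n+1) (Fin.cons (a • (Pi.single 0 1 : Fin (n+1) → ℝ)) R) :=
      Measurable.comp (g := fun z : (Fin (n+1) → ℝ) × (Fin n → Fin (n+1) → ℝ) =>
        detPow K (n+1) (Fin.cons z.1 z.2))
        (f := fun R => ((a • (Pi.single 0 1 : Fin (n+1) → ℝ)), R)) hm (by fun_prop)
    rw [hrot.lintegral_comp hm2]
    simp only [detPow_cons a ha]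
    have htail := measurePreserving_pi (fun _ : Fin n => nuG (n+1)) (fun _ : Fin n => nuG n)
      (fun _ => nuG_tail n)
    rw [lintegral_const_mul, htail.lintegral_comp (detPow_meas K n)]
    exact (detPow_meas K n).comp htail.measurable
  · unfold dotProduct
    fun_prop

/-- moments -/
lemma nuG_integral (n : ℕ) (f : ℝ → ℝ) :
    ∫ c, f (Real.sqrt (c ⬝ᵥ c)) ∂nuG n =
      (Real.sqrt Real.pi)⁻¹ ^ n * ∫ y : EuclideanSpace ℝ (Fin n), Real.exp (-‖y‖ ^ 2) * f ‖y‖ := by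
  rw [nuG_density, integral_withDensity_eq_integral_toReal_smul (rhoG_meas n).ennreal_ofReal
    (Filter.Eventually.of_forall fun _ => ENNReal.ofReal_lt_top)]
  rw [← (PiLp.volume_preserving_toLp (Fin n)).integral_comp
    (MeasurableEquiv.toLp 2 _).measurableEmbedding, ← integral_const_mul]
  refine integral_congr_ae (Filter.Eventually.of_forall fun c => ?_)
  have hcc : 0 ≤ c ⬝ᵥ c := by
      unfold dotProduct; exact Finset.sum_nonneg fun i _ => mul_self_nonneg _
  have : ‖(WithLp.toLp 2 c : EuclideanSpace ℝ (Fin n))‖ = Real.sqrt (c ⬝ᵥ c) := by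
    rw [EuclideanSpace.norm_eq]; congr 1; simp [dotProduct, pow_two]
  simp only [this, ENNReal.toReal_ofReal (rhoG_nonneg n c)]
  simp only [rhoG, smul_eq_mul, Real.sq_sqrt hcc]
  ring

lemma radial (n K : ℕ) (hn : 0 < n) :
    ∫ y : EuclideanSpace ℝ (Fin n), Real.exp (-‖y‖ ^ 2) * ‖y‖ ^ K =
      n * (volume : Measure (EuclideanSpace ℝ (Fin n))).real (Metric.ball 0 1) * (1 / 2 * Real.Gamma (((n : ℝ) + K) / 2)) := by
  have : Nonempty (Fin n) := ⟨⟨0, hn⟩⟩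
  rw [integral_fun_norm_addHaar (volume : Measure (EuclideanSpace ℝ (Fin n)))
    (fun r => Real.exp (-r ^ 2) * r ^ K)]
  have := integral_rpow_mul_exp_neg_rpow (p := 2) (q := (n:ℝ) + K - 1) (by norm_num) (by
    have : (0:ℝ) < n := by exact_mod_cast hn
    have : (0:ℝ) ≤ K := by positivity
    linarith)
  rw [show (n:ℝ) + K - 1 + 1 = n + K by ring] at this
  rw [← this, finrank_euclideanSpace, Fintype.card_fin]
  simp only [nsmul_eq_mul, smul_eq_mul]
  rw [mul_assoc]
  congr 2
  refine setIntegral_congr_fun measurableSet_Ioi fun r hr => ?_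
  have : (n:ℝ) + K - 1 = ((n - 1 + K : ℕ) : ℝ) := by
    rw [Nat.cast_add, Nat.cast_sub hn]; push_cast; ring
  simp only [this, Real.rpow_natCast, Real.rpow_two, pow_add]
  ring

lemma nuG_moment (n K : ℕ) (hn : 0 < n) :
    ∫ c, Real.sqrt (c ⬝ᵥ c) ^ K ∂nuG n =
      Real.Gamma (((n : ℝ) + K) / 2) / Real.Gamma ((n : ℝ) / 2) := by
  have hn' : (0:ℝ) < n := by exact_mod_cast hn
  have h0 := nuG_integral n (fun _ => 1)
  have h0' := radial n 0 hn
  simp only [pow_zero, Nat.cast_zero, add_zero] at h0'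
  have hG : 0 < Real.Gamma ((n:ℝ)/2) := Real.Gamma_pos_of_pos (by positivity)
  rw [nuG_integral n (fun r => r ^ K), radial n K hn]
  rw [h0'] at h0
  simp at h0
  rw [eq_div_iff hG.ne']
  have h0 : 1 = (Real.sqrt Real.pi)⁻¹ ^ n * (n * (volume : Measure (EuclideanSpace ℝ (Fin n))).real (Metric.ball 0 1) * (1 / 2 * Real.Gamma ((n:ℝ) / 2))) := by
    exact h0.trans (by rw [inv_pow]; ring)
  linear_combination -(Real.Gamma (((n : ℝ) + K) / 2)) * h0

lemma nuG_lmoment (n K : ℕ) (hn : 0 < n) :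
    ∫⁻ c, ENNReal.ofReal (Real.sqrt (c ⬝ᵥ c) ^ K) ∂nuG n =
      ENNReal.ofReal (Real.Gamma (((n : ℝ) + K) / 2) / Real.Gamma ((n : ℝ) / 2)) := by
  have hn' : (0:ℝ) < n := by exact_mod_cast hn
  rw [← nuG_moment n K hn, ofReal_integral_eq_lintegral_ofReal]
  · by_contra h
    have h1 := integral_undef h
    rw [nuG_moment n K hn] at h1
    have : 0 < Real.Gamma (((n : ℝ) + K) / 2) / Real.Gamma ((n : ℝ) / 2) :=
      div_pos (Real.Gamma_pos_of_pos (by positivity)) (Real.Gamma_pos_of_pos (by positivity))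
    exact this.ne' h1
  · exact Filter.Eventually.of_forall fun c => by positivity

noncomputable def Dv (K n : ℕ) : ℝ :=
  ∏ k : Fin K, Real.Gamma (((n : ℝ) + ((k : ℕ) + 1)) / 2) / Real.Gamma ((((k : ℕ) : ℝ) + 1) / 2)

lemma Dv_pos (K n : ℕ) : 0 < Dv K n := Finset.prod_pos fun k _ =>
  div_pos (Real.Gamma_pos_of_pos (by positivity)) (Real.Gamma_pos_of_pos (by positivity))

lemma Dv_succ (K n : ℕ) : Dv K (n+1) =
    Real.Gamma ((((n+1:ℕ) : ℝ) + K) / 2) / Real.Gamma (((n+1:ℕ) : ℝ) / 2) * Dv K n := by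
  have hg : ∀ k : ℕ, Real.Gamma (((n:ℝ) + (k+1))/2) ≠ 0 := fun k =>
    (Real.Gamma_pos_of_pos (by positivity)).ne'
  have hg1 : ∀ k : ℕ, Real.Gamma (((k:ℝ)+1)/2) ≠ 0 := fun k =>
    (Real.Gamma_pos_of_pos (by positivity)).ne'
  unfold Dv
  rw [Fin.prod_univ_eq_prod_range (fun k => Real.Gamma ((((n+1:ℕ) : ℝ) + ((k : ℕ) + 1)) / 2) / Real.Gamma ((((k : ℕ) : ℝ) + 1) / 2)),
    Fin.prod_univ_eq_prod_range (fun k => Real.Gamma (((n : ℝ) + ((k : ℕ) + 1)) / 2) / Real.Gamma ((((k : ℕ) : ℝ) + 1) / 2))]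
  induction K with
  | zero =>
    simp
    rw [div_self]
    have := hg 0
    simpa using this
  | succ K ih =>
    rw [Finset.prod_range_succ, ih, Finset.prod_range_succ]
    have a1 := hg K
    have a2 := hg1 K
    have a3 := hg 0
    have e1 : (((n+1:ℕ):ℝ) + K)/2 = ((n:ℝ) + (K+1))/2 := by push_cast; ring
    have e2 : (((n+1:ℕ):ℝ) + ((K+1:ℕ):ℝ))/2 = (((n+1:ℕ):ℝ) + ((K:ℝ)+1))/2 := by push_cast; ring
    rw [e1, e2]
    field_simp

lemma Dl_eq {K : ℕ} (hK : Even K) (n : ℕ) : Dl K n = ENNReal.ofReal (Dv K n) := by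
  induction n with
  | zero =>
    rw [Dl_zero]
    unfold Dv
    rw [Finset.prod_eq_one]
    · simp
    · intro k _
      simp only [Nat.cast_zero, zero_add]
      exact div_self (Real.Gamma_pos_of_pos (by positivity)).ne'
  | succ n ih =>
    rw [Dl_succ hK, ih, nuG_lmoment _ _ (Nat.succ_pos n), Dv_succ, ENNReal.ofReal_mul]
    exact (div_pos (Real.Gamma_pos_of_pos (by positivity)) (Real.Gamma_pos_of_pos (by positivity))).le

lemma ginibre_detpow {K : ℕ} (hK : Even K) (n : ℕ) :
    ∫ M, M.det ^ K ∂ginibre n 1 = Dv K n := by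
  have hm : Measurable fun M : Fin n → Fin n → ℝ => (Matrix.of M).det ^ K := by
    have : Continuous fun M : Fin n → Fin n → ℝ => (Matrix.of M).det := by
      apply Continuous.matrix_det
      exact continuous_id
    exact this.measurable.pow_const K
  have h : ∫ M : Fin n → Fin n → ℝ, (Matrix.of M).det ^ K ∂(Measure.pi fun _ : Fin n => nuG n)
      = Dv K n := by
    rw [integral_eq_lintegral_of_nonneg_ae (Filter.Eventually.of_forall fun M => hK.pow_nonneg _)
      hm.aestronglyMeasurable]
    have := Dl_eq hK n
    unfold Dl detPow at this
    rw [this, ENNReal.toReal_ofReal (Dv_pos K n).le]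
  exact h

lemma norm_const (K n : ℕ) (hn : K < 2 * n) :
    (2 : ℝ)⁻¹ ^ K * (∏ k : Fin K, sphereArea (2 * n - ((k : ℕ) + 1)) *
                Real.pi ^ (-(((2 * n : ℕ) : ℝ) - ((k : ℕ) + 1)) / 2)) * Dv K (2 * n - K) =
      ∏ k : Fin K, Real.sqrt Real.pi / Real.Gamma ((((k : ℕ) : ℝ) + 1) / 2) := by
  unfold Dv
  have hg : ∀ k : Fin K, Real.Gamma ((((2 * n - K : ℕ):ℝ) + ((k:ℕ)+1))/2) ≠ 0 := fun k =>
    (Real.Gamma_pos_of_pos (by positivity)).ne'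
  have h1 : (∏ k : Fin K, sphereArea (2 * n - ((k : ℕ) + 1)) *
                Real.pi ^ (-(((2 * n : ℕ) : ℝ) - ((k : ℕ) + 1)) / 2)) =
      ∏ k : Fin K, (2 * (Real.sqrt Real.pi / Real.Gamma ((((2 * n - K : ℕ):ℝ) + ((k:ℕ)+1))/2))) := by
    rw [← Equiv.prod_comp Fin.revPerm]
    refine Finset.prod_congr rfl fun k _ => ?_
    have hk := k.2
    have e1 : 2 * n - (((Fin.revPerm k : Fin K) : ℕ) + 1) = 2 * n - K + (k : ℕ) := by
      simp [Fin.val_rev]; omega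
    have e2 : (((2 * n : ℕ) : ℝ) - (((Fin.revPerm k : Fin K) : ℕ) + 1)) = ((2 * n - K : ℕ) : ℝ) + (k : ℕ) := by
      rw [← Nat.cast_add, ← e1, Nat.cast_sub (by simp [Fin.val_rev]; omega)]; push_cast; ring
    rw [e1, e2, sphereArea]
    have e3 : (((2 * n - K + (k:ℕ) : ℕ) : ℝ) + 1) / 2 = (((2 * n - K : ℕ):ℝ) + ((k:ℕ)+1))/2 := by
      push_cast; ring
    rw [e3]
    have e4 : Real.pi ^ ((((2 * n - K : ℕ):ℝ) + ((k:ℕ)+1))/2) * Real.pi ^ (-(((2 * n - K : ℕ) : ℝ) + (k : ℕ)) / 2) = Real.sqrt Real.pi := by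
      rw [← Real.rpow_add Real.pi_pos, Real.sqrt_eq_rpow]; congr 1; ring
    rw [← e4]; ring
  rw [h1, Finset.prod_mul_distrib, Finset.prod_const, Finset.card_univ, Fintype.card_fin,
    ← mul_assoc, ← mul_pow, inv_mul_cancel₀ two_ne_zero, one_pow, one_mul, ← Finset.prod_mul_distrib]
  refine Finset.prod_congr rfl fun k _ => ?_
  have := hg k
  field_simp

end NRM2



noncomputable def ginE {K : ℕ} (x : Fin K → ℝ) (d : ℕ) : ℝ :=
  ∫ M, ∏ m : Fin K, (M - x m • (1 : Matrix (Fin d) (Fin d) ℝ)).det ∂(ginibre d 1)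

lemma ratio_eq {K : ℕ} (hK : Even K) (x : Fin K → ℝ) (p : ℕ) (hp : 0 < p) :
    ((ginE x (2 * p) / Dv K (2 * p) : ℝ) : ℂ) =
      (∫ G : Fin K → Fin K → ℂ, wt x (Real.sqrt (2 * p))⁻¹ G ^ p) /
      ((∫ G : Fin K → Fin K → ℂ, WW G ^ p : ℝ) : ℂ) := by
  obtain ⟨c, hc⟩ := duality2 (K := K) p hp
  have h1 := hc x
  have h0 := hc (fun _ => 0)
  have e0 : ∫ M, ∏ m : Fin K, (M - (fun _ : Fin K => (0:ℝ)) m • (1 : Matrix (Fin (2*p)) (Fin (2*p)) ℝ)).det ∂ginibre (2*p) 1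
      = Dv K (2 * p) := by
    rw [← ginibre_detpow hK]
    refine integral_congr_ae (Filter.Eventually.of_forall fun M => ?_)
    simp
  have e1 : ∀ G : Fin K → Fin K → ℂ, wt (fun _ => 0) (Real.sqrt (2 * p))⁻¹ G = WW G := by
    intro G
    rw [← wt_zero hK (fun _ => 0) G]
    simp only [wt, mul_zero]
  have e2 : ∫ G : Fin K → Fin K → ℂ, wt (fun _ => 0) (Real.sqrt (2 * p))⁻¹ G ^ p =
      ((∫ G : Fin K → Fin K → ℂ, WW G ^ p : ℝ) : ℂ) := by
    rw [← integral_complex_ofReal]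
    refine integral_congr_ae (Filter.Eventually.of_forall fun G => ?_)
    simp only [e1]
    push_cast; rfl
  rw [e0, e2] at h0
  have hD : ((Dv K (2 * p) : ℝ) : ℂ) ≠ 0 := Complex.ofReal_ne_zero.2 (Dv_pos _ _).ne'
  have hc0 : c ≠ 0 := by rintro rfl; simp at h0; exact (Dv_pos _ _).ne' h0
  change ((ginE x (2 * p) : ℝ) : ℂ) = _ at h1
  rw [Complex.ofReal_div, h1, h0, mul_div_mul_left _ _ hc0]

lemma ratio_tendsto {K : ℕ} (hK : Even K) (μ : Measure (Matrix.unitaryGroup (Fin K) ℂ))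
    [μ.IsHaarMeasure] [IsProbabilityMeasure μ] (x : Fin K → ℝ) (I : ℝ)
    (hI : I = ∫ U : Matrix.unitaryGroup (Fin K) ℂ,
          Real.exp (-(1 / 2) *
            (Matrix.trace
              ((((U : Matrix (Fin K) (Fin K) ℂ) * Matrix.diagonal (fun i => (x i : ℂ)) *
                  (U : Matrix (Fin K) (Fin K) ℂ)ᴴ) -
                sympJ K * ((U : Matrix (Fin K) (Fin K) ℂ) *
                  Matrix.diagonal (fun i => (x i : ℂ)) *
                  (U : Matrix (Fin K) (Fin K) ℂ)ᴴ)ᵀ * (sympJ K)ᵀ) ^ 2)).re) ∂μ) :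
    Filter.Tendsto (fun p : ℕ => ginE x (2 * p) / Dv K (2 * p)) Filter.atTop
      (nhds (Real.exp (∑ i, x i ^ 2) * I)) := by
  have h := laplace μ hK x _ (fun G hG => L_value hK μ x G hG)
  have hL : ∫ U, Complex.exp ((AU U * XD x * (AU U)ᴴ * XD x).trace) ∂μ =
      ((Real.exp (∑ i, x i ^ 2) * I : ℝ) : ℂ) := by
    simp only [final_integrand hK]
    rw [integral_complex_ofReal, integral_const_mul, hI]
  rw [hL] at h
  have h2 := (Complex.continuous_re.tendsto _).comp h
  rw [Complex.ofReal_re] at h2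
  refine h2.congr' ?_
  filter_upwards [Filter.eventually_gt_atTop 0] with p hp
  rw [Function.comp_apply, ← ratio_eq hK x p hp, Complex.ofReal_re]

/-- Theorem 3 of the paper (Haar-integral form): for even `K ≥ 2`, there is a constant
`C_K > 0` such that for all `x₁ < … < x_K`, the limit along even `N → ∞` of
`2^{−K}·(∏_{k=1}^K |S_{N−k}| π^{−(N−k)/2} e^{−x_k²})·𝔼_{N−K}[∏_{m=1}^K det(M − x_m I)]`
equals `C_K·∫_{U(K)} e^{−(1/2)Tr((H−H^R)²)} dμ_H(U)`, with `H = UXUᴴ`, `X = diag(x)`,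
`H^R = JHᵀJᵀ`, and `μ_H` the Haar probability measure on `U(K)`. -/
theorem modified_density_haar_limit (K : ℕ) (hK : 2 ≤ K) (hKeven : Even K)
    (μ : Measure (Matrix.unitaryGroup (Fin K) ℂ)) [μ.IsHaarMeasure]
    [IsProbabilityMeasure μ] :
    ∃ C : ℝ, 0 < C ∧ ∀ x : Fin K → ℝ, StrictMono x →
      Filter.Tendsto
        (fun n : ℕ =>
          (2 : ℝ)⁻¹ ^ K *
            (∏ k : Fin K,
              sphereArea (2 * n - ((k : ℕ) + 1)) *
                Real.pi ^ (-(((2 * n : ℕ) : ℝ) - ((k : ℕ) + 1)) / 2) *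
                Real.exp (-x k ^ 2)) *
            ∫ M, ∏ m : Fin K,
              (M - x m • (1 : Matrix (Fin (2 * n - K)) (Fin (2 * n - K)) ℝ)).det
              ∂(ginibre (2 * n - K) 1))
        Filter.atTop
        (nhds (C * ∫ U : Matrix.unitaryGroup (Fin K) ℂ,
          Real.exp (-(1 / 2) *
            (Matrix.trace
              ((((U : Matrix (Fin K) (Fin K) ℂ) * Matrix.diagonal (fun i => (x i : ℂ)) *
                  (U : Matrix (Fin K) (Fin K) ℂ)ᴴ) -
                sympJ K * ((U : Matrix (Fin K) (Fin K) ℂ) *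
                  Matrix.diagonal (fun i => (x i : ℂ)) *
                  (U : Matrix (Fin K) (Fin K) ℂ)ᴴ)ᵀ * (sympJ K)ᵀ) ^ 2)).re) ∂μ)) := by
  refine ⟨∏ k : Fin K, Real.sqrt Real.pi / Real.Gamma ((((k : ℕ) : ℝ) + 1) / 2),
    Finset.prod_pos fun k _ => div_pos (Real.sqrt_pos.2 Real.pi_pos)
      (Real.Gamma_pos_of_pos (by positivity)), ?_⟩
  intro x _
  set C := ∏ k : Fin K, Real.sqrt Real.pi / Real.Gamma ((((k : ℕ) : ℝ) + 1) / 2) with hC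
  set S := ∑ i, x i ^ 2 with hS
  have hlim := ratio_tendsto hKeven μ x _ rfl
  obtain ⟨q, hq⟩ := hKeven
  rw [← Filter.tendsto_add_atTop_iff_nat q]
  have hlim2 := (hlim.const_mul (C * Real.exp (-S)))
  have hval : ∀ I : ℝ, C * Real.exp (-S) * (Real.exp S * I) = C * I := by
    intro I
    rw [mul_assoc, ← mul_assoc (Real.exp (-S)), ← Real.exp_add]; simp
  rw [hval] at hlim2
  refine Filter.Tendsto.congr' ?_ hlim2
  filter_upwards [Filter.eventually_gt_atTop 0] with p hp
  have hd : 2 * (p + q) - K = 2 * p := by omega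
  change _ = _ * ginE x (2 * (p + q) - K)
  have hn := norm_const K (p + q) (by omega)
  rw [hd] at hn ⊢
  rw [hC, ← hn, Finset.prod_mul_distrib (g := fun k : Fin K => Real.exp (-x k ^ 2)), ← Real.exp_sum,
    Finset.sum_neg_distrib, ← hS]
  have := (Dv_pos K (2 * p)).ne'
  field_simp
end

section
/- Fix t > 0, τ > 0 and x, y ∈ ℝ. Define, for N ≥ 3, ρ̃^{(N)}(y,x) = (2|S_{N−1}||S_{N−2}| / (t²(2π)^N)) ∫₀¹ dz (1−z²)^{(N−3)/2} (τ/t + 1−z²)^{−N/2} exp(−(x² − 2z²xy + y²(1+τ/t)) / (τ + t(1−z²))) · [ (x − y(1−z²)(t+τ)/(τ+t(1−z²))) (y − x(1−z²)t/(τ+t(1−z²))) E_{N−2}(2xy/t) + ((N−1)tτz²/(2(τ+t(1−z²)))) E_{N−2}(2xy/t) − ((N−2)tτz²/(2(τ+t(1−z²)))) (2xy/t) E_{N−3}(2xy/t) ]. Then lim_{N→∞} ρ̃^{(N)}(y,x) = 0. (This is the vanishing of the two-time modified eigenvalue density at any fixed positive time lag τ.) -/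
open MeasureTheory Nat intervalIntegral

/-- The truncated exponential polynomial `E_n(u) = n! Σ_{k=0}^n u^k/k!`. -/
noncomputable def Epoly (n : ℕ) (u : ℝ) : ℝ :=
  (n ! : ℝ) * ∑ k ∈ Finset.range (n + 1), u ^ k / (k ! : ℝ)

/-- The exact finite-`N` two-time modified density `ρ̃^{(N)}_{t,t+τ}(y,x)`, reduced to a
one-dimensional integral over `z ∈ [0,1]`. -/
noncomputable def rhoMod (N : ℕ) (t τ y x : ℝ) : ℝ :=
  2 * sphereArea (N - 1) * sphereArea (N - 2) / (t ^ 2 * (2 * Real.pi) ^ N) *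
    ∫ z in (0 : ℝ)..1,
      (1 - z ^ 2) ^ (((N : ℝ) - 3) / 2) * (τ / t + (1 - z ^ 2)) ^ (-(N : ℝ) / 2) *
        Real.exp (-(x ^ 2 - 2 * z ^ 2 * x * y + y ^ 2 * (1 + τ / t)) /
          (τ + t * (1 - z ^ 2))) *
        ((x - y * (1 - z ^ 2) * (t + τ) / (τ + t * (1 - z ^ 2))) *
            (y - x * (1 - z ^ 2) * t / (τ + t * (1 - z ^ 2))) * Epoly (N - 2) (2 * x * y / t) +
          ((N : ℝ) - 1) * t * τ * z ^ 2 / (2 * (τ + t * (1 - z ^ 2))) *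
            Epoly (N - 2) (2 * x * y / t) -
          ((N : ℝ) - 2) * t * τ * z ^ 2 / (2 * (τ + t * (1 - z ^ 2))) * (2 * x * y / t) *
            Epoly (N - 3) (2 * x * y / t))


lemma Epoly_abs_le (n : ℕ) (u : ℝ) : |Epoly n u| ≤ (n ! : ℝ) * Real.exp |u| := by
  unfold Epoly
  rw [abs_mul, abs_of_nonneg (by positivity : (0:ℝ) ≤ (n ! : ℝ))]
  gcongr
  calc |∑ k ∈ Finset.range (n + 1), u ^ k / (k ! : ℝ)|
      ≤ ∑ k ∈ Finset.range (n + 1), |u ^ k / (k ! : ℝ)| := Finset.abs_sum_le_sum_abs _ _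
    _ = ∑ k ∈ Finset.range (n + 1), |u| ^ k / (k ! : ℝ) := by
        refine Finset.sum_congr rfl fun k _ => ?_
        rw [abs_div, abs_pow, abs_of_nonneg (by positivity : (0:ℝ) ≤ (k ! : ℝ))]
    _ ≤ Real.exp |u| := Real.sum_le_exp_of_nonneg (abs_nonneg u) _

lemma prefactor_eq (n : ℕ) (t : ℝ) (ht : 0 < t) :
    2 * sphereArea (n + 2) * sphereArea (n + 1) / (t ^ 2 * (2 * Real.pi) ^ (n + 3)) =
      2 / (Real.pi * t ^ 2 * ((n + 1)! : ℝ)) := by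
  unfold sphereArea
  have hpi := Real.pi_pos
  have hd := Real.Gamma_mul_Gamma_add_half (((n : ℝ) + 2) / 2)
  have e1 : 2 * (((n : ℝ) + 2) / 2) = ((n + 1 : ℕ) : ℝ) + 1 := by push_cast; ring
  rw [e1, Real.Gamma_nat_eq_factorial] at hd
  have e2 : ((n : ℝ) + 2) / 2 + 1 / 2 = (((n + 2 : ℕ) : ℝ) + 1) / 2 := by push_cast; ring
  have e3 : ((n : ℝ) + 2) / 2 = (((n + 1 : ℕ) : ℝ) + 1) / 2 := by push_cast; ring
  rw [e2, e3] at hd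
  have e4 : (1 : ℝ) - (((n + 1 : ℕ) : ℝ) + 1) = -((n + 1 : ℕ) : ℝ) := by ring
  rw [e4, Real.rpow_neg (by norm_num), Real.rpow_natCast] at hd
  have g1 : 0 < Real.Gamma ((((n + 1 : ℕ) : ℝ) + 1) / 2) := Real.Gamma_pos_of_pos (by positivity)
  have g2 : 0 < Real.Gamma ((((n + 2 : ℕ) : ℝ) + 1) / 2) := Real.Gamma_pos_of_pos (by positivity)
  have p1 : Real.pi ^ ((((n + 2 : ℕ) : ℝ) + 1) / 2) * Real.pi ^ ((((n + 1 : ℕ) : ℝ) + 1) / 2)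
      = Real.pi ^ (n + 2) * √Real.pi := by
    rw [← Real.rpow_add hpi, Real.sqrt_eq_rpow, ← Real.rpow_natCast, ← Real.rpow_add hpi]
    congr 1; push_cast; ring
  set G1 := Real.Gamma ((((n + 1 : ℕ) : ℝ) + 1) / 2)
  set G2 := Real.Gamma ((((n + 2 : ℕ) : ℝ) + 1) / 2)
  set P1 := Real.pi ^ ((((n + 1 : ℕ) : ℝ) + 1) / 2)
  set P2 := Real.pi ^ ((((n + 2 : ℕ) : ℝ) + 1) / 2)
  have hf : (0:ℝ) < ((n + 1)! : ℝ) := by positivity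
  have hs : 0 < √Real.pi := Real.sqrt_pos.mpr hpi
  have : 2 * (2 * P2 / G2) * (2 * P1 / G1) / (t ^ 2 * (2 * Real.pi) ^ (n + 3))
      = 8 * (P2 * P1) / ((G1 * G2) * (t ^ 2 * (2 * Real.pi) ^ (n + 3))) := by
    field_simp; ring
  rw [this, p1, hd]
  field_simp
  ring

lemma integral_bound (n : ℕ) (t τ x y : ℝ) (ht : 0 < t) (hτ : 0 < τ) (z : ℝ) (h0 : 0 ≤ z)
    (h1 : z ≤ 1) :
    |(1 - z ^ 2) ^ ((((n + 3 : ℕ) : ℝ) - 3) / 2) *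
        (τ / t + (1 - z ^ 2)) ^ (-((n + 3 : ℕ) : ℝ) / 2) *
        Real.exp (-(x ^ 2 - 2 * z ^ 2 * x * y + y ^ 2 * (1 + τ / t)) /
          (τ + t * (1 - z ^ 2))) *
        ((x - y * (1 - z ^ 2) * (t + τ) / (τ + t * (1 - z ^ 2))) *
            (y - x * (1 - z ^ 2) * t / (τ + t * (1 - z ^ 2))) * Epoly (n + 1) (2 * x * y / t) +
          (((n + 3 : ℕ) : ℝ) - 1) * t * τ * z ^ 2 / (2 * (τ + t * (1 - z ^ 2))) *
            Epoly (n + 1) (2 * x * y / t) -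
          (((n + 3 : ℕ) : ℝ) - 2) * t * τ * z ^ 2 / (2 * (τ + t * (1 - z ^ 2))) *
            (2 * x * y / t) *
            Epoly n (2 * x * y / t))| ≤
      (√(1 / (1 + τ / t))) ^ n * (τ / t) ^ (-(3 / 2) : ℝ) * (((n + 1)! : ℝ) *
        Real.exp |2 * x * y / t| * ((|x| + |y| * ((t + τ) / τ)) * (|y| + |x| * (t / τ)) +
          (n + 2) * (t / 2) + t / 2 * |2 * x * y / t|)) := by
  obtain ⟨a, ha⟩ : ∃ a, a = 1 - z ^ 2 := ⟨_, rfl⟩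
  have ha0 : 0 ≤ a := by rw [ha]; nlinarith
  have ha1 : a ≤ 1 := by rw [ha]; nlinarith
  have hz : z ^ 2 = 1 - a := by rw [ha]; ring
  have hz1 : z ^ 2 ≤ 1 := by nlinarith
  have hz0 : 0 ≤ z ^ 2 := sq_nonneg z
  rw [← ha]
  set u := 2 * x * y / t
  obtain ⟨r, hr⟩ : ∃ r, r = τ / t := ⟨_, rfl⟩
  have hr0 : 0 < r := by rw [hr]; positivity
  rw [← hr]
  obtain ⟨D, hD⟩ : ∃ D, D = τ + t * a := ⟨_, rfl⟩
  have hDτ : τ ≤ D := by rw [hD]; nlinarith [mul_nonneg ht.le ha0]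
  have hD0 : 0 < D := by linarith
  rw [← hD]
  have E1 := Epoly_abs_le (n + 1) u
  have E2 := Epoly_abs_le n u
  -- power part
  have B1 : |a ^ ((((n + 3 : ℕ) : ℝ) - 3) / 2) * (r + a) ^ (-((n + 3 : ℕ) : ℝ) / 2)| ≤
      (√(1 / (1 + r))) ^ n * r ^ (-(3 / 2) : ℝ) := by
    have hra : 0 < r + a := by linarith
    rw [abs_of_nonneg (by positivity)]
    have e1 : (((n + 3 : ℕ) : ℝ) - 3) / 2 = (n : ℝ) / 2 := by push_cast; ring
    have e2 : -((n + 3 : ℕ) : ℝ) / 2 = -((n : ℝ) / 2) + (-(3 / 2)) := by push_cast; ring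
    rw [e1, e2, Real.rpow_add hra, Real.rpow_neg hra.le, ← mul_assoc, ← div_eq_mul_inv,
      ← Real.div_rpow ha0 hra.le]
    have e3 : (√(1 / (1 + r))) ^ n = (1 / (1 + r)) ^ ((n : ℝ) / 2) := by
      rw [Real.sqrt_eq_rpow, ← Real.rpow_natCast, ← Real.rpow_mul (by positivity)]
      congr 1; ring
    rw [e3]
    have e4 : a / (r + a) ≤ 1 / (1 + r) := by
      rw [div_le_div_iff₀ hra (by linarith)]; nlinarith
    have e5 : (r + a) ^ (-(3 / 2) : ℝ) ≤ r ^ (-(3 / 2) : ℝ) :=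
      Real.rpow_le_rpow_of_nonpos hr0 (by linarith) (by norm_num)
    gcongr
  have B2 : |Real.exp (-(x ^ 2 - 2 * z ^ 2 * x * y + y ^ 2 * (1 + r)) / D)| ≤ 1 := by
    rw [abs_of_pos (Real.exp_pos _), Real.exp_le_one_iff]
    apply div_nonpos_of_nonpos_of_nonneg _ hD0.le
    nlinarith [mul_nonneg hz0 (sq_nonneg (x - y)), mul_nonneg ha0 (sq_nonneg x),
      mul_nonneg ha0 (sq_nonneg y), mul_nonneg hr0.le (sq_nonneg y)]
  have C1 : |x - y * a * (t + τ) / D| ≤ |x| + |y| * ((t + τ) / τ) := by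
    refine (abs_sub _ _).trans ?_
    have : |y * a * (t + τ) / D| = |y| * (a * (t + τ) / D) := by
      rw [mul_assoc, mul_div_assoc, abs_mul,
        abs_of_nonneg (by positivity : 0 ≤ a * (t + τ) / D)]
    rw [this]
    gcongr
    nlinarith
  have C2 : |y - x * a * t / D| ≤ |y| + |x| * (t / τ) := by
    refine (abs_sub _ _).trans ?_
    have : |x * a * t / D| = |x| * (a * t / D) := by
      rw [mul_assoc, mul_div_assoc, abs_mul,
        abs_of_nonneg (by positivity : 0 ≤ a * t / D)]
    rw [this]
    gcongr
    nlinarith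
  have C3 : t * τ * z ^ 2 / (2 * D) ≤ t / 2 := by
    rw [div_le_div_iff₀ (by positivity) (by norm_num)]
    have : τ * z ^ 2 ≤ D := by nlinarith
    nlinarith
  have C30 : 0 ≤ t * τ * z ^ 2 / (2 * D) := by positivity
  set w := t * τ * z ^ 2 / (2 * D) with hw
  have f1 : (((n + 3 : ℕ) : ℝ) - 1) * t * τ * z ^ 2 / (2 * D) = ((n : ℝ) + 2) * w := by
    rw [hw]; push_cast; ring
  have f2 : (((n + 3 : ℕ) : ℝ) - 2) * t * τ * z ^ 2 / (2 * D) = ((n : ℝ) + 1) * w := by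
    rw [hw]; push_cast; ring
  rw [f1, f2]
  have F : ((n + 1)! : ℝ) = ((n : ℝ) + 1) * (n ! : ℝ) := by
    rw [Nat.factorial_succ]; push_cast; ring
  have hn : (0:ℝ) ≤ n := Nat.cast_nonneg n
  rw [abs_mul, abs_mul (a ^ ((((n + 3 : ℕ) : ℝ) - 3) / 2) * _)]
  have hB : ∀ p q s b e c : ℝ, 0 ≤ p → 0 ≤ e → 0 ≤ c → p ≤ q → e ≤ 1 → c ≤ s →
      p * e * c ≤ q * s := by
    intro p q s b e c hp he hc hpq he1 hcs
    calc p * e * c ≤ p * 1 * c := by gcongr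
      _ ≤ q * s := by rw [mul_one]; exact mul_le_mul hpq hcs hc (hp.trans hpq)
  refine hB _ _ _ 0 _ _ (abs_nonneg _) (abs_nonneg _) (abs_nonneg _) B1 B2 ?_
  refine (abs_sub _ _).trans ?_
  refine (add_le_add (abs_add_le _ _) le_rfl).trans ?_
  simp only [abs_mul]
  rw [abs_of_nonneg C30, abs_of_nonneg (by linarith : (0:ℝ) ≤ n + 2),
    abs_of_nonneg (by linarith : (0:ℝ) ≤ n + 1)]
  have G1 : |x - y * a * (t + τ) / D| * |y - x * a * t / D| * |Epoly (n + 1) u| ≤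
      (|x| + |y| * ((t + τ) / τ)) * (|y| + |x| * (t / τ)) * (((n + 1)! : ℝ) * Real.exp |u|) := by
    gcongr
  have G2 : ((n : ℝ) + 2) * w * |Epoly (n + 1) u| ≤
      ((n : ℝ) + 2) * (t / 2) * (((n + 1)! : ℝ) * Real.exp |u|) := by
    gcongr
  have G3 : ((n : ℝ) + 1) * w * |u| * |Epoly n u| ≤
      ((n : ℝ) + 1) * (t / 2) * |u| * ((n ! : ℝ) * Real.exp |u|) := by
    gcongr
  have G4 : ((n : ℝ) + 1) * (t / 2) * |u| * ((n ! : ℝ) * Real.exp |u|) =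
      (t / 2) * |u| * (((n + 1)! : ℝ) * Real.exp |u|) := by rw [F]; ring
  rw [G4] at G3
  linarith

/-- Vanishing of the two-time modified eigenvalue density at any fixed positive time lag `τ`:
`lim_{N→∞} ρ̃^{(N)}_{t,t+τ}(y,x) = 0`. -/
theorem rhoMod_tendsto_zero (t τ : ℝ) (ht : 0 < t) (hτ : 0 < τ) (x y : ℝ) :
    Filter.Tendsto (fun N : ℕ => rhoMod N t τ y x) Filter.atTop (nhds 0) := by
  rw [← Filter.tendsto_add_atTop_iff_nat 3]
  obtain ⟨K, hK⟩ : ∃ K, K = (|x| + |y| * ((t + τ) / τ)) * (|y| + |x| * (t / τ)) +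
    t + t / 2 * |2 * x * y / t| := ⟨_, rfl⟩
  obtain ⟨s, hs⟩ : ∃ s, s = √(1 / (1 + τ / t)) := ⟨_, rfl⟩
  obtain ⟨c, hc⟩ : ∃ c, c = 2 / (Real.pi * t ^ 2) * (τ / t) ^ (-(3 / 2) : ℝ) *
    Real.exp |2 * x * y / t| := ⟨_, rfl⟩
  have hr0 : 0 < τ / t := by positivity
  have hs0 : 0 ≤ s := by rw [hs]; positivity
  have hs1 : s < 1 := by
    rw [hs, Real.sqrt_lt' one_pos, one_pow, div_lt_one (by linarith)]; linarith
  have hlim : Filter.Tendsto (fun n : ℕ => c * K * s ^ n + c * (t / 2) * ((n : ℝ) * s ^ n))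
      Filter.atTop (nhds 0) := by
    have l1 := (tendsto_pow_atTop_nhds_zero_of_lt_one hs0 hs1).const_mul (c * K)
    have l2 := (tendsto_self_mul_const_pow_of_lt_one hs0 hs1).const_mul (c * (t / 2))
    simpa using l1.add l2
  refine squeeze_zero_norm (fun n => ?_) hlim
  unfold rhoMod
  have i1 : n + 3 - 1 = n + 2 := rfl
  have i2 : n + 3 - 2 = n + 1 := rfl
  have i3 : n + 3 - 3 = n := rfl
  rw [i1, i2, i3, prefactor_eq n t ht, norm_mul]
  have hpi := Real.pi_pos
  have hf : (0:ℝ) < ((n + 1)! : ℝ) := by positivity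
  rw [Real.norm_of_nonneg (by positivity : 0 ≤ 2 / (Real.pi * t ^ 2 * ((n + 1)! : ℝ)))]
  have hb := fun (z : ℝ) (hz : z ∈ Set.Ioc (0:ℝ) 1) =>
    integral_bound n t τ x y ht hτ z hz.1.le hz.2
  simp only [← Set.uIoc_of_le (zero_le_one (α := ℝ)), ← Real.norm_eq_abs (_ * _ * _ * _)] at hb
  have hI := intervalIntegral.norm_integral_le_of_norm_le_const hb
  refine (mul_le_mul_of_nonneg_left hI (by positivity)).trans (le_of_eq ?_)
  rw [← hs, hc, hK]
  simp only [sub_zero, abs_one, mul_one]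
  generalize (τ / t) ^ (-(3 / 2) : ℝ) = R
  generalize Real.exp |2 * x * y / t| = X
  generalize |2 * x * y / t| = U
  field_simp
  ring
end
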